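/- arXiv:2412.20900 — 2 statements merged into one kernel-verified Lean document; each statement's English description precedes it below -/
import Mathlib

section
/- Let X be a real Banach space. Then every closed subspace of X is locally complemented in X if and only if X is isomorphic to a Hilbert space. -/
universe u

variable (X : Type u) [NormedAddCommGroup X] [NormedSpace ℝ X]

/-- `f` is a real inner product on `X`: symmetric, bilinear, positive definite. -/
def IsRealInner (f : X → X → ℝ) : Prop :=
  (∀ x y, f x y = f y x) ∧
  (∀ (a : ℝ) (x y : X), f (a • x) y = a * f x y) ∧
  (∀ x y z : X, f (x + y) z = f x z + f y z) ∧
  (∀ x : X, x ≠ 0 → 0 < f x x)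

/-- `X` is isomorphic to a Hilbert space: there is a real inner product on `X` whose
induced norm is equivalent to the given norm. -/
def IsomorphicToHilbert : Prop :=
  ∃ f : X → X → ℝ, IsRealInner X f ∧
    ∃ a b : ℝ, 0 < a ∧ 0 < b ∧ ∀ x : X, a * ‖x‖ ^ 2 ≤ f x x ∧ f x x ≤ b * ‖x‖ ^ 2

/-- `Z` is locally `c`-complemented in `X`: for every finite-dimensional subspace `M` of
`X` there is a continuous linear map `f : M → Z` with `‖f‖ ≤ c` fixing `M ∩ Z`. -/
def LocallyComplemented (Z : Submodule ℝ X) (c : ℝ) : Prop :=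
  ∀ M : Submodule ℝ X, FiniteDimensional ℝ M →
    ∃ f : M →L[ℝ] Z, ‖f‖ ≤ c ∧ ∀ x : M, (x : X) ∈ Z → ((f x : Z) : X) = (x : X)

section Converse

variable {X}

/-- The bilinear form attached to a real inner product. -/
noncomputable def IsRealInner.bilin {f : X → X → ℝ} (hf : IsRealInner X f) :
    LinearMap.BilinForm ℝ X :=
  LinearMap.mk₂ ℝ f hf.2.2.1 hf.2.1
    (fun x y z => by rw [hf.1, hf.2.2.1, hf.1 y, hf.1 z])
    (fun a x y => by rw [hf.1, hf.2.1, hf.1 y, smul_eq_mul])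

theorem IsomorphicToHilbert.locallyComplemented (h : IsomorphicToHilbert X)
    (Z : Submodule ℝ X) : ∃ c : ℝ, 0 < c ∧ LocallyComplemented X Z c := by
  obtain ⟨f, hf, a, b, ha, hb, hab⟩ := h
  refine ⟨√(b / a), Real.sqrt_pos.2 (div_pos hb ha), fun M hM => ?_⟩
  let B : LinearMap.BilinForm ℝ M := hf.bilin.restrict M
  have hB : ∀ x y : M, B x y = f x y := fun x y => rfl
  let W : Submodule ℝ M := Z.comap M.subtype
  have hrefl : B.IsRefl := fun x y hxy => by rw [hB] at *; rw [hf.1, hxy]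
  have hnd : (B.restrict W).Nondegenerate := by
    have key : ∀ x : W, (B.restrict W) x x = 0 → x = 0 := by
      intro x hx
      by_contra hne
      have hx0 : ((x : M) : X) ≠ 0 := by simpa using hne
      have : 0 < f ((x : M) : X) ((x : M) : X) := hf.2.2.2 _ hx0
      exact this.ne' hx
    exact ⟨fun x hx => key x (hx x), fun x hx => key x (hx x)⟩
  have hc := LinearMap.BilinForm.isCompl_orthogonal_of_restrict_nondegenerate hrefl hnd
  let P : M →ₗ[ℝ] W := W.projectionOnto (B.orthogonal W) hc
  have hPid : ∀ w : W, P w = w := Submodule.projectionOnto_apply_left hc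
  let j : W →ₗ[ℝ] Z := (M.subtype.comp W.subtype).codRestrict Z fun w => w.2
  have hbound : ∀ x : M, ‖(j ∘ₗ P) x‖ ≤ √(b / a) * ‖x‖ := by
    intro x
    have h0 : P (x - P x) = 0 := by rw [map_sub, hPid, sub_self]
    have h1 : x - P x ∈ B.orthogonal W :=
      (Submodule.projectionOnto_apply_eq_zero_iff hc).1 h0
    have h2 : B (P x) (x - P x) = 0 := h1 _ (P x).2
    have h2' : B (x - P x) (P x) = 0 := hrefl _ _ h2
    have h3 : B x x = B (P x) (P x) + B (x - P x) (x - P x) := by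
      simp only [map_sub, LinearMap.sub_apply] at h2 h2' ⊢
      linarith
    have h4 : 0 ≤ B (x - P x) (x - P x) := by
      rw [hB]
      exact le_trans (by positivity) (hab _).1
    have h5 := (hab ((P x : M) : X)).1
    have h6 := (hab (x : X)).2
    rw [hB, hB] at h3
    have h7 : a * ‖((P x : M) : X)‖ ^ 2 ≤ b * ‖(x : X)‖ ^ 2 := by linarith
    have h8 : ‖((P x : M) : X)‖ ^ 2 ≤ (√(b / a) * ‖(x : X)‖) ^ 2 := by
      rw [mul_pow, Real.sq_sqrt (by positivity), div_mul_eq_mul_div, le_div_iff₀ ha]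
      linarith
    exact le_of_sq_le_sq h8 (by positivity)
  refine ⟨(j ∘ₗ P).mkContinuous _ hbound, LinearMap.mkContinuous_norm_le _ (by positivity) _, ?_⟩
  intro x hx
  have := hPid ⟨x, hx⟩
  change ((P x : M) : X) = x
  rw [this]

end Converse

section Uniform

variable {X}

/-- `Z` admits, on every finite-dimensional subspace, a linear map into `Z` that is bounded by
`c` there and fixes the points of `Z`. -/
def LocalProj (Z : Submodule ℝ X) (c : ℝ) : Prop :=
  ∀ M : Submodule ℝ X, FiniteDimensional ℝ M → ∃ P : X →ₗ[ℝ] X,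
    ∀ x ∈ M, P x ∈ Z ∧ (x ∈ Z → P x = x) ∧ ‖P x‖ ≤ c * ‖x‖

theorem LocallyComplemented.localProj {Z : Submodule ℝ X} {c : ℝ}
    (h : LocallyComplemented X Z c) : LocalProj Z c := by
  intro M hM
  obtain ⟨f, hf, hfix⟩ := h M hM
  obtain ⟨P, hP⟩ := LinearMap.exists_extend (Z.subtype ∘ₗ (f : M →ₗ[ℝ] Z))
  have hP' : ∀ x (hx : x ∈ M), P x = (f ⟨x, hx⟩ : X) := fun x hx =>
    LinearMap.congr_fun hP ⟨x, hx⟩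
  refine ⟨P, fun x hx => ?_⟩
  rw [hP' x hx]
  refine ⟨(f _).2, fun hz => hfix ⟨x, hx⟩ hz, ?_⟩
  exact (f.le_opNorm ⟨x, hx⟩).trans (mul_le_mul_of_nonneg_right hf (norm_nonneg _))

theorem LocalProj.mono {Z : Submodule ℝ X} {c d : ℝ} (h : LocalProj Z c) (hcd : c ≤ d) :
    LocalProj Z d := by
  intro M hM
  obtain ⟨P, hP⟩ := h M hM
  exact ⟨P, fun x hx => ⟨(hP x hx).1, (hP x hx).2.1,
    (hP x hx).2.2.trans (mul_le_mul_of_nonneg_right hcd (norm_nonneg _))⟩⟩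

/-- The common kernel of finitely many functionals. -/
def jointKer (S : Finset (X →L[ℝ] ℝ)) : Submodule ℝ X :=
  ⨅ φ ∈ S, LinearMap.ker (φ : X →ₗ[ℝ] ℝ)

theorem mem_jointKer {S : Finset (X →L[ℝ] ℝ)} {x : X} :
    x ∈ jointKer S ↔ ∀ φ ∈ S, φ x = 0 := by
  simp [jointKer]

theorem isClosed_jointKer (S : Finset (X →L[ℝ] ℝ)) : IsClosed (jointKer S : Set X) := by
  have : (jointKer S : Set X) = ⋂ φ ∈ S, {x | φ x = 0} := by
    ext x; simp [mem_jointKer]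
  rw [this]
  exact isClosed_biInter fun φ _ => isClosed_eq φ.continuous continuous_const

theorem jointKer_anti {S T : Finset (X →L[ℝ] ℝ)} (h : S ⊆ T) : jointKer T ≤ jointKer S :=
  fun _ hx => mem_jointKer.2 fun φ hφ => mem_jointKer.1 hx φ (h hφ)

theorem exists_jointKer_norm_le (F : Submodule ℝ X) [FiniteDimensional ℝ F] :
    ∃ S : Finset (X →L[ℝ] ℝ), ∀ x ∈ F, ∀ y ∈ jointKer S, ‖x‖ ≤ 2 * ‖x + y‖ := by
  classical
  have hcpt : IsCompact (Metric.sphere (0 : F) 1) := isCompact_sphere 0 1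
  obtain ⟨t, ht, htf, hcov⟩ := hcpt.finite_cover_balls (e := 1 / 2) (by norm_num)
  choose g hg1 hg2 using fun x : F => exists_dual_vector'' ℝ (x : X)
  refine ⟨htf.toFinset.image g, ?_⟩
  have key : ∀ u : F, ‖u‖ = 1 → ∀ y ∈ jointKer (htf.toFinset.image g), 1 ≤ 2 * ‖(u : X) + y‖ := by
    intro u hu y hy
    have hu' : u ∈ Metric.sphere (0 : F) 1 := by simpa using hu
    obtain ⟨v, hv, huv⟩ := Set.mem_iUnion₂.1 (hcov hu')
    have hy0 : g v y = 0 := mem_jointKer.1 hy _ (Finset.mem_image_of_mem g (by simpa using hv))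
    have hv1 : ‖(v : X)‖ = 1 := by simpa using ht hv
    have h1 : g v ((u : X) + y) = 1 - g v ((v : X) - u) := by
      have := hg2 v
      simp only [hv1] at this
      simp [hy0, this]
    have h2 : g v ((v : X) - u) ≤ 1 / 2 := by
      refine (le_abs_self _).trans (((g v).le_of_opNorm_le (hg1 v) _).trans ?_)
      rw [Metric.mem_ball, dist_comm, dist_eq_norm] at huv
      have : ‖(v : X) - u‖ < 1 / 2 := huv
      linarith
    have h3 := (le_abs_self _).trans ((g v).le_of_opNorm_le (hg1 v) ((u : X) + y))
    linarith
  intro x hx y hy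
  rcases eq_or_ne x 0 with rfl | h0
  · simp
  have hpos : 0 < ‖x‖ := norm_pos_iff.2 h0
  have := key ((‖x‖)⁻¹ • ⟨x, hx⟩) (by
    rw [norm_smul, norm_inv, norm_norm]; exact inv_mul_cancel₀ hpos.ne') ((‖x‖)⁻¹ • y)
    (Submodule.smul_mem _ _ hy)
  have h2 : (((‖x‖)⁻¹ • (⟨x, hx⟩ : F) : F) : X) + (‖x‖)⁻¹ • y = (‖x‖)⁻¹ • (x + y) := by
    simp
  rw [h2, norm_smul, norm_inv, norm_norm] at this
  field_simp at this
  exact this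

/-- All finite-dimensional subspaces of the common kernel of `S` have local projections with a
common bound. -/
def UniformLocalProj (S : Finset (X →L[ℝ] ℝ)) : Prop :=
  ∃ c : ℝ, ∀ E : Submodule ℝ X, FiniteDimensional ℝ E → E ≤ jointKer S → LocalProj E c

theorem exists_proj_of_injOn (K : Submodule ℝ X) (φ : X →L[ℝ] ℝ)
    (h : ∀ x ∈ K, φ x = 0 → x = 0) :
    ∃ g : X →ₗ[ℝ] X, (∀ x, g x ∈ K) ∧ (∀ x ∈ K, g x = x) ∧ ∀ x, ‖g x‖ ≤ ‖x‖ := by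
  by_cases hK : ∀ x ∈ K, x = 0
  · exact ⟨0, fun x => K.zero_mem, fun x hx => (hK x hx).symm, fun x => by simp⟩
  push Not at hK
  obtain ⟨k, hk, hk0⟩ := hK
  have hφk : φ k ≠ 0 := fun h0 => hk0 (h k hk h0)
  obtain ⟨ψ, hψ1, hψ2⟩ := exists_dual_vector'' ℝ k
  have hpos : 0 < ‖k‖ := norm_pos_iff.2 hk0
  refine ⟨(ψ : X →ₗ[ℝ] ℝ).smulRight ((‖k‖)⁻¹ • k), fun x => ?_, fun x hx => ?_, fun x => ?_⟩
  · exact K.smul_mem _ (K.smul_mem _ hk)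
  · have h1 : x = (φ x / φ k) • k := by
      rw [← sub_eq_zero]
      refine h _ (K.sub_mem hx (K.smul_mem _ hk)) ?_
      simp [hφk]
    generalize φ x / φ k = r at h1
    subst h1
    simp only [LinearMap.smulRight_apply, ContinuousLinearMap.coe_coe, map_smul, hψ2, smul_smul]
    simp [hpos.ne']
  · simp only [LinearMap.smulRight_apply, ContinuousLinearMap.coe_coe, norm_smul, norm_inv,
      norm_norm, inv_mul_cancel₀ hpos.ne', mul_one]
    have := ψ.le_of_opNorm_le hψ1 x
    linarith

open Classical in
theorem UniformLocalProj.of_insert {S : Finset (X →L[ℝ] ℝ)} {φ : X →L[ℝ] ℝ}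
    (h : UniformLocalProj (insert φ S)) : UniformLocalProj S := by
  obtain ⟨c, hc⟩ := h
  refine ⟨2 * c + 1, fun E hE hES M hM => ?_⟩
  let E₀ := E ⊓ LinearMap.ker (φ : X →ₗ[ℝ] ℝ)
  have hE₀ : E₀ ≤ jointKer (insert φ S) := by
    intro x hx
    rw [mem_jointKer]
    intro ψ hψ
    rcases Finset.mem_insert.1 hψ with rfl | hψ
    · exact hx.2
    · exact mem_jointKer.1 (hES hx.1) ψ hψ
  obtain ⟨P, hP⟩ := hc E₀ (Submodule.finiteDimensional_of_le inf_le_left) hE₀ (M ⊔ E) inferInstance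
  obtain ⟨g, hg1, hg2, hg3⟩ := exists_proj_of_injOn (E ⊓ LinearMap.ker P) φ (by
    rintro x ⟨hxE, hxP⟩ hx
    rw [← (hP x (Submodule.mem_sup_right hxE)).2.1 ⟨hxE, hx⟩]
    exact hxP)
  refine ⟨P + g ∘ₗ (LinearMap.id - P), fun x hx => ?_⟩
  have hx' : x ∈ M ⊔ E := Submodule.mem_sup_left hx
  obtain ⟨h1, h2, h3⟩ := hP x hx'
  refine ⟨E.add_mem h1.1 (hg1 _).1, fun hxE => ?_, ?_⟩
  · have h4 : P (P x) = P x := (hP _ (Submodule.mem_sup_right h1.1)).2.1 h1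
    have := hg2 (x - P x) ⟨E.sub_mem hxE h1.1, by simp [h4]⟩
    simp [this]
  · have h5 := hg3 (x - P x)
    have h6 := norm_sub_le x (P x)
    have h7 := norm_add_le (P x) (g (x - P x))
    simp only [LinearMap.add_apply, LinearMap.comp_apply, LinearMap.sub_apply, LinearMap.id_apply]
    linarith

theorem UniformLocalProj.empty_of (S : Finset (X →L[ℝ] ℝ)) (h : UniformLocalProj S) :
    UniformLocalProj (∅ : Finset (X →L[ℝ] ℝ)) := by
  classical
  induction S using Finset.induction_on with
  | empty => exact h
  | insert φ S _ ih => exact ih h.of_insert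

/-- A sequence of finite-dimensional subspaces without uniform local projections, sitting
almost orthogonally to each other. -/
theorem exists_separated_bad_sequence
    (h : ¬ UniformLocalProj (∅ : Finset (X →L[ℝ] ℝ))) :
    ∃ (E F : ℕ → Submodule ℝ X) (S : ℕ → Finset (X →L[ℝ] ℝ)),
      (∀ n, FiniteDimensional ℝ (F n)) ∧ (∀ n, ¬ LocalProj (E n) n) ∧
      (∀ n, E n ≤ jointKer (S n)) ∧ (∀ n, F (n + 1) = F n ⊔ E n) ∧
      (∀ n, S n ⊆ S (n + 1)) ∧
      ∀ n, ∀ x ∈ F n, ∀ y ∈ jointKer (S n), ‖x‖ ≤ 2 * ‖x + y‖ := by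
  classical
  have hbad : ∀ (S : Finset (X →L[ℝ] ℝ)) (n : ℕ), ∃ E : Submodule ℝ X,
      FiniteDimensional ℝ E ∧ E ≤ jointKer S ∧ ¬ LocalProj E n := by
    intro S n
    by_contra hcon
    push Not at hcon
    exact h (UniformLocalProj.empty_of S ⟨n, hcon⟩)
  choose E hE1 hE2 hE3 using hbad
  choose T hT using fun F : {F : Submodule ℝ X // FiniteDimensional ℝ F} =>
    haveI := F.2; exists_jointKer_norm_le F.1
  let State := {F : Submodule ℝ X // FiniteDimensional ℝ F} × Finset (X →L[ℝ] ℝ)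
  let F' : State → ℕ → {F : Submodule ℝ X // FiniteDimensional ℝ F} := fun s n =>
    ⟨s.1.1 ⊔ E s.2 n, by have := s.1.2; have := hE1 s.2 n; infer_instance⟩
  let st : ℕ → State := fun n => Nat.rec (⟨⊥, inferInstance⟩, ∅)
    (fun n s => (F' s n, s.2 ∪ T (F' s n))) n
  refine ⟨fun n => E (st n).2 n, fun n => (st n).1.1, fun n => (st n).2, fun n => (st n).1.2,
    fun n => hE3 _ _, fun n => hE2 _ _, fun n => rfl, fun n => ?_, fun n => ?_⟩
  · exact Finset.subset_union_left
  · cases n with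
    | zero =>
      intro x hx y _
      have hx0 : x = 0 := (Submodule.mem_bot ℝ).1 hx
      simp [hx0]
    | succ n =>
      intro x hx y hy
      exact hT (F' (st n) n) x hx y (jointKer_anti Finset.subset_union_right hy)

theorem uniformLocalProj_of_forall_isClosed
    (h : ∀ Z : Submodule ℝ X, IsClosed (Z : Set X) → ∃ c : ℝ, LocalProj Z c) :
    UniformLocalProj (∅ : Finset (X →L[ℝ] ℝ)) := by
  by_contra hcon
  obtain ⟨E, F, S, hFfin, hbad, hES, hF, hS, hsep⟩ := exists_separated_bad_sequence hcon
  have hFmono : Monotone F := monotone_nat_of_le_succ fun n => by rw [hF]; exact le_sup_left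
  have hSmono : Monotone S := monotone_nat_of_le_succ hS
  obtain ⟨c, hc⟩ := h (⨆ n, E n).topologicalClosure (Submodule.isClosed_topologicalClosure _)
  obtain ⟨k, hk⟩ := exists_nat_ge (4 * c)
  refine hbad k (LocalProj.mono ?_ hk)
  have hest : ∀ f ∈ F k, ∀ e ∈ E k, ∀ y ∈ jointKer (S (k + 1)), ‖e‖ ≤ 4 * ‖f + e + y‖ := by
    intro f hf e he y hy
    have h1 : ‖f + e‖ ≤ 2 * ‖f + e + y‖ := by
      refine hsep (k + 1) _ ?_ _ hy
      rw [hF]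
      exact Submodule.add_mem_sup hf he
    have h2 : ‖f‖ ≤ 2 * ‖f + (e + y)‖ :=
      hsep k _ hf _ (Submodule.add_mem _ (hES k he) (jointKer_anti (hS k) hy))
    rw [← add_assoc] at h2
    have h3 := norm_sub_le (f + e) f
    rw [add_sub_cancel_left] at h3
    linarith
  have hclosed : IsClosed ((jointKer (S (k + 1)) ⊔ F (k + 1) : Submodule ℝ X) : Set X) := by
    have := hFfin (k + 1)
    exact Submodule.isClosed_sup_finiteDimensional _ _ (isClosed_jointKer _)
  have hZ : (⨆ n, E n).topologicalClosure ≤ jointKer (S (k + 1)) ⊔ F (k + 1) := by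
    refine Submodule.topologicalClosure_minimal _ (iSup_le fun n => ?_) hclosed
    rcases lt_or_ge n (k + 1) with hn | hn
    · refine le_trans ?_ le_sup_right
      refine le_trans ?_ (hFmono (Nat.succ_le_of_lt hn))
      rw [hF]
      exact le_sup_right
    · exact ((hES n).trans (jointKer_anti (hSmono hn))).trans le_sup_left
  have hdisj : Disjoint (F k ⊔ jointKer (S (k + 1))) (E k) := by
    rw [Submodule.disjoint_def]
    intro x hx hxE
    obtain ⟨f, hf, y, hy, rfl⟩ := Submodule.mem_sup.1 hx
    have := hest (-f) (Submodule.neg_mem _ hf) _ hxE (-y) (Submodule.neg_mem _ hy)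
    rw [show -f + (f + y) + -y = 0 by abel, norm_zero, mul_zero] at this
    exact norm_le_zero_iff.1 this
  obtain ⟨N, hN, hcompl⟩ := hdisj.exists_isCompl
  let Q : X →ₗ[ℝ] X :=
    (E k).subtype ∘ₗ (E k).projectionOnto N hcompl.symm
  have hQE : ∀ e ∈ E k, Q e = e := fun e he =>
    congrArg Subtype.val (Submodule.projectionOnto_apply_left hcompl.symm ⟨e, he⟩)
  have hQN : ∀ y ∈ N, Q y = 0 := fun y hy =>
    congrArg Subtype.val ((Submodule.projectionOnto_apply_eq_zero_iff hcompl.symm).2 hy)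
  have hQ : ∀ z ∈ (⨆ n, E n).topologicalClosure, ‖Q z‖ ≤ 4 * ‖z‖ := by
    intro z hz
    obtain ⟨y, hy, w, hw, rfl⟩ := Submodule.mem_sup.1 (hZ hz)
    rw [hF] at hw
    obtain ⟨f, hf, e, he, rfl⟩ := Submodule.mem_sup.1 hw
    rw [map_add, map_add, hQE e he, hQN y (hN (Submodule.mem_sup_right hy)),
      hQN f (hN (Submodule.mem_sup_left hf)), zero_add, zero_add]
    have := hest f hf e he y hy
    rwa [add_comm _ y] at this
  intro M hM
  obtain ⟨P, hP⟩ := hc M hM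
  refine ⟨Q ∘ₗ P, fun x hx => ?_⟩
  obtain ⟨h1, h2, h3⟩ := hP x hx
  refine ⟨Subtype.prop ((E k).projectionOnto N hcompl.symm (P x)), fun hxE => ?_, ?_⟩
  · rw [LinearMap.comp_apply, h2 (Submodule.le_topologicalClosure _
      (Submodule.mem_iSup_of_mem k hxE)), hQE x hxE]
  · have := hQ _ h1
    rw [LinearMap.comp_apply]
    linarith

end Uniform

section Coupling

variable {X} {V : Type*} [AddCommGroup V] [Module ℝ V]

/-- At every scale `t`, vectors split linearly into a part controlled in `t q` by `p` and a part
controlled in `p` by `t q`. -/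
def Coupled (L : ℝ) (p q : V → ℝ) : Prop :=
  ∀ t : ℝ, 0 < t → ∃ A : V →ₗ[ℝ] V, ∀ v, t * q (A v) ≤ L * p v ∧ p (v - A v) ≤ L * (t * q v)

theorem coupled_of_norm_le [FiniteDimensional ℝ V] {c : ℝ}
    (hc : ∀ E : Submodule ℝ X, FiniteDimensional ℝ E → LocalProj E c) (i j : V →ₗ[ℝ] X)
    (hi : Function.Injective i)
    (hij : ∀ v w, ‖i v‖ ≤ 3 * ‖i v + j w‖ ∧ ‖j w‖ ≤ 3 * ‖i v + j w‖) :
    Coupled (3 * c) (fun v => ‖i v‖) (fun v => ‖j v‖) := by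
  intro t ht
  let g : V →ₗ[ℝ] X := i + t • j
  have hg : ∀ v, g v = i v + t • j v := fun v => rfl
  have hg1 : ∀ v, ‖i v‖ ≤ 3 * ‖g v‖ := fun v => by
    simpa [hg] using (hij v (t • v)).1
  have hg2 : ∀ v, t * ‖j v‖ ≤ 3 * ‖g v‖ := fun v => by
    have h1 := (hij v (t • v)).2
    rwa [map_smul, norm_smul, Real.norm_of_nonneg ht.le, ← hg] at h1
  have hginj : LinearMap.ker g = ⊥ := by
    rw [LinearMap.ker_eq_bot']
    intro v hv
    have := hg1 v
    rw [hv, norm_zero, mul_zero] at this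
    exact (map_eq_zero_iff i hi).1 (norm_le_zero_iff.1 this)
  obtain ⟨s, hs⟩ := g.exists_leftInverse_of_injective hginj
  have hs' : ∀ v, s (g v) = v := fun v => LinearMap.congr_fun hs v
  obtain ⟨P, hP⟩ := hc (LinearMap.range g) inferInstance
    (LinearMap.range i ⊔ LinearMap.range j) inferInstance
  have hgs : ∀ x ∈ LinearMap.range g, g (s x) = x := by
    rintro _ ⟨v, rfl⟩
    rw [hs']
  have him : ∀ v, i v ∈ LinearMap.range i ⊔ LinearMap.range j := fun v =>
    Submodule.mem_sup_left ⟨v, rfl⟩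
  have hjm : ∀ v, t • j v ∈ LinearMap.range i ⊔ LinearMap.range j := fun v =>
    Submodule.smul_mem _ _ (Submodule.mem_sup_right ⟨v, rfl⟩)
  refine ⟨s ∘ₗ P ∘ₗ i, fun v => ⟨?_, ?_⟩⟩
  · obtain ⟨h1, -, h3⟩ := hP _ (him v)
    have h4 := hg2 (s (P (i v)))
    rw [hgs _ h1] at h4
    simp only [LinearMap.comp_apply]
    linarith
  · obtain ⟨h1, -, h3⟩ := hP _ (hjm v)
    have h5 : P (g v) = g v := (hP _ (Submodule.add_mem _ (him v) (hjm v))).2.1 ⟨v, rfl⟩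
    have h6 : v - s (P (i v)) = s (P (t • j v)) := by
      have h7 : t • j v = g v - i v := by rw [hg, add_sub_cancel_left]
      rw [h7, map_sub, map_sub, h5, hs']
    have h4 := hg1 (s (P (t • j v)))
    rw [hgs _ h1] at h4
    rw [norm_smul, Real.norm_of_nonneg ht.le] at h3
    simp only [LinearMap.comp_apply]
    rw [h6]
    linarith

end Coupling

section HilbertDistance

/-- `V` is isomorphic to a Euclidean space with distortion at most `d`. -/
def EuclideanBound (V : Type*) [NormedAddCommGroup V] [NormedSpace ℝ V] (d : ℝ) : Prop :=
  ∃ S : V →ₗ[ℝ] EuclideanSpace ℝ (Fin (Module.finrank ℝ V)), ∀ v, ‖v‖ ≤ ‖S v‖ ∧ ‖S v‖ ≤ d * ‖v‖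

theorem EuclideanBound.mono {V : Type*} [NormedAddCommGroup V] [NormedSpace ℝ V]
    {d e : ℝ} (h : EuclideanBound V d) (hde : d ≤ e) :
    EuclideanBound V e := by
  obtain ⟨S, hS⟩ := h
  exact ⟨S, fun v => ⟨(hS v).1, (hS v).2.trans (mul_le_mul_of_nonneg_right hde (norm_nonneg _))⟩⟩

variable {V : Type*} [NormedAddCommGroup V] [NormedSpace ℝ V] [FiniteDimensional ℝ V]

theorem exists_euclidean_norm_eq {H : Type*} [NormedAddCommGroup H] [InnerProductSpace ℝ H]
    (T : V →ₗ[ℝ] H) (hT : Function.Injective T) :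
    ∃ S : V →ₗ[ℝ] EuclideanSpace ℝ (Fin (Module.finrank ℝ V)), ∀ v, ‖S v‖ = ‖T v‖ := by
  have h := LinearMap.finrank_range_of_inj hT
  let b := (stdOrthonormalBasis ℝ (LinearMap.range T)).reindex (finCongr h)
  exact ⟨b.repr.toLinearEquiv.toLinearMap ∘ₗ T.rangeRestrict, fun v => b.repr.norm_map _⟩

theorem exists_euclideanBound : ∃ d : ℝ, EuclideanBound V d := by
  let e : V ≃L[ℝ] EuclideanSpace ℝ (Fin (Module.finrank ℝ V)) :=
    ContinuousLinearEquiv.ofFinrankEq (by simp)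
  let K := ‖(e.symm : EuclideanSpace ℝ (Fin (Module.finrank ℝ V)) →L[ℝ] V)‖
  refine ⟨K * ‖(e : V →L[ℝ] EuclideanSpace ℝ (Fin (Module.finrank ℝ V)))‖,
    K • (e : V →L[ℝ] EuclideanSpace ℝ (Fin (Module.finrank ℝ V))).toLinearMap, fun v => ?_⟩
  have hK : 0 ≤ K := norm_nonneg _
  have h1 : ‖v‖ ≤ K * ‖e v‖ := by
    simpa using (e.symm : EuclideanSpace ℝ (Fin (Module.finrank ℝ V)) →L[ℝ] V).le_opNorm (e v)
  have h2 := (e : V →L[ℝ] EuclideanSpace ℝ (Fin (Module.finrank ℝ V))).le_opNorm v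
  have h3 : ‖(K • (e : V →L[ℝ] EuclideanSpace ℝ (Fin (Module.finrank ℝ V))).toLinearMap) v‖ =
      K * ‖e v‖ := by
    rw [LinearMap.smul_apply, norm_smul, Real.norm_of_nonneg hK]; rfl
  rw [h3, mul_assoc]
  exact ⟨h1, mul_le_mul_of_nonneg_left h2 hK⟩

theorem EuclideanBound.improve {L c d : ℝ} (hL : 0 < L) (hc : 0 < c) (hd : 0 < d)
    {q : EuclideanSpace ℝ (Fin (Module.finrank ℝ V)) → ℝ}
    (hq : ∀ a, ‖a‖ ≤ q a ∧ q a ≤ c * ‖a‖)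
    (hcoup : ∀ S : V →ₗ[ℝ] EuclideanSpace ℝ (Fin (Module.finrank ℝ V)), Function.Injective S →
      Coupled L (fun v : V => ‖v‖) (fun v => q (S v)))
    (h : EuclideanBound V d) : EuclideanBound V (√(2 * L ^ 2 * (1 + c ^ 2) * d)) := by
  obtain ⟨S, hS⟩ := h
  have hinj : Function.Injective S := by
    rw [injective_iff_map_eq_zero]
    intro v hv
    have := (hS v).1
    rw [hv, norm_zero] at this
    exact norm_le_zero_iff.1 this
  have hsd : 0 < √d := Real.sqrt_pos.2 hd
  have hsd2 : √d ^ 2 = d := Real.sq_sqrt hd.le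
  obtain ⟨A, hA⟩ := hcoup S hinj (√d)⁻¹ (inv_pos.2 hsd)
  let r : ℝ := L * c * (√d)⁻¹
  have hr : 0 < r := by positivity
  let T : V →ₗ[ℝ] WithLp 2 (EuclideanSpace ℝ (Fin (Module.finrank ℝ V)) ×
      EuclideanSpace ℝ (Fin (Module.finrank ℝ V))) :=
    (WithLp.linearEquiv 2 ℝ _).symm.toLinearMap ∘ₗ
      LinearMap.prod (√2 • (S ∘ₗ A)) ((√2 * r) • S)
  have hT : ∀ v, ‖T v‖ ^ 2 = 2 * (‖S (A v)‖ ^ 2 + r ^ 2 * ‖S v‖ ^ 2) := by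
    intro v
    have h2 : (√2 : ℝ) ^ 2 = 2 := Real.sq_sqrt (by norm_num)
    have : T v = WithLp.toLp 2 (√2 • S (A v), (√2 * r) • S v) := rfl
    rw [this, WithLp.prod_norm_sq_eq_of_L2]
    change ‖√2 • S (A v)‖ ^ 2 + ‖(√2 * r) • S v‖ ^ 2 = _
    rw [norm_smul, norm_smul, Real.norm_of_nonneg (Real.sqrt_nonneg 2),
      Real.norm_of_nonneg (by positivity), mul_pow, mul_pow, mul_pow, h2]
    ring
  have hlow : ∀ v, ‖v‖ ≤ ‖S (A v)‖ + r * ‖S v‖ := by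
    intro v
    have h1 := (hS (A v)).1
    have h2 := (hA v).2
    have h3 := mul_le_mul_of_nonneg_left (hq (S v)).2
      (show 0 ≤ L * (√d)⁻¹ by positivity)
    have h4 := norm_add_le (A v) (v - A v)
    rw [add_sub_cancel] at h4
    have : r * ‖S v‖ = L * (√d)⁻¹ * (c * ‖S v‖) := by ring
    rw [this]
    linarith
  have hup : ∀ v, ‖S (A v)‖ ≤ L * √d * ‖v‖ := by
    intro v
    have h1 := (hA v).1
    have h2 := (hq (S (A v))).1
    rw [inv_mul_le_iff₀ hsd] at h1
    linarith
  have hTlow : ∀ v, ‖v‖ ≤ ‖T v‖ := by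
    intro v
    refine le_of_sq_le_sq ?_ (norm_nonneg _)
    rw [hT]
    have := pow_le_pow_left₀ (norm_nonneg v) (hlow v) 2
    nlinarith [sq_nonneg (‖S (A v)‖ - r * ‖S v‖)]
  have hTinj : Function.Injective T := by
    rw [injective_iff_map_eq_zero]
    intro v hv
    have := hTlow v
    rw [hv, norm_zero] at this
    exact norm_le_zero_iff.1 this
  obtain ⟨S', hS'⟩ := exists_euclidean_norm_eq T hTinj
  refine ⟨S', fun v => ⟨(hS' v) ▸ hTlow v, ?_⟩⟩
  rw [hS']
  refine le_of_sq_le_sq ?_ (by positivity)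
  have hsq : (√(2 * L ^ 2 * (1 + c ^ 2) * d) * ‖v‖) ^ 2 =
      2 * L ^ 2 * (1 + c ^ 2) * d * ‖v‖ ^ 2 := by
    rw [mul_pow, Real.sq_sqrt (by positivity)]
  rw [hT, hsq]
  have h1 := pow_le_pow_left₀ (norm_nonneg _) (hup v) 2
  have h2 := pow_le_pow_left₀ (norm_nonneg _) (hS v).2 2
  have h3 := mul_le_mul_of_nonneg_left h2 (sq_nonneg r)
  have h4 : r ^ 2 * (d * ‖v‖) ^ 2 = L ^ 2 * c ^ 2 * d * ‖v‖ ^ 2 := by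
    have : r ^ 2 * d = L ^ 2 * c ^ 2 := by
      simp only [r, mul_pow, inv_pow, hsd2]
      field_simp
    calc r ^ 2 * (d * ‖v‖) ^ 2 = (r ^ 2 * d) * d * ‖v‖ ^ 2 := by ring
      _ = _ := by rw [this]
  have h5 : (L * √d * ‖v‖) ^ 2 = L ^ 2 * d * ‖v‖ ^ 2 := by
    rw [mul_pow, mul_pow, hsd2]
  rw [h4] at h3
  rw [h5] at h1
  nlinarith

theorem euclideanBound_of_coupled {L c : ℝ} (hL : 0 < L) (hc : 0 < c)
    {q : EuclideanSpace ℝ (Fin (Module.finrank ℝ V)) → ℝ}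
    (hq : ∀ a, ‖a‖ ≤ q a ∧ q a ≤ c * ‖a‖)
    (hcoup : ∀ S : V →ₗ[ℝ] EuclideanSpace ℝ (Fin (Module.finrank ℝ V)), Function.Injective S →
      Coupled L (fun v : V => ‖v‖) (fun v => q (S v))) :
    EuclideanBound V (2 * (2 * L ^ 2 * (1 + c ^ 2))) := by
  set C := 2 * L ^ 2 * (1 + c ^ 2) with hC
  have hCpos : 0 < C := by positivity
  let D : Set ℝ := {d | 0 < d ∧ EuclideanBound V d}
  have hne : D.Nonempty := by
    obtain ⟨d, hd⟩ := exists_euclideanBound (V := V)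
    exact ⟨max d 1, by positivity, hd.mono (le_max_left _ _)⟩
  have hbdd : BddBelow D := ⟨0, fun d hd => hd.1.le⟩
  have hinf : ∀ d ∈ D, sInf D ≤ √(C * d) := fun d hd =>
    csInf_le hbdd ⟨by have := hd.1; positivity, hd.2.improve hL hc hd.1 hq hcoup⟩
  have hle : sInf D ≤ C := by
    by_contra hlt
    push Not at hlt
    have h1 : sInf D < sInf D ^ 2 / C := by
      rw [lt_div_iff₀ hCpos]
      nlinarith
    obtain ⟨d, hd, hd2⟩ := exists_lt_of_csInf_lt hne h1
    rw [lt_div_iff₀ hCpos] at hd2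
    have h2 := hinf d hd
    have h3 := pow_le_pow_left₀ (hCpos.trans hlt).le h2 2
    rw [Real.sq_sqrt (by have := hd.1; positivity)] at h3
    linarith
  obtain ⟨d, hd, hd2⟩ := exists_lt_of_csInf_lt hne (show sInf D < 2 * C by linarith)
  exact hd.2.mono hd2.le

end HilbertDistance

section SpreadingLimit

open Filter Topology

/-- The limit of a bounded real sequence along a fixed nonprincipal ultrafilter. -/
noncomputable def ulim (f : ℕ → ℝ) : ℝ := limUnder (hyperfilter ℕ : Filter ℕ) f

theorem tendsto_ulim {f : ℕ → ℝ} {C : ℝ} (h : ∀ k, |f k| ≤ C) :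
    Tendsto f (hyperfilter ℕ) (𝓝 (ulim f)) := by
  refine tendsto_nhds_limUnder ?_
  obtain ⟨x, -, hx⟩ := (isCompact_Icc (a := -C) (b := C)).ultrafilter_le_nhds'
    ((hyperfilter ℕ).map f) (by
      rw [Ultrafilter.mem_map]
      exact univ_mem' fun k => abs_le.1 (h k))
  exact ⟨x, hx⟩

theorem abs_ulim_le {f : ℕ → ℝ} {C : ℝ} (h : ∀ k, |f k| ≤ C) : |ulim f| ≤ C :=
  le_of_tendsto (tendsto_ulim h).abs (Eventually.of_forall h)

theorem ulim_le_ulim_add {f g : ℕ → ℝ} {C D c : ℝ} (hf : ∀ k, |f k| ≤ C) (hg : ∀ k, |g k| ≤ D)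
    (h : ∀ k, f k ≤ g k + c) : ulim f ≤ ulim g + c :=
  le_of_tendsto_of_tendsto' (tendsto_ulim hf) ((tendsto_ulim hg).add_const c) h

theorem ulim_le_ulim_mid {f g g' : ℕ → ℝ} {C D D' : ℝ} (hf : ∀ k, |f k| ≤ C)
    (hg : ∀ k, |g k| ≤ D) (hg' : ∀ k, |g' k| ≤ D') (h : ∀ k, f k ≤ (g k + g' k) / 2) :
    ulim f ≤ (ulim g + ulim g') / 2 :=
  le_of_tendsto_of_tendsto' (tendsto_ulim hf)
    (((tendsto_ulim hg).add (tendsto_ulim hg')).div_const 2) h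

theorem ulim_const (c : ℝ) : ulim (fun _ => c) = c :=
  (tendsto_const_nhds (f := (hyperfilter ℕ : Filter ℕ))).limUnder_eq

variable {Y : Type*} [NormedAddCommGroup Y] [NormedSpace ℝ Y]

/-- Functions that are `1`-Lipschitz and midpoint convex. -/
structure LipConvex (φ : Y → ℝ) : Prop where
  lip : ∀ z w, φ z ≤ φ w + ‖z - w‖
  mid : ∀ z w, φ ((1 / 2 : ℝ) • (z + w)) ≤ (φ z + φ w) / 2

/-- The iterated limit of `φ (z + a (xₖ - xₗ))`. -/
noncomputable def diffLim (x : ℕ → Y) (a : ℝ) (φ : Y → ℝ) (z : Y) : ℝ :=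
  ulim fun k => ulim fun l => φ (z + a • (x k - x l))

variable {x : ℕ → Y} {R : ℝ} {φ ψ : Y → ℝ}

theorem norm_smul_sub_le (hx : ∀ k, ‖x k‖ ≤ R) (a : ℝ) (k l : ℕ) :
    ‖a • (x k - x l)‖ ≤ |a| * (2 * R) := by
  rw [norm_smul, Real.norm_eq_abs]
  refine mul_le_mul_of_nonneg_left ?_ (abs_nonneg a)
  linarith [norm_sub_le (x k) (x l), hx k, hx l]

theorem LipConvex.abs_sub_le (hφ : LipConvex φ) (z w : Y) : |φ (z + w) - φ z| ≤ ‖w‖ := by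
  have h1 := hφ.lip (z + w) z
  have h2 := hφ.lip z (z + w)
  rw [add_sub_cancel_left] at h1
  rw [show z - (z + w) = -w by abel, norm_neg] at h2
  rw [abs_le]
  constructor <;> linarith

theorem LipConvex.abs_le (hφ : LipConvex φ) (hx : ∀ k, ‖x k‖ ≤ R) (a : ℝ) (z : Y) (k l : ℕ) :
    |φ (z + a • (x k - x l))| ≤ |φ z| + |a| * (2 * R) := by
  have h1 := hφ.abs_sub_le z (a • (x k - x l))
  have h2 := norm_smul_sub_le hx a k l
  have h3 := abs_sub_abs_le_abs_sub (φ (z + a • (x k - x l))) (φ z)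
  linarith

theorem LipConvex.abs_ulim_le (hφ : LipConvex φ) (hx : ∀ k, ‖x k‖ ≤ R) (a : ℝ) (z : Y) (k : ℕ) :
    |ulim fun l => φ (z + a • (x k - x l))| ≤ |φ z| + |a| * (2 * R) :=
  _root_.abs_ulim_le fun l => hφ.abs_le hx a z k l

theorem LipConvex.diffLim_mono (hφ : LipConvex φ) (hψ : LipConvex ψ) (hx : ∀ k, ‖x k‖ ≤ R)
    (h : ∀ z, φ z ≤ ψ z) (a : ℝ) (z : Y) : diffLim x a φ z ≤ diffLim x a ψ z := by
  have := ulim_le_ulim_add (c := 0) (hφ.abs_ulim_le hx a z) (hψ.abs_ulim_le hx a z) fun k => by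
    refine ulim_le_ulim_add (hφ.abs_le hx a z k) (hψ.abs_le hx a z k) fun l => ?_
    rw [add_zero]
    exact h _
  rwa [add_zero] at this

theorem LipConvex.diffLim (hφ : LipConvex φ) (hx : ∀ k, ‖x k‖ ≤ R) (a : ℝ) :
    LipConvex (diffLim x a φ) where
  lip z w := by
    refine ulim_le_ulim_add (hφ.abs_ulim_le hx a z) (hφ.abs_ulim_le hx a w) fun k => ?_
    refine ulim_le_ulim_add (hφ.abs_le hx a z k) (hφ.abs_le hx a w k) fun l => ?_
    have := hφ.lip (z + a • (x k - x l)) (w + a • (x k - x l))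
    rwa [add_sub_add_right_eq_sub] at this
  mid z w := by
    refine ulim_le_ulim_mid (hφ.abs_ulim_le hx a _) (hφ.abs_ulim_le hx a z)
      (hφ.abs_ulim_le hx a w) fun k => ?_
    refine ulim_le_ulim_mid (hφ.abs_le hx a _ k) (hφ.abs_le hx a z k)
      (hφ.abs_le hx a w k) fun l => ?_
    have := hφ.mid (z + a • (x k - x l)) (w + a • (x k - x l))
    convert this using 2
    module

theorem LipConvex.abs_diffLim_sub_le (hφ : LipConvex φ) (hx : ∀ k, ‖x k‖ ≤ R) (a : ℝ) (z : Y) :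
    φ z ≤ _root_.diffLim x a φ z + |a| * (2 * R) := by
  have h := ulim_le_ulim_add (f := fun _ => φ z) (c := |a| * (2 * R)) (fun _ => le_rfl)
    (hφ.abs_ulim_le hx a z) fun k => by
      rw [← ulim_const (φ z)]
      refine ulim_le_ulim_add (fun _ => le_rfl) (hφ.abs_le hx a z k) fun l => ?_
      have h1 := hφ.abs_sub_le z (a • (x k - x l))
      have h2 := norm_smul_sub_le hx a k l
      linarith [neg_abs_le (φ (z + a • (x k - x l)) - φ z)]
  rwa [ulim_const] at h

theorem LipConvex.diffLim_half_le (hφ : LipConvex φ) (hx : ∀ k, ‖x k‖ ≤ R) (a : ℝ) (z : Y) :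
    _root_.diffLim x (a / 2) φ z ≤ _root_.diffLim x a φ z := by
  have hpt : ∀ k l m, φ (z + (a / 2) • (x k - x m)) ≤
      (φ (z + a • (x k - x l)) + φ (z + a • (x l - x m))) / 2 := by
    intro k l m
    convert hφ.mid (z + a • (x k - x l)) (z + a • (x l - x m)) using 2
    module
  have h1 : ∀ k l, (ulim fun m => φ (z + (a / 2) • (x k - x m))) ≤
      (φ (z + a • (x k - x l)) + ulim fun m => φ (z + a • (x l - x m))) / 2 := by
    intro k l
    have := ulim_le_ulim_mid (g := fun _ => φ (z + a • (x k - x l)))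
      (hφ.abs_le hx (a / 2) z k) (fun _ => le_rfl) (hφ.abs_le hx a z l) (hpt k l)
    rwa [ulim_const] at this
  have h2 : ∀ k, (ulim fun m => φ (z + (a / 2) • (x k - x m))) ≤
      ((ulim fun l => φ (z + a • (x k - x l))) + _root_.diffLim x a φ z) / 2 := by
    intro k
    have := ulim_le_ulim_mid (f := fun _ => ulim fun m => φ (z + (a / 2) • (x k - x m)))
      (fun _ => le_rfl) (hφ.abs_le hx a z k) (hφ.abs_ulim_le hx a z) (h1 k)
    rwa [ulim_const] at this
  have h3 := ulim_le_ulim_mid (hφ.abs_ulim_le hx (a / 2) z) (hφ.abs_ulim_le hx a z)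
    (g' := fun _ => _root_.diffLim x a φ z) (fun _ => le_rfl) h2
  rw [ulim_const] at h3
  change _root_.diffLim x (a / 2) φ z ≤ (_root_.diffLim x a φ z + _root_.diffLim x a φ z) / 2 at h3
  linarith

/-- Dropping a difference does not increase the iterated limit. -/
theorem LipConvex.le_diffLim (hφ : LipConvex φ) (hx : ∀ k, ‖x k‖ ≤ R) (a : ℝ) (z : Y) :
    φ z ≤ _root_.diffLim x a φ z := by
  have hpow : ∀ n : ℕ, _root_.diffLim x (a / 2 ^ n) φ z ≤ _root_.diffLim x a φ z := by
    intro n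
    induction n with
    | zero => simp
    | succ n ih =>
      rw [pow_succ, ← div_div]
      exact (hφ.diffLim_half_le hx _ z).trans ih
  have hlim : Tendsto (fun n : ℕ => _root_.diffLim x a φ z + |a / 2 ^ n| * (2 * R)) atTop
      (𝓝 (_root_.diffLim x a φ z + |0| * (2 * R))) := by
    refine tendsto_const_nhds.add (Tendsto.mul_const _ (Tendsto.abs ?_))
    have := (tendsto_pow_atTop_nhds_zero_of_lt_one (r := (1 / 2 : ℝ)) (by norm_num)
      (by norm_num)).const_mul a
    simpa [div_eq_mul_inv] using this
  rw [abs_zero, zero_mul, add_zero] at hlim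
  refine ge_of_tendsto' hlim fun n => ?_
  have := hφ.abs_diffLim_sub_le hx (a / 2 ^ n) z
  linarith [hpow n]

theorem diffLim_zero (x : ℕ → Y) (φ : Y → ℝ) (z : Y) : diffLim x 0 φ z = φ z := by
  simp [diffLim, ulim_const]

theorem LipConvex.eventually_abs_sub_diffLim_lt (hφ : LipConvex φ) (hx : ∀ k, ‖x k‖ ≤ R)
    (a : ℝ) (z : Y) {ε : ℝ} (hε : 0 < ε) :
    ∀ᶠ k in hyperfilter ℕ, ∀ᶠ l in hyperfilter ℕ,
      |φ (z + a • (x k - x l)) - _root_.diffLim x a φ z| < ε := by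
  have h1 := (tendsto_ulim (hφ.abs_ulim_le hx a z)).eventually
    (Metric.ball_mem_nhds _ (half_pos hε))
  filter_upwards [h1] with k hk
  have h2 := (tendsto_ulim (hφ.abs_le hx a z k)).eventually
    (Metric.ball_mem_nhds _ (half_pos hε))
  filter_upwards [h2] with l hl
  have h3 := dist_triangle (φ (z + a • (x k - x l))) (ulim fun l => φ (z + a • (x k - x l)))
    (_root_.diffLim x a φ z)
  have hk' : dist (ulim fun l => φ (z + a • (x k - x l))) (_root_.diffLim x a φ z) < ε / 2 := hk
  have hl' : dist (φ (z + a • (x k - x l))) (ulim fun l => φ (z + a • (x k - x l))) < ε / 2 := hl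
  rw [← Real.dist_eq]
  linarith

/-- The norm of the spreading model generated by the differences of `x`. -/
noncomputable def spreadNorm (x : ℕ → Y) : (n : ℕ) → (Fin n → ℝ) → Y → ℝ
  | 0, _ => fun z => ‖z‖
  | n + 1, a => diffLim x (a 0) (spreadNorm x n (Fin.tail a))

theorem lipConvex_spreadNorm (hx : ∀ k, ‖x k‖ ≤ R) :
    ∀ (n : ℕ) (a : Fin n → ℝ), LipConvex (spreadNorm x n a)
  | 0, _ => ⟨fun z w => by
      have := norm_add_le w (z - w)
      rwa [add_sub_cancel] at this, fun z w => by
      change ‖(1 / 2 : ℝ) • (z + w)‖ ≤ (‖z‖ + ‖w‖) / 2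
      rw [norm_smul]
      have := norm_add_le z w
      norm_num
      linarith⟩
  | n + 1, a => (lipConvex_spreadNorm hx n (Fin.tail a)).diffLim hx (a 0)

theorem spreadNorm_mask_le (hx : ∀ k, ‖x k‖ ≤ R) :
    ∀ (n : ℕ) (m a : Fin n → ℝ) (_ : ∀ i, m i = 0 ∨ m i = 1) (z : Y),
      spreadNorm x n (m * a) z ≤ spreadNorm x n a z
  | 0, _, _, _, _ => le_rfl
  | n + 1, m, a, hm, z => by
    have ih := spreadNorm_mask_le hx n (Fin.tail m) (Fin.tail a) fun i => hm i.succ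
    have htail : Fin.tail (m * a) = Fin.tail m * Fin.tail a := rfl
    have hφ := lipConvex_spreadNorm hx n (Fin.tail m * Fin.tail a)
    have hψ := lipConvex_spreadNorm hx n (Fin.tail a)
    change diffLim x (m 0 * a 0) (spreadNorm x n (Fin.tail (m * a))) z ≤
      diffLim x (a 0) (spreadNorm x n (Fin.tail a)) z
    rw [htail]
    rcases hm 0 with h0 | h0
    · rw [h0, zero_mul, diffLim_zero]
      exact (ih z).trans (hψ.le_diffLim hx _ z)
    · rw [h0, one_mul]
      exact hφ.diffLim_mono hψ hx ih _ z

theorem exists_diff_approx (hx : ∀ k, ‖x k‖ ≤ R) (hsep : Pairwise fun m n => 1 ≤ ‖x m - x n‖)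
    {ε : ℝ} (hε : 0 < ε) :
    ∀ (n : ℕ) (T : Finset ((Fin n → ℝ) × Y)), ∃ y : Fin n → Y,
      (∀ i, 1 ≤ ‖y i‖ ∧ ‖y i‖ ≤ 2 * R) ∧
      ∀ p ∈ T, |‖p.2 + ∑ i, p.1 i • y i‖ - spreadNorm x n p.1 p.2| ≤ n * ε
  | 0, T => ⟨Fin.elim0, fun i => i.elim0, fun p _ => by simp [spreadNorm]⟩
  | n + 1, T => by
    classical
    have h1 : ∀ᶠ k in hyperfilter ℕ, ∀ᶠ l in hyperfilter ℕ, ∀ p ∈ T,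
        |spreadNorm x n (Fin.tail p.1) (p.2 + p.1 0 • (x k - x l)) -
          spreadNorm x (n + 1) p.1 p.2| < ε := by
      simp only [eventually_all_finset]
      exact fun p _ => (lipConvex_spreadNorm hx n _).eventually_abs_sub_diffLim_lt hx _ _ hε
    obtain ⟨k, hk⟩ := h1.exists
    have h2 : ∀ᶠ l in hyperfilter ℕ, k ≠ l := by
      have : ({k}ᶜ : Set ℕ) ∈ hyperfilter ℕ :=
        Set.Finite.compl_mem_hyperfilter (Set.finite_singleton k)
      filter_upwards [this] with l hl h
      exact hl h.symm
    obtain ⟨l, hl, hkl⟩ := (hk.and h2).exists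
    obtain ⟨y, hy1, hy2⟩ := exists_diff_approx hx hsep hε n
      (T.image fun p => (Fin.tail p.1, p.2 + p.1 0 • (x k - x l)))
    refine ⟨Fin.cons (x k - x l) y, fun i => ?_, fun p hp => ?_⟩
    · refine Fin.cases ?_ (fun i => ?_) i
      · rw [Fin.cons_zero]
        exact ⟨hsep hkl, by linarith [norm_sub_le (x k) (x l), hx k, hx l]⟩
      · rw [Fin.cons_succ]
        exact hy1 i
    · have h3 := hy2 _ (Finset.mem_image_of_mem _ hp)
      have h4 := hl p hp
      rw [Fin.sum_univ_succ, ← add_assoc]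
      simp only [Fin.cons_zero, Fin.cons_succ]
      push_cast
      change |‖p.2 + p.1 0 • (x k - x l) + ∑ i : Fin n, p.1 i.succ • y i‖ -
        spreadNorm x n (Fin.tail p.1) (p.2 + p.1 0 • (x k - x l))| ≤ n * ε at h3
      have h5 := abs_sub_le ‖p.2 + p.1 0 • (x k - x l) + ∑ i : Fin n, p.1 i.succ • y i‖
        (spreadNorm x n (Fin.tail p.1) (p.2 + p.1 0 • (x k - x l)))
        (spreadNorm x (n + 1) p.1 p.2)
      linarith

theorem norm_sum_smul_sub_le {N : ℕ} {y : Fin N → Y} {C : ℝ} (hy : ∀ i, ‖y i‖ ≤ C)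
    (a b : Fin N → ℝ) : ‖∑ i, a i • y i‖ ≤ ‖∑ i, b i • y i‖ + N * (‖a - b‖ * C) := by
  have h1 : ∑ i, a i • y i = ∑ i, b i • y i + ∑ i, (a - b) i • y i := by
    rw [← Finset.sum_add_distrib]
    refine Finset.sum_congr rfl fun i _ => ?_
    rw [← add_smul, Pi.sub_apply, add_sub_cancel]
  have h2 : ‖∑ i, (a - b) i • y i‖ ≤ ∑ _i : Fin N, ‖a - b‖ * C := by
    refine norm_sum_le_of_le _ fun i _ => ?_
    rw [norm_smul]
    exact mul_le_mul (norm_le_pi_norm _ i) (hy i) (norm_nonneg _) (norm_nonneg _)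
  rw [Finset.sum_const, Finset.card_univ, Fintype.card_fin, nsmul_eq_mul] at h2
  rw [h1]
  exact (norm_add_le _ _).trans (by gcongr)

/-- An infinite-dimensional space contains arbitrarily long sequences whose coordinate
restrictions are bounded by `2`. -/
theorem exists_suppression_unconditional (hY : ¬ FiniteDimensional ℝ Y) (N : ℕ) :
    ∃ y : Fin N → Y, (∀ i, y i ≠ 0) ∧ ∀ (a : Fin N → ℝ) (s : Finset (Fin N)),
      ‖∑ i ∈ s, a i • y i‖ ≤ 2 * ‖∑ i, a i • y i‖ := by
  classical
  obtain ⟨R, x, hR, hx, hsep⟩ := exists_seq_norm_le_one_le_norm_sub hY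
  let mask : Finset (Fin N) → Fin N → ℝ := fun s i => if i ∈ s then 1 else 0
  have hmask : ∀ s i, mask s i = 0 ∨ mask s i = 1 := fun s i => by
    by_cases h : i ∈ s <;> simp [mask, h]
  have hsum : ∀ (s : Finset (Fin N)) (a : Fin N → ℝ) (y : Fin N → Y),
      ∑ i, (mask s * a) i • y i = ∑ i ∈ s, a i • y i := fun s a y => by
    simp [mask, ite_smul, Finset.sum_ite_mem]
  let δ : ℝ := 1 / (8 * ((N + 1) * (2 * R)))
  have hδ : 0 < δ := by positivity
  have hδN : N * (δ * (2 * R)) ≤ 1 / 8 := by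
    have : (N : ℝ) * (δ * (2 * R)) = N / (8 * (N + 1)) := by
      simp only [δ]; field_simp
    rw [this, div_le_div_iff₀ (by positivity) (by norm_num)]
    linarith
  let ε : ℝ := 1 / (8 * (N + 1))
  have hε : 0 < ε := by positivity
  have hεN : N * ε ≤ 1 / 8 := by
    have : (N : ℝ) * ε = N / (8 * (N + 1)) := by simp only [ε]; field_simp
    rw [this, div_le_div_iff₀ (by positivity) (by norm_num)]
    linarith
  obtain ⟨t, ht, htf, hcov⟩ :=
    (isCompact_sphere (0 : Fin N → ℝ) 1).finite_cover_balls hδ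
  obtain ⟨y, hy1, hy2⟩ := exists_diff_approx hx hsep hε N
    ((htf.toFinset ×ˢ Finset.univ).image fun p : (Fin N → ℝ) × Finset (Fin N) =>
      (mask p.2 * p.1, (0 : Y)))
  have happ : ∀ b ∈ t, ∀ s, |‖∑ i, (mask s * b) i • y i‖ - spreadNorm x N (mask s * b) 0| ≤
      1 / 8 := fun b hb s => by
    have := hy2 (mask s * b, 0) (Finset.mem_image.2 ⟨(b, s), by simpa using hb, rfl⟩)
    rw [zero_add] at this
    exact this.trans hεN
  have hone : mask Finset.univ = 1 := by ext i; simp [mask]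
  have hunit : ∀ a : Fin N → ℝ, ‖a‖ = 1 → ∀ s,
      ‖∑ i, (mask s * a) i • y i‖ ≤ ‖∑ i, a i • y i‖ + 1 / 2 := by
    intro a ha s
    obtain ⟨b, hb, hab⟩ := Set.mem_iUnion₂.1 (hcov (show a ∈ Metric.sphere 0 1 by simpa using ha))
    rw [Metric.mem_ball, dist_eq_norm] at hab
    have hba : ‖b - a‖ ≤ δ := by rw [norm_sub_rev]; exact hab.le
    have hmab : ‖mask s * a - mask s * b‖ ≤ δ := by
      rw [pi_norm_le_iff_of_nonneg hδ.le]
      intro i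
      have h1 := (norm_le_pi_norm (a - b) i).trans hab.le
      rcases hmask s i with h0 | h0
      · simp [h0, hδ.le]
      · simpa [h0] using h1
    have hRpos : 0 ≤ 2 * R := by linarith
    have hN : (0 : ℝ) ≤ N := Nat.cast_nonneg N
    have e1 := norm_sum_smul_sub_le (fun i => (hy1 i).2) (mask s * a) (mask s * b)
    have e1' : N * (‖mask s * a - mask s * b‖ * (2 * R)) ≤ 1 / 8 :=
      le_trans (by gcongr) hδN
    have e2 := norm_sum_smul_sub_le (fun i => (hy1 i).2) b a
    have e2' : N * (‖b - a‖ * (2 * R)) ≤ 1 / 8 := le_trans (by gcongr) hδN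
    have e3 := (abs_le.1 (happ b hb s)).2
    have e4 := (abs_le.1 (happ b hb Finset.univ)).1
    rw [hone, one_mul] at e4
    have e5 := spreadNorm_mask_le hx N (mask s) b (hmask s) 0
    linarith
  have hunit' : ∀ a : Fin N → ℝ, ‖a‖ = 1 → ∀ s,
      ‖∑ i, (mask s * a) i • y i‖ ≤ 2 * ‖∑ i, a i • y i‖ := by
    intro a ha s
    have hlow : 1 ≤ ‖∑ i, a i • y i‖ + 1 / 2 := by
      have hN : Nonempty (Fin N) := by
        by_contra hemp
        rw [not_nonempty_iff] at hemp
        rw [Subsingleton.elim a 0, norm_zero] at ha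
        exact zero_ne_one ha
      obtain ⟨j, -, hj⟩ := Finset.exists_max_image Finset.univ (fun i => ‖a i‖)
        Finset.univ_nonempty
      have hj1 : 1 ≤ ‖a j‖ := by
        rw [← ha]
        exact (pi_norm_le_iff_of_nonneg (norm_nonneg _)).2 fun i => hj i (Finset.mem_univ i)
      have := hunit a ha {j}
      rw [hsum, Finset.sum_singleton, norm_smul] at this
      nlinarith [(hy1 j).1]
    linarith [hunit a ha s]
  refine ⟨y, fun i h0 => ?_, fun a s => ?_⟩
  · have := (hy1 i).1
    rw [h0, norm_zero] at this
    linarith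
  · rcases eq_or_ne a 0 with rfl | ha
    · simp
    have hpos : 0 < ‖a‖ := norm_pos_iff.2 ha
    have := hunit' (‖a‖⁻¹ • a) (by
      rw [norm_smul, norm_inv, norm_norm, inv_mul_cancel₀ hpos.ne']) s
    rw [hsum] at this
    simp only [Pi.smul_apply, smul_assoc, ← Finset.smul_sum, norm_smul, norm_inv, norm_norm]
      at this
    rw [mul_left_comm] at this
    exact le_of_mul_le_mul_left this (inv_pos.2 hpos)

end SpreadingLimit

section Unconditional

variable {Y : Type*} [NormedAddCommGroup Y] [NormedSpace ℝ Y] {ι : Type*}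

theorem Seminorm.map_finset_sum_le {E κ : Type*} [AddCommGroup E] [Module ℝ E]
    (p : Seminorm ℝ E) (s : Finset κ) (f : κ → E) : p (∑ i ∈ s, f i) ≤ ∑ i ∈ s, p (f i) :=
  Finset.le_sum_of_subadditive p (map_zero p).le (map_add_le_add p) s f

/-- A seminorm in which the unit vectors have size `1` and form a `K`-unconditional basis. -/
structure IsUnconditional [DecidableEq ι] (K : ℝ) (p : Seminorm ℝ (ι → ℝ)) : Prop where
  single : ∀ i, p (Pi.single i 1) = 1
  mul_le : ∀ m v : ι → ℝ, (∀ i, |m i| ≤ 1) → p (m * v) ≤ K * p v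

theorem norm_sum_mul_smul_le [Fintype ι] {y : ι → Y} {a : ι → ℝ} {B : ℝ}
    (h : ∀ s : Finset ι, ‖∑ i ∈ s, a i • y i‖ ≤ B) {m : ι → ℝ} (hm : ∀ i, m i ∈ Set.Icc 0 1) :
    ‖∑ i, (m i * a i) • y i‖ ≤ B := by
  classical
  let T : (ι → ℝ) →ₗ[ℝ] Y := Fintype.linearCombination ℝ fun i => a i • y i
  have hT : ∀ m, T m = ∑ i, (m i * a i) • y i := fun m => by
    simp [T, Fintype.linearCombination_apply, smul_smul]
  have hconv : Convex ℝ (T ⁻¹' Metric.closedBall 0 B) :=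
    (convex_closedBall 0 B).linear_preimage T
  have hsub : (Set.univ.pi fun _ : ι => ({0, 1} : Set ℝ)) ⊆ T ⁻¹' Metric.closedBall 0 B := by
    intro u hu
    rw [Set.mem_preimage, mem_closedBall_zero_iff, hT]
    have : ∑ i, (u i * a i) • y i = ∑ i ∈ Finset.univ.filter (fun i => u i = 1), a i • y i := by
      rw [Finset.sum_filter]
      refine Finset.sum_congr rfl fun i _ => ?_
      rcases hu i (Set.mem_univ i) with h0 | h1
      · simp [h0]
      · rw [Set.mem_singleton_iff] at h1
        simp [h1]
    rw [this]
    exact h _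
  have hmem : m ∈ convexHull ℝ (Set.univ.pi fun _ : ι => ({0, 1} : Set ℝ)) := by
    rw [convexHull_pi]
    intro i _
    rw [convexHull_pair, segment_eq_Icc zero_le_one]
    exact hm i
  have := convexHull_min hsub hconv hmem
  rwa [Set.mem_preimage, mem_closedBall_zero_iff, hT] at this

theorem exists_isUnconditional [Fintype ι] [DecidableEq ι] (hY : ¬ FiniteDimensional ℝ Y) :
    ∃ J : (ι → ℝ) →ₗ[ℝ] Y, IsUnconditional 4 ((normSeminorm ℝ Y).comp J) := by
  obtain ⟨y, hy0, hy⟩ := exists_suppression_unconditional hY (Fintype.card ι)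
  let e := Fintype.equivFin ι
  let z : ι → Y := fun i => ‖y (e i)‖⁻¹ • y (e i)
  have hpos : ∀ i, 0 < ‖y (e i)‖ := fun i => norm_pos_iff.2 (hy0 _)
  have hsupp : ∀ (a : ι → ℝ) (s : Finset ι),
      ‖∑ i ∈ s, a i • z i‖ ≤ 2 * ‖∑ i, a i • z i‖ := by
    intro a s
    have h := hy (fun k => a (e.symm k) * ‖y k‖⁻¹) (s.map e.toEmbedding)
    rw [Finset.sum_map, ← e.sum_comp] at h
    simpa [z, smul_smul] using h
  refine ⟨Fintype.linearCombination ℝ z, fun i => ?_, fun m v hm => ?_⟩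
  · rw [Seminorm.comp_apply, coe_normSeminorm]
    simp [z, Fintype.linearCombination_apply, Pi.single_apply, norm_smul, (hpos i).ne']
  · simp only [Seminorm.comp_apply, coe_normSeminorm, Fintype.linearCombination_apply,
      Pi.mul_apply]
    have h1 := norm_sum_mul_smul_le (hsupp v) (m := fun i => (m i)⁺) fun i =>
      ⟨posPart_nonneg _, by
        rw [posPart_def]; exact sup_le ((le_abs_self _).trans (hm i)) zero_le_one⟩
    have h2 := norm_sum_mul_smul_le (hsupp v) (m := fun i => (m i)⁻) fun i =>
      ⟨negPart_nonneg _, by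
        rw [negPart_def]; exact sup_le ((neg_le_abs _).trans (hm i)) zero_le_one⟩
    have h3 : ∑ i, (m i * v i) • z i =
        ∑ i, ((m i)⁺ * v i) • z i - ∑ i, ((m i)⁻ * v i) • z i := by
      rw [← Finset.sum_sub_distrib]
      refine Finset.sum_congr rfl fun i _ => ?_
      rw [← sub_smul, ← sub_mul, posPart_sub_negPart]
    rw [h3]
    linarith [norm_sub_le (∑ i, ((m i)⁺ * v i) • z i) (∑ i, ((m i)⁻ * v i) • z i)]

/-- The real-valued function given by a choice of signs. -/
def signFun (ε : ι → ℤˣ) : ι → ℝ := fun i => ((ε i : ℤ) : ℝ)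

theorem abs_signFun (ε : ι → ℤˣ) (i : ι) : |signFun ε i| = 1 := by
  rcases Int.units_eq_one_or (ε i) with h | h <;> simp [signFun, h]

theorem signFun_mul_self (ε : ι → ℤˣ) (i : ι) : signFun ε i * signFun ε i = 1 := by
  rw [← abs_mul_abs_self, abs_signFun, one_mul]

theorem signFun_mul (ε η : ι → ℤˣ) (i : ι) : signFun (ε * η) i = signFun ε i * signFun η i := by
  simp [signFun]

theorem sum_signFun_mul_signFun [Fintype ι] [DecidableEq ι] (i j : ι) :
    ∑ ε : ι → ℤˣ, signFun ε i * signFun ε j =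
      if i = j then (Fintype.card (ι → ℤˣ) : ℝ) else 0 := by
  split_ifs with h
  · simp [h, signFun_mul_self]
  · have h1 : ∑ ε : ι → ℤˣ, signFun ε i * signFun ε j =
        ∑ ε : ι → ℤˣ, -(signFun ε i * signFun ε j) := by
      refine Fintype.sum_equiv (Equiv.mulLeft (Pi.mulSingle i (-1))) _ _ fun ε => ?_
      rw [Equiv.coe_mulLeft, signFun_mul, signFun_mul]
      simp [signFun, Pi.mulSingle_eq_of_ne (Ne.symm h)]
    rw [Finset.sum_neg_distrib] at h1
    linarith

variable [DecidableEq ι] {K L : ℝ} {p q : Seminorm ℝ (ι → ℝ)}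

theorem IsUnconditional.abs_le (hp : IsUnconditional K p) (v : ι → ℝ) (i : ι) :
    |v i| ≤ K * p v := by
  have h1 := hp.mul_le (Pi.single i 1) v fun j => by
    rcases eq_or_ne j i with rfl | h <;> simp [*]
  have h2 : Pi.single i 1 * v = v i • (Pi.single i 1 : ι → ℝ) := by
    ext j
    rcases eq_or_ne j i with rfl | h <;> simp [*]
  rwa [h2, map_smul_eq_mul, hp.single, mul_one, Real.norm_eq_abs] at h1

theorem IsUnconditional.le_of_abs_le_two (hp : IsUnconditional K p) {f v : ι → ℝ}
    (hf : ∀ i, |f i| ≤ 2) : p (f * v) ≤ 2 * K * p v := by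
  have h1 := hp.mul_le (fun i => f i / 2) v fun i => by
    rw [abs_div, abs_two]
    linarith [hf i]
  have h2 : f * v = (2 : ℝ) • ((fun i => f i / 2) * v) := by
    ext i
    simp only [Pi.mul_apply, Pi.smul_apply, smul_eq_mul]
    ring
  rw [h2, map_smul_eq_mul, Real.norm_of_nonneg zero_le_two]
  linarith

theorem IsUnconditional.le_of_coupled [Fintype ι] (hp : IsUnconditional K p)
    (hq : IsUnconditional K q) (hK : 0 < K) (hL : 0 < L) (h : Coupled L p q) (v : ι → ℝ) :
    p v ≤ 4 * K ^ 4 * L ^ 2 * q v := by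
  have ht : 0 < 2 * K * L := by positivity
  obtain ⟨A, hA⟩ := h (2 * K * L) ht
  let a : ι → ℝ := fun i => A (Pi.single i 1) i
  have ha : ∀ i, |a i| ≤ 1 / 2 := by
    intro i
    have h1 := (hA (Pi.single i 1)).1
    rw [hp.single] at h1
    have h2 := hq.abs_le (A (Pi.single i 1)) i
    have : K * q (A (Pi.single i 1)) ≤ 1 / 2 := by
      refine le_of_mul_le_mul_left ?_ hL
      linarith
    exact h2.trans this
  have hcard : (0 : ℝ) < Fintype.card (ι → ℤˣ) := Nat.cast_pos.2 Fintype.card_pos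
  have hAsum : ∀ w i, A w i = ∑ j, w j * A (Pi.single j 1) i := by
    intro w i
    rw [LinearMap.pi_apply_eq_sum_univ A w]
    have : ∀ j : ι, (fun k => if j = k then (1 : ℝ) else 0) = Pi.single j 1 := fun j => by
      ext k
      simp [Pi.single_apply, eq_comm (a := j)]
    simp only [this, Finset.sum_apply, Pi.smul_apply, smul_eq_mul]
  have havg : (Fintype.card (ι → ℤˣ) : ℝ) • (v - a * v) =
      ∑ ε : ι → ℤˣ, signFun ε * (signFun ε * v - A (signFun ε * v)) := by
    ext i
    have h1 : ∀ ε : ι → ℤˣ, signFun ε i * (signFun ε i * v i - A (signFun ε * v) i) =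
        v i - ∑ j, (signFun ε i * signFun ε j) * (v j * A (Pi.single j 1) i) := by
      intro ε
      rw [mul_sub, ← mul_assoc, signFun_mul_self, one_mul, hAsum, Finset.mul_sum]
      congr 1
      refine Finset.sum_congr rfl fun j _ => ?_
      rw [Pi.mul_apply]
      ring
    simp only [Finset.sum_apply, Pi.mul_apply, Pi.sub_apply, Pi.smul_apply, smul_eq_mul, h1]
    rw [Finset.sum_sub_distrib, Finset.sum_comm]
    simp only [← Finset.sum_mul, sum_signFun_mul_signFun]
    simp [a]
    ring
  have hdiag : p (v - a * v) ≤ 2 * K ^ 3 * L ^ 2 * q v := by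
    have h1 : ∀ ε : ι → ℤˣ, p (signFun ε * (signFun ε * v - A (signFun ε * v))) ≤
        2 * K ^ 3 * L ^ 2 * q v := by
      intro ε
      have h2 := hp.mul_le (signFun ε) (signFun ε * v - A (signFun ε * v)) fun i =>
        (abs_signFun ε i).le
      have h3 := (hA (signFun ε * v)).2
      have h4 := hq.mul_le (signFun ε) v fun i => (abs_signFun ε i).le
      calc _ ≤ K * p (signFun ε * v - A (signFun ε * v)) := h2
        _ ≤ K * (L * (2 * K * L * q (signFun ε * v))) := by gcongr
        _ ≤ K * (L * (2 * K * L * (K * q v))) := by gcongr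
        _ = _ := by ring
    have h2 := p.map_finset_sum_le Finset.univ
      fun ε : ι → ℤˣ => signFun ε * (signFun ε * v - A (signFun ε * v))
    rw [← havg, map_smul_eq_mul, Real.norm_of_nonneg hcard.le] at h2
    have h3 := h2.trans (Finset.sum_le_sum fun ε _ => h1 ε)
    rw [Finset.sum_const, nsmul_eq_mul, Finset.card_univ] at h3
    exact le_of_mul_le_mul_left h3 hcard
  have hone : ∀ i, 1 / 2 ≤ 1 - a i := fun i => by linarith [(_root_.abs_le.1 (ha i)).2]
  have hinv := hp.mul_le (fun i => (2 * (1 - a i))⁻¹) (v - a * v) fun i => by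
    rw [abs_of_nonneg (inv_nonneg.2 (by linarith [hone i]))]
    exact inv_le_one_of_one_le₀ (by linarith [hone i])
  have hv : v = (2 : ℝ) • ((fun i => (2 * (1 - a i))⁻¹) * (v - a * v)) := by
    ext i
    have : 1 - a i ≠ 0 := by linarith [hone i]
    simp only [Pi.smul_apply, Pi.mul_apply, Pi.sub_apply, smul_eq_mul]
    field_simp
  have hpv : p v = 2 * p ((fun i => (2 * (1 - a i))⁻¹) * (v - a * v)) := by
    conv_lhs => rw [hv]
    rw [map_smul_eq_mul, Real.norm_of_nonneg zero_le_two]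
  rw [hpv]
  calc _ ≤ 2 * (K * p (v - a * v)) := by gcongr
    _ ≤ 2 * (K * (2 * K ^ 3 * L ^ 2 * q v)) := by gcongr
    _ = _ := by ring

end Unconditional

section Translation

variable {X}

theorem not_finiteDimensional_jointKer (hX : ¬ FiniteDimensional ℝ X)
    (S : Finset (X →L[ℝ] ℝ)) : ¬ FiniteDimensional ℝ (jointKer S) := by
  intro h
  refine hX ⟨?_⟩
  let T : X →ₗ[ℝ] (S → ℝ) := LinearMap.pi fun φ => (φ.1 : X →ₗ[ℝ] ℝ)
  refine Submodule.fg_of_fg_map_of_fg_inf_ker T (IsNoetherian.noetherian _) ?_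
  have : ⊤ ⊓ LinearMap.ker T = jointKer S := by
    ext x
    simp [T, mem_jointKer, funext_iff]
  rw [this]
  exact (Submodule.fg_top _).1 h.1

theorem exists_isUnconditional_jointKer {ι : Type*} [Fintype ι] [DecidableEq ι]
    (hX : ¬ FiniteDimensional ℝ X) (S : Finset (X →L[ℝ] ℝ)) :
    ∃ J : (ι → ℝ) →ₗ[ℝ] X, (∀ v, J v ∈ jointKer S) ∧
      IsUnconditional 4 ((normSeminorm ℝ X).comp J) := by
  obtain ⟨J, hJ⟩ := exists_isUnconditional (ι := ι) (not_finiteDimensional_jointKer hX S)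
  exact ⟨(jointKer S).subtype ∘ₗ J, fun v => (J v).2, hJ.single, hJ.mul_le⟩

theorem IsUnconditional.injective {ι : Type*} [DecidableEq ι] {K : ℝ} {J : (ι → ℝ) →ₗ[ℝ] X}
    (h : IsUnconditional K ((normSeminorm ℝ X).comp J)) : Function.Injective J := by
  rw [injective_iff_map_eq_zero]
  intro v hv
  ext i
  have := h.abs_le v i
  rw [Seminorm.comp_apply, hv, map_zero, mul_zero] at this
  exact abs_nonpos_iff.1 this

variable {G : Type*} [Group G]

/-- Left translation of functions. -/
def shiftFun (g : G) : (G → ℝ) →ₗ[ℝ] (G → ℝ) := LinearMap.funLeft ℝ ℝ (g * ·)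

@[simp]
theorem shiftFun_apply (g : G) (v : G → ℝ) (x : G) : shiftFun g v x = v (g * x) := rfl

theorem IsUnconditional.shiftFun [DecidableEq G] {K : ℝ} {q : Seminorm ℝ (G → ℝ)}
    (h : IsUnconditional K q) (g : G) : IsUnconditional K (q.comp (shiftFun g)) where
  single i := by
    have : _root_.shiftFun g (Pi.single i 1) = Pi.single (g⁻¹ * i) 1 := by
      ext x
      simp [Pi.single_apply, eq_inv_mul_iff_mul_eq]
    rw [Seminorm.comp_apply, this, h.single]
  mul_le m v hm := h.mul_le (_root_.shiftFun g m) (_root_.shiftFun g v) fun i => hm (g * i)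

theorem exists_norm_shiftFun_le [Fintype G] [DecidableEq G] {c : ℝ} (hc0 : 0 < c)
    (hc : ∀ E : Submodule ℝ X, FiniteDimensional ℝ E → LocalProj E c)
    (hX : ¬ FiniteDimensional ℝ X) (S : Finset (X →L[ℝ] ℝ)) :
    ∃ J : (G → ℝ) →ₗ[ℝ] X, (∀ v, J v ∈ jointKer S) ∧
      IsUnconditional 4 ((normSeminorm ℝ X).comp J) ∧
      ∀ g v, ‖J (shiftFun g v)‖ ≤ (4 * 4 ^ 4 * (3 * c) ^ 2) ^ 2 * ‖J v‖ := by
  obtain ⟨J, hJS, hJ⟩ := exists_isUnconditional_jointKer (ι := G) hX S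
  obtain ⟨S', hS'⟩ := exists_jointKer_norm_le (LinearMap.range J)
  obtain ⟨J', hJS', hJ'⟩ := exists_isUnconditional_jointKer (ι := G) hX S'
  have hsep : ∀ v w, ‖J v‖ ≤ 2 * ‖J v + J' w‖ := fun v w => hS' _ ⟨v, rfl⟩ _ (hJS' w)
  have hsep' : ∀ v w, ‖J v‖ ≤ 3 * ‖J v + J' w‖ ∧ ‖J' w‖ ≤ 3 * ‖J v + J' w‖ := fun v w => by
    have h1 := norm_sub_le (J v + J' w) (J v)
    rw [add_sub_cancel_left] at h1
    constructor <;> linarith [hsep v w, norm_nonneg (J v + J' w)]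
  have hJt : ∀ g, Function.Injective (J' ∘ₗ shiftFun g) := fun g =>
    (hJ'.shiftFun g).injective
  have h3c : 0 < 3 * c := by positivity
  set C : ℝ := 4 * 4 ^ 4 * (3 * c) ^ 2 with hC
  have hC0 : 0 ≤ C := by positivity
  have h1 : ∀ g v, ‖J v‖ ≤ C * ‖J' (shiftFun g v)‖ := fun g v =>
    hJ.le_of_coupled (hJ'.shiftFun g) (by norm_num) h3c
      (coupled_of_norm_le hc J (J' ∘ₗ shiftFun g) hJ.injective fun v w => hsep' v _) v
  have h2 : ∀ v, ‖J' v‖ ≤ C * ‖J v‖ := fun v =>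
    hJ'.le_of_coupled hJ (by norm_num) h3c
      (coupled_of_norm_le hc J' J hJ'.injective fun v w => by
        rw [add_comm]
        exact (hsep' w v).symm) v
  refine ⟨J, hJS, hJ, fun g v => ?_⟩
  have h3 := h1 g⁻¹ (shiftFun g v)
  rw [show shiftFun g⁻¹ (shiftFun g v) = v by ext x; simp] at h3
  calc _ ≤ C * ‖J' v‖ := h3
    _ ≤ C * (C * ‖J v‖) := by gcongr; exact h2 v
    _ = _ := by ring

end Translation

section Rademacher

variable {X} {ι : Type*} [Fintype ι]

/-- The linear combinations of the Rademacher functions. -/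
noncomputable def rademacher : EuclideanSpace ℝ ι →ₗ[ℝ] ((ι → ℤˣ) → ℝ) where
  toFun a ω := ∑ i, a i * signFun ω i
  map_add' a b := by
    ext ω
    simp [add_mul, Finset.sum_add_distrib]
  map_smul' t a := by
    ext ω
    simp [mul_assoc, Finset.mul_sum]

theorem rademacher_apply (a : EuclideanSpace ℝ ι) (ω : ι → ℤˣ) :
    rademacher a ω = ∑ i, a i * signFun ω i := rfl

variable [DecidableEq ι]

theorem sum_prod_mul_signFun (u : ι → ℂ) (k : ι) :
    ∑ ω : ι → ℤˣ, (∏ j, (1 + u j * (signFun ω j : ℂ))) * (signFun ω k : ℂ) =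
      Fintype.card (ι → ℤˣ) * u k := by
  let F : ι → ℤˣ → ℂ := fun j s => (1 + u j * ((s : ℤ) : ℂ)) * if j = k then ((s : ℤ) : ℂ) else 1
  have h1 : ∀ ω : ι → ℤˣ, (∏ j, (1 + u j * (signFun ω j : ℂ))) * (signFun ω k : ℂ) =
      ∏ j, F j (ω j) := by
    intro ω
    simp only [F, Finset.prod_mul_distrib, signFun]
    simp
  have h2 : ∀ j, ∑ s : ℤˣ, F j s = 2 * if j = k then u k else 1 := by
    intro j
    rw [UnitsInt.univ, Finset.sum_pair (by decide)]
    by_cases h : j = k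
    · simp [F, h]; ring
    · simp [F, h]; ring
  rw [Finset.sum_congr rfl fun ω _ => h1 ω, ← Fintype.prod_sum]
  simp only [h2, Finset.prod_mul_distrib]
  simp

/-- A bounded function with prescribed Rademacher coefficients, given by a Riesz product. -/
theorem exists_abs_le_sum_mul_signFun (a : ι → ℝ) (ha : ∑ i, a i ^ 2 ≤ 1) :
    ∃ f : (ι → ℤˣ) → ℝ, (∀ ω, |f ω| ≤ 2) ∧
      ∀ k, ∑ ω, f ω * signFun ω k = Fintype.card (ι → ℤˣ) * a k := by
  refine ⟨fun ω => (∏ j, (1 + (a j * Complex.I) * (signFun ω j : ℂ))).im, fun ω => ?_,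
    fun k => ?_⟩
  · refine (Complex.abs_im_le_norm _).trans ?_
    rw [norm_prod]
    refine le_of_sq_le_sq ?_ zero_le_two
    rw [← Finset.prod_pow]
    have h1 : ∀ j, ‖1 + (a j * Complex.I) * (signFun ω j : ℂ)‖ ^ 2 = 1 + a j ^ 2 := by
      intro j
      have h2 : 1 + (a j * Complex.I) * (signFun ω j : ℂ) =
          ((1 : ℝ) : ℂ) + ((a j * signFun ω j : ℝ) : ℂ) * Complex.I := by
        push_cast; ring
      have h3 : signFun ω j ^ 2 = 1 := by rw [sq, signFun_mul_self]
      rw [h2, Complex.norm_add_mul_I, Real.sq_sqrt (by positivity), mul_pow, h3]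
      ring
    calc ∏ j, ‖1 + (a j * Complex.I) * (signFun ω j : ℂ)‖ ^ 2
        = ∏ j, (1 + a j ^ 2) := Finset.prod_congr rfl fun j _ => h1 j
      _ ≤ ∏ j, Real.exp (a j ^ 2) := Finset.prod_le_prod (fun j _ => by positivity) fun j _ => by
        linarith [Real.add_one_le_exp (a j ^ 2)]
      _ = Real.exp (∑ j, a j ^ 2) := (Real.exp_sum _ _).symm
      _ ≤ Real.exp 1 := Real.exp_le_exp.2 ha
      _ ≤ 2 ^ 2 := by linarith [Real.exp_one_lt_d9]
  · have h := congrArg Complex.im (sum_prod_mul_signFun (fun j => a j * Complex.I) k)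
    rw [Complex.im_sum] at h
    simp only [Complex.im_mul_ofReal] at h
    rw [h, ← Complex.ofReal_natCast, Complex.im_ofReal_mul, Complex.im_ofReal_mul,
      Complex.I_im, mul_one]

theorem rademacher_single (i : ι) (ω : ι → ℤˣ) :
    rademacher (EuclideanSpace.single i (1 : ℝ)) ω = signFun ω i := by
  simp [rademacher_apply]

theorem sum_signFun_smul_shiftFun (f : (ι → ℤˣ) → ℝ) (i : ι) :
    ∑ g : ι → ℤˣ, signFun g i • shiftFun g f =
      (∑ ω, f ω * signFun ω i) • rademacher (EuclideanSpace.single i (1 : ℝ)) := by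
  ext x
  simp only [Finset.sum_apply, Pi.smul_apply, smul_eq_mul, shiftFun_apply, rademacher_single]
  rw [Finset.sum_mul]
  refine Fintype.sum_equiv (Equiv.mulRight x) _ _ fun g => ?_
  rw [Equiv.coe_mulRight, signFun_mul]
  linear_combination (-(signFun g i * f (g * x))) * signFun_mul_self x i

/-- Averaging a left inverse of `rademacher` over translations yields the Rademacher
coefficients. -/
theorem sum_shiftFun_rademacher (β : ((ι → ℤˣ) → ℝ) →ₗ[ℝ] EuclideanSpace ℝ ι)
    (hβ : ∀ a, β (rademacher a) = a) (f : (ι → ℤˣ) → ℝ) :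
    ∑ g : ι → ℤˣ, shiftFun g (rademacher (β (shiftFun g f))) =
      rademacher (WithLp.toLp 2 fun i => ∑ ω, f ω * signFun ω i) := by
  ext x
  have h : ∀ i, ∑ g : ι → ℤˣ, signFun g i * β (shiftFun g f) i = ∑ ω, f ω * signFun ω i := by
    intro i
    have := congrArg (fun u => β u i) (sum_signFun_smul_shiftFun f i)
    simpa [map_sum, hβ] using this
  simp only [Finset.sum_apply, shiftFun_apply, rademacher_apply, signFun_mul]
  rw [Finset.sum_comm]
  refine Finset.sum_congr rfl fun i _ => ?_
  rw [← h, Finset.sum_mul]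
  refine Finset.sum_congr rfl fun g _ => ?_
  ring

theorem sum_shiftFun (f : (ι → ℤˣ) → ℝ) :
    ∑ g : ι → ℤˣ, shiftFun g f = fun _ => ∑ ω, f ω := by
  ext x
  simp only [Finset.sum_apply, shiftFun_apply]
  exact Equiv.sum_comp (Equiv.mulRight x) f

variable {K M : ℝ} {p : Seminorm ℝ ((ι → ℤˣ) → ℝ)}

theorem rademacher_lower (hp : IsUnconditional K p) (hM : 0 ≤ M)
    (hshift : ∀ g v, p (shiftFun g v) ≤ M * p v) {a : EuclideanSpace ℝ ι} (ha : ‖a‖ = 1) :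
    p 1 ≤ M * (2 * K) * p (rademacher a) := by
  have hsq : ∑ i, a i ^ 2 = 1 := by rw [← EuclideanSpace.real_norm_sq_eq, ha, one_pow]
  obtain ⟨f, hf, hcoef⟩ := exists_abs_le_sum_mul_signFun a hsq.le
  have hcard : (0 : ℝ) < Fintype.card (ι → ℤˣ) := Nat.cast_pos.2 Fintype.card_pos
  have hmean : ∑ g : ι → ℤˣ, shiftFun g (f * rademacher a) =
      (Fintype.card (ι → ℤˣ) : ℝ) • 1 := by
    rw [sum_shiftFun]
    ext x
    have : ∑ ω, (f * rademacher a) ω = ∑ i, a i * ∑ ω, f ω * signFun ω i := by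
      simp only [Pi.mul_apply, rademacher_apply, Finset.mul_sum]
      rw [Finset.sum_comm]
      refine Finset.sum_congr rfl fun i _ => Finset.sum_congr rfl fun ω _ => ?_
      ring
    rw [this]
    simp only [hcoef, Pi.smul_apply, Pi.one_apply, smul_eq_mul, mul_one]
    calc _ = (Fintype.card (ι → ℤˣ) : ℝ) * ∑ i, a i ^ 2 := by
          rw [Finset.mul_sum]
          exact Finset.sum_congr rfl fun i _ => by ring
      _ = _ := by rw [hsq, mul_one]
  have h1 := p.map_finset_sum_le Finset.univ fun g : ι → ℤˣ => shiftFun g (f * rademacher a)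
  rw [hmean, map_smul_eq_mul, Real.norm_of_nonneg hcard.le] at h1
  have h2 := h1.trans (Finset.sum_le_sum fun g _ => (hshift g _).trans
    (mul_le_mul_of_nonneg_left (hp.le_of_abs_le_two hf) hM))
  rw [Finset.sum_const, nsmul_eq_mul, Finset.card_univ] at h2
  rw [mul_assoc]
  exact le_of_mul_le_mul_left h2 hcard

theorem rademacher_upper (hp : IsUnconditional K p) (hM : 0 ≤ M)
    (hshift : ∀ g v, p (shiftFun g v) ≤ M * p v) {c : ℝ} (hc : 0 ≤ c)
    (β : ((ι → ℤˣ) → ℝ) →ₗ[ℝ] EuclideanSpace ℝ ι) (hβ : ∀ a, β (rademacher a) = a)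
    (hβc : ∀ f, p (rademacher (β f)) ≤ c * p f) {a : EuclideanSpace ℝ ι} (ha : ‖a‖ ≤ 1) :
    p (rademacher a) ≤ M ^ 2 * c * (2 * K) * p 1 := by
  have hsq : ∑ i, a i ^ 2 ≤ 1 := by
    rw [← EuclideanSpace.real_norm_sq_eq]
    exact pow_le_one₀ (norm_nonneg _) ha
  obtain ⟨f, hf, hcoef⟩ := exists_abs_le_sum_mul_signFun a hsq
  have hcard : (0 : ℝ) < Fintype.card (ι → ℤˣ) := Nat.cast_pos.2 Fintype.card_pos
  have hsum : ∑ g : ι → ℤˣ, shiftFun g (rademacher (β (shiftFun g f))) =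
      (Fintype.card (ι → ℤˣ) : ℝ) • rademacher a := by
    rw [sum_shiftFun_rademacher β hβ, ← map_smul]
    congr 1
    ext i
    simp [hcoef]
  have hf1 : p f ≤ 2 * K * p 1 := by
    have := hp.le_of_abs_le_two (v := 1) hf
    rwa [mul_one] at this
  have h1 := p.map_finset_sum_le Finset.univ
    fun g : ι → ℤˣ => shiftFun g (rademacher (β (shiftFun g f)))
  rw [hsum, map_smul_eq_mul, Real.norm_of_nonneg hcard.le] at h1
  have h2 : ∀ g : ι → ℤˣ, p (shiftFun g (rademacher (β (shiftFun g f)))) ≤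
      M ^ 2 * c * (2 * K) * p 1 := by
    intro g
    calc _ ≤ M * p (rademacher (β (shiftFun g f))) := hshift g _
      _ ≤ M * (c * p (shiftFun g f)) := by gcongr; exact hβc _
      _ ≤ M * (c * (M * p f)) := by gcongr; exact hshift g f
      _ ≤ M * (c * (M * (2 * K * p 1))) := by gcongr
      _ = _ := by ring
  have h3 := h1.trans (Finset.sum_le_sum fun g _ => h2 g)
  rw [Finset.sum_const, nsmul_eq_mul, Finset.card_univ] at h3
  exact le_of_mul_le_mul_left h3 hcard

theorem rademacher_injective :
    Function.Injective (rademacher : EuclideanSpace ℝ ι →ₗ[ℝ] ((ι → ℤˣ) → ℝ)) := by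
  rw [injective_iff_map_eq_zero]
  intro a ha
  ext k
  have h : ∑ ω : ι → ℤˣ, rademacher a ω * signFun ω k = Fintype.card (ι → ℤˣ) * a k := by
    simp only [rademacher_apply, Finset.sum_mul, mul_assoc]
    rw [Finset.sum_comm]
    simp only [← Finset.mul_sum, sum_signFun_mul_signFun]
    simp [mul_comm]
  rw [ha] at h
  simpa using h

/-- Uniform local projections make Euclidean spaces embed uniformly into subspaces of finite
codimension. -/
theorem exists_euclidean_embedding {c : ℝ} (hc0 : 0 < c)
    (hc : ∀ E : Submodule ℝ X, FiniteDimensional ℝ E → LocalProj E c)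
    (hX : ¬ FiniteDimensional ℝ X) :
    ∃ d : ℝ, 0 < d ∧ ∀ (n : ℕ) (S : Finset (X →L[ℝ] ℝ)),
      ∃ J : EuclideanSpace ℝ (Fin n) →ₗ[ℝ] X, (∀ a, J a ∈ jointKer S) ∧
        ∀ a, ‖a‖ ≤ ‖J a‖ ∧ ‖J a‖ ≤ d * ‖a‖ := by
  set M : ℝ := (4 * 4 ^ 4 * (3 * c) ^ 2) ^ 2
  have hM : 0 < M := by positivity
  refine ⟨64 * M ^ 3 * c, by positivity, fun n S => ?_⟩
  obtain ⟨J, hJS, hJ, hshift⟩ := exists_norm_shiftFun_le (G := Fin n → ℤˣ) hc0 hc hX S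
  set p := (normSeminorm ℝ X).comp J
  have hp1 : 0 < p 1 := by
    have := hJ.abs_le 1 1
    rw [Pi.one_apply, abs_one] at this
    linarith
  let r : EuclideanSpace ℝ (Fin n) →ₗ[ℝ] X := J ∘ₗ rademacher
  obtain ⟨s, hs⟩ := r.exists_leftInverse_of_injective
    (LinearMap.ker_eq_bot.2 (hJ.injective.comp rademacher_injective))
  have hs' : ∀ a, s (r a) = a := LinearMap.congr_fun hs
  obtain ⟨P, hP⟩ := hc (LinearMap.range r) inferInstance (LinearMap.range J) inferInstance
  have hβc : ∀ f, p (rademacher ((s ∘ₗ P ∘ₗ J) f)) ≤ c * p f := by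
    intro f
    obtain ⟨⟨a, ha⟩, -, h3⟩ := hP (J f) ⟨f, rfl⟩
    rw [← ha] at h3
    simp only [LinearMap.comp_apply, ← ha, hs']
    exact h3
  have hβ : ∀ a, (s ∘ₗ P ∘ₗ J) (rademacher a) = a := by
    intro a
    have := (hP (J (rademacher a)) ⟨_, rfl⟩).2.1 ⟨a, rfl⟩
    simp only [LinearMap.comp_apply, this]
    exact hs' a
  have hunit : ∀ a : EuclideanSpace ℝ (Fin n), ‖a‖ = 1 →
      1 ≤ 8 * M / p 1 * p (rademacher a) ∧ 8 * M / p 1 * p (rademacher a) ≤ 64 * M ^ 3 * c := by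
    intro a ha
    have hlow := rademacher_lower hJ hM.le hshift ha
    have hup := rademacher_upper hJ hM.le hshift hc0.le _ hβ hβc ha.le
    rw [div_mul_eq_mul_div, one_le_div hp1, div_le_iff₀ hp1]
    refine ⟨by linarith, ?_⟩
    calc _ ≤ 8 * M * (M ^ 2 * c * (2 * 4) * p 1) := by gcongr
      _ = _ := by ring
  have hfac : 0 < 8 * M / p 1 := by positivity
  refine ⟨(8 * M / p 1) • r, fun a => Submodule.smul_mem _ _ (hJS _), fun a => ?_⟩
  rcases eq_or_ne a 0 with rfl | ha
  · simp
  have hna : 0 < ‖a‖ := norm_pos_iff.2 ha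
  have h1 := hunit (‖a‖⁻¹ • a) (by
    rw [norm_smul, norm_inv, norm_norm, inv_mul_cancel₀ hna.ne'])
  rw [map_smul, map_smul_eq_mul, norm_inv, norm_norm, mul_left_comm] at h1
  have h2 : ‖((8 * M / p 1) • r) a‖ = 8 * M / p 1 * p (rademacher a) := by
    rw [LinearMap.smul_apply, norm_smul, Real.norm_of_nonneg hfac.le]
    rfl
  rw [h2]
  rw [le_inv_mul_iff₀ hna, inv_mul_le_iff₀ hna, mul_one] at h1
  exact ⟨h1.1, by linarith [h1.2]⟩

end Rademacher

section LocalToGlobal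

variable {X}

open Filter Topology

theorem exists_forall_euclideanBound {c : ℝ} (hc0 : 0 < c)
    (hc : ∀ E : Submodule ℝ X, FiniteDimensional ℝ E → LocalProj E c) :
    ∃ D : ℝ, ∀ E : Submodule ℝ X, FiniteDimensional ℝ E → EuclideanBound E D := by
  by_cases hX : FiniteDimensional ℝ X
  · obtain ⟨D, T, hT⟩ := exists_euclideanBound (V := X)
    refine ⟨D, fun E _ => ?_⟩
    have hinj : Function.Injective (T ∘ₗ E.subtype) := by
      rw [injective_iff_map_eq_zero]
      intro v hv
      have := (hT v).1
      rw [show T v = 0 from hv, norm_zero] at this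
      exact Subtype.ext (norm_le_zero_iff.1 this)
    obtain ⟨S, hS⟩ := exists_euclidean_norm_eq _ hinj
    exact ⟨S, fun v => by rw [hS]; exact hT v⟩
  · obtain ⟨d, hd, hemb⟩ := exists_euclidean_embedding hc0 hc hX
    refine ⟨2 * (2 * (3 * c) ^ 2 * (1 + d ^ 2)), fun E _ => ?_⟩
    obtain ⟨S, hS⟩ := exists_jointKer_norm_le E
    obtain ⟨J, hJS, hJ⟩ := hemb (Module.finrank ℝ E) S
    refine euclideanBound_of_coupled (L := 3 * c) (by positivity) hd hJ fun T hT => ?_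
    refine coupled_of_norm_le hc E.subtype (J ∘ₗ T) E.injective_subtype fun v w => ?_
    have h1 := hS v v.2 _ (hJS (T w))
    have h2 := norm_sub_le ((v : X) + J (T w)) v
    rw [add_sub_cancel_left] at h2
    change ‖(v : X)‖ ≤ 3 * ‖(v : X) + J (T w)‖ ∧ ‖J (T w)‖ ≤ 3 * ‖(v : X) + J (T w)‖
    constructor <;> linarith [norm_nonneg ((v : X) + J (T w))]

theorem isomorphicToHilbert_of_forall_euclideanBound {D : ℝ}
    (h : ∀ E : Submodule ℝ X, FiniteDimensional ℝ E → EuclideanBound E D) :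
    IsomorphicToHilbert X := by
  have hT : ∀ s : Finset X, ∃ f : X →ₗ[ℝ] X →ₗ[ℝ] ℝ, (∀ x y, f x y = f y x) ∧
      ∀ x ∈ s, ‖x‖ ^ 2 ≤ f x x ∧ f x x ≤ D ^ 2 * ‖x‖ ^ 2 ∧
        ∀ y ∈ s, |f x y| ≤ (D * ‖x‖) * (D * ‖y‖) := by
    intro s
    obtain ⟨S, hS⟩ := h (Submodule.span ℝ (s : Set X)) inferInstance
    obtain ⟨T, hT⟩ := S.exists_extend
    have hTS : ∀ x ∈ s, ‖x‖ ≤ ‖T x‖ ∧ ‖T x‖ ≤ D * ‖x‖ := fun x hx => by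
      have := hS ⟨x, Submodule.subset_span hx⟩
      rwa [← hT] at this
    refine ⟨(innerₗ _).compl₁₂ T T, fun x y => real_inner_comm (T y) (T x), fun x hx => ?_⟩
    simp only [LinearMap.compl₁₂_apply, innerₗ_apply_apply, real_inner_self_eq_norm_sq]
    refine ⟨pow_le_pow_left₀ (norm_nonneg _) (hTS x hx).1 2, ?_, fun y hy => ?_⟩
    · rw [← mul_pow]
      exact pow_le_pow_left₀ (norm_nonneg _) (hTS x hx).2 2
    · exact (abs_real_inner_le_norm _ _).trans (mul_le_mul (hTS x hx).2 (hTS y hy).2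
        (norm_nonneg _) ((norm_nonneg _).trans (hTS x hx).2))
  choose B hsymm hB using hT
  let U : Ultrafilter (Finset X) := Ultrafilter.of atTop
  have hmem : ∀ x : X, ∀ᶠ s : Finset X in (U : Filter (Finset X)), x ∈ s := fun x =>
    Ultrafilter.of_le _ ((eventually_ge_atTop {x}).mono fun s hs =>
      Finset.singleton_subset_iff.1 hs)
  have hlim : ∀ x y, ∃ l, Tendsto (fun s => B s x y) U (𝓝 l) := by
    intro x y
    obtain ⟨l, -, hl⟩ := (isCompact_Icc (a := -((D * ‖x‖) * (D * ‖y‖)))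
      (b := (D * ‖x‖) * (D * ‖y‖))).ultrafilter_le_nhds' (U.map fun s => B s x y) (by
        rw [Ultrafilter.mem_map]
        filter_upwards [hmem x, hmem y] with s hx hy
        exact abs_le.1 ((hB s x hx).2.2 y hy))
    exact ⟨l, hl⟩
  choose f hf using hlim
  have hlow : ∀ x, ‖x‖ ^ 2 ≤ f x x := fun x =>
    ge_of_tendsto (hf x x) ((hmem x).mono fun s hx => (hB s x hx).1)
  have hup : ∀ x, f x x ≤ D ^ 2 * ‖x‖ ^ 2 := fun x =>
    le_of_tendsto (hf x x) ((hmem x).mono fun s hx => (hB s x hx).2.1)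
  refine ⟨f, ⟨fun x y => ?_, fun a x y => ?_, fun x y z => ?_, fun x hx => ?_⟩,
    1, D ^ 2 + 1, one_pos, by positivity, fun x => ⟨?_, ?_⟩⟩
  · refine tendsto_nhds_unique (hf x y) ?_
    simpa only [hsymm _ x y] using hf y x
  · refine tendsto_nhds_unique (hf (a • x) y) ?_
    simpa using (hf x y).const_mul a
  · refine tendsto_nhds_unique (hf (x + y) z) ?_
    simpa using (hf x z).add (hf y z)
  · have := norm_pos_iff.2 hx
    exact lt_of_lt_of_le (by positivity) (hlow x)
  · rw [one_mul]
    exact hlow x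
  · linarith [hup x, sq_nonneg ‖x‖]

theorem isomorphicToHilbert_of_forall_locallyComplemented
    (h : ∀ Z : Submodule ℝ X, IsClosed (Z : Set X) → ∃ c : ℝ, 0 < c ∧ LocallyComplemented X Z c) :
    IsomorphicToHilbert X := by
  obtain ⟨c, hc⟩ := uniformLocalProj_of_forall_isClosed fun Z hZ => by
    obtain ⟨c, -, hc⟩ := h Z hZ
    exact ⟨c, hc.localProj⟩
  obtain ⟨D, hD⟩ := exists_forall_euclideanBound (c := max c 1) (by positivity) fun E hE =>
    (hc E hE fun x _ => by simp [mem_jointKer]).mono (le_max_left _ _)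
  exact isomorphicToHilbert_of_forall_euclideanBound hD

end LocalToGlobal

/-- Corollary 3.A.8: every closed subspace of a real Banach space `X` is locally
complemented in `X` if and only if `X` is isomorphic to a Hilbert space. -/
theorem locally_complemented_iff_hilbert [CompleteSpace X] :
    (∀ Z : Submodule ℝ X, IsClosed (Z : Set X) →
      ∃ c : ℝ, 0 < c ∧ LocallyComplemented X Z c) ↔
    IsomorphicToHilbert X := by
  exact ⟨fun h => isomorphicToHilbert_of_forall_locallyComplemented h,
    fun h Z _ => h.locallyComplemented Z⟩
end

section
/- Let X be a real Banach space such that for every closed subspace M of X, the quotient map φ : X → X/M admits a continuous linear right inverse, i.e., there exists a continuous linear map ψ : X/M → X with φ(ψ(u)) = u for all u ∈ X/M. Then X is isomorphic to a Hilbert space. -/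
universe u

variable (X : Type u) [NormedAddCommGroup X] [NormedSpace ℝ X]

section UniformComplementation

open Metric

variable {V : Type*} [NormedAddCommGroup V] [NormedSpace ℝ V]

/-- A subspace of dimension at most one is the range of a projection of norm at most one. -/
lemma exists_isProj_of_finrank_le_one (E : Submodule ℝ V) [FiniteDimensional ℝ E]
    (hE : Module.finrank ℝ E ≤ 1) :
    ∃ P : V →L[ℝ] V, LinearMap.IsProj E P ∧ ‖P‖ ≤ 1 := by
  obtain ⟨v, hv⟩ := finrank_le_one_iff.1 hE
  by_cases hv0 : (v : V) = 0
  · refine ⟨0, ⟨fun x => by simp, fun x hx => ?_⟩, by simp⟩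
    obtain ⟨c, hc⟩ := hv ⟨x, hx⟩
    have hxc : c • (v : V) = x := congrArg Subtype.val hc
    simp [← hxc, hv0]
  · obtain ⟨g, hg, hgv⟩ := exists_dual_vector ℝ (v : V) (norm_ne_zero_iff.2 hv0)
    have hn : ‖(v : V)‖ ≠ 0 := norm_ne_zero_iff.2 hv0
    refine ⟨(‖(v : V)‖⁻¹ • g).smulRight (v : V), ⟨fun x => ?_, fun x hx => ?_⟩, ?_⟩
    · exact E.smul_mem _ v.2
    · obtain ⟨c, hc⟩ := hv ⟨x, hx⟩
      have hxc : c • (v : V) = x := congrArg Subtype.val hc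
      rw [← hxc]
      simp only [ContinuousLinearMap.smulRight_apply, smul_apply, map_smul,
        hgv, smul_eq_mul, RCLike.ofReal_real_eq_id, id]
      rw [inv_mul_cancel₀ hn, one_smul]
    · rw [ContinuousLinearMap.norm_smulRight_apply, norm_smul, hg, norm_inv, norm_norm]
      field_simp
      exact le_rfl

/-- All finite-dimensional subspaces of `Y` are ranges of projections of the ambient space with
uniformly bounded norms. -/
def UniformlyComplemented (Y : Submodule ℝ V) : Prop :=
  ∃ c : ℝ, ∀ E : Submodule ℝ V, FiniteDimensional ℝ E → E ≤ Y →
    ∃ P : V →L[ℝ] V, LinearMap.IsProj E P ∧ ‖P‖ ≤ c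

lemma UniformlyComplemented.of_inf_ker {Y : Submodule ℝ V} (f : V →L[ℝ] ℝ)
    (h : UniformlyComplemented (Y ⊓ LinearMap.ker (f : V →ₗ[ℝ] ℝ))) :
    UniformlyComplemented Y := by
  obtain ⟨c, hc⟩ := h
  refine ⟨c + 1 * (1 + c), fun E hE hEY => ?_⟩
  set N := LinearMap.ker (f : V →ₗ[ℝ] ℝ)
  have hfd : FiniteDimensional ℝ (E ⊓ N : Submodule ℝ V) :=
    Submodule.finiteDimensional_of_le inf_le_left
  obtain ⟨Q, hQ, hQc⟩ := hc (E ⊓ N) hfd (inf_le_inf_right _ hEY)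
  set E' : Submodule ℝ V := E ⊓ LinearMap.ker (Q : V →ₗ[ℝ] V)
  have hfd' : FiniteDimensional ℝ E' := Submodule.finiteDimensional_of_le inf_le_left
  have hinj : Function.Injective ((f : V →ₗ[ℝ] ℝ).domRestrict E') := by
    rw [← LinearMap.ker_eq_bot, LinearMap.ker_eq_bot']
    rintro ⟨x, hxE, hxQ⟩ hx
    have h1 : Q x = x := hQ.map_id x ⟨hxE, hx⟩
    have h2 : Q x = 0 := hxQ
    exact Subtype.ext (h1.symm.trans h2)
  have hrank : Module.finrank ℝ E' ≤ 1 := by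
    simpa using LinearMap.finrank_le_finrank_of_injective hinj
  obtain ⟨R, hR, hR1⟩ := exists_isProj_of_finrank_le_one E' hrank
  have hQE : ∀ x, Q x ∈ E := fun x => (hQ.map_mem x).1
  refine ⟨Q + R.comp (1 - Q), ⟨fun x => ?_, fun x hx => ?_⟩, ?_⟩
  · exact E.add_mem (hQE x) (hR.map_mem _).1
  · have hmem : x - Q x ∈ E' := by
      refine ⟨E.sub_mem hx (hQE x), ?_⟩
      change Q (x - Q x) = 0
      rw [map_sub, hQ.map_id _ (hQ.map_mem x), sub_self]
    have : R (x - Q x) = x - Q x := hR.map_id _ hmem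
    change Q x + R (x - Q x) = x
    rw [this, add_sub_cancel]
  · have h1 : ‖(1 : V →L[ℝ] V) - Q‖ ≤ 1 + c :=
      (norm_sub_le _ _).trans (add_le_add ContinuousLinearMap.norm_id_le hQc)
    calc ‖Q + R.comp (1 - Q)‖ ≤ ‖Q‖ + ‖R‖ * ‖(1 : V →L[ℝ] V) - Q‖ :=
          (norm_add_le _ _).trans (add_le_add le_rfl (R.opNorm_comp_le _))
      _ ≤ c + 1 * (1 + c) := by gcongr

/-- The common kernel of finitely many continuous functionals. -/
def commonKer (s : Finset (V →L[ℝ] ℝ)) : Submodule ℝ V where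
  carrier := {x | ∀ f ∈ s, f x = 0}
  add_mem' := fun ha hb f hf => by simp [ha f hf, hb f hf]
  zero_mem' := fun f _ => map_zero f
  smul_mem' := fun c x hx f hf => by simp [hx f hf]

lemma mem_commonKer {s : Finset (V →L[ℝ] ℝ)} {x : V} :
    x ∈ commonKer s ↔ ∀ f ∈ s, f x = 0 := Iff.rfl

lemma commonKer_anti {s t : Finset (V →L[ℝ] ℝ)} (h : s ⊆ t) : commonKer t ≤ commonKer s :=
  fun _ hx f hf => hx f (h hf)

lemma UniformlyComplemented.of_commonKer (s : Finset (V →L[ℝ] ℝ))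
    (h : UniformlyComplemented (commonKer s)) : UniformlyComplemented (⊤ : Submodule ℝ V) := by
  classical
  induction s using Finset.induction_on with
  | empty =>
    convert h
    exact (eq_top_iff.2 fun x _ f hf => by simp at hf).symm
  | insert f s _ ih =>
    refine ih (UniformlyComplemented.of_inf_ker f ?_)
    convert h using 1
    ext x
    simp [mem_commonKer, and_comm]

/-- Finitely many functionals norm a finite-dimensional subspace up to the factor two, and their
common kernel lies in the kernel of some continuous projection onto the subspace. -/
lemma exists_commonKer_norm_le (F : Submodule ℝ V) [FiniteDimensional ℝ F]
    (s : Finset (V →L[ℝ] ℝ)) :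
    ∃ t : Finset (V →L[ℝ] ℝ), s ⊆ t ∧
      (∀ x ∈ F, ∀ y ∈ commonKer t, ‖x‖ ≤ 2 * ‖x + y‖) ∧
      ∃ S : V →L[ℝ] V, LinearMap.IsProj F S ∧ ∀ y ∈ commonKer t, S y = 0 := by
  classical
  obtain ⟨N, hNS, hNf, hN⟩ :=
    (isCompact_sphere (0 : F) 1).finite_cover_balls (show (0 : ℝ) < 1 / 2 by norm_num)
  choose g hg hgv using fun v : F => exists_dual_vector'' ℝ (v : V)
  set t : Finset (V →L[ℝ] ℝ) := s ∪ hNf.toFinset.image g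
  have hnorm : ∀ x ∈ F, ∀ y ∈ commonKer t, ‖x‖ ≤ 2 * ‖x + y‖ := by
    intro x hx y hy
    by_cases hx0 : x = 0
    · simp [hx0]
    have hxn : ‖x‖ ≠ 0 := norm_ne_zero_iff.2 hx0
    have hmem : (‖x‖⁻¹ • (⟨x, hx⟩ : F)) ∈ sphere (0 : F) 1 := by
      rw [mem_sphere_zero_iff_norm, norm_smul, norm_inv, norm_norm]
      exact inv_mul_cancel₀ hxn
    obtain ⟨v, hv, hxv⟩ := Set.mem_iUnion₂.1 (hN hmem)
    have hv1 : ‖(v : V)‖ = 1 := by simpa using hNS hv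
    have hd : ‖‖x‖⁻¹ • x - (v : V)‖ < 1 / 2 := by
      rw [mem_ball, dist_eq_norm] at hxv
      exact hxv
    have hgy : g v y = 0 := hy _ (by
      simp only [t, Finset.mem_union, Finset.mem_image, Set.Finite.mem_toFinset]
      exact Or.inr ⟨v, hv, rfl⟩)
    have h1 : g v (‖x‖⁻¹ • x - (v : V)) ≥ -(1 / 2) := by
      have := (g v).le_of_opNorm_le (hg v) (‖x‖⁻¹ • x - (v : V))
      have := (abs_le.1 ((Real.norm_eq_abs _).symm.trans_le this)).1
      linarith
    have h2 : g v (x + y) ≤ ‖x + y‖ := by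
      have := (g v).le_of_opNorm_le (hg v) (x + y)
      linarith [le_abs_self (g v (x + y)), Real.norm_eq_abs (g v (x + y))]
    rw [map_sub, map_smul, hgv, smul_eq_mul] at h1
    simp only [RCLike.ofReal_real_eq_id, id, hv1] at h1
    rw [map_add, hgy, add_zero] at h2
    have h3 : 1 / 2 ≤ ‖x‖⁻¹ * g v x := by linarith
    rw [inv_mul_eq_div, le_div_iff₀ (by positivity)] at h3
    linarith
  refine ⟨t, Finset.subset_union_left, hnorm, ?_⟩
  let Φ : V →L[ℝ] (t → ℝ) := ContinuousLinearMap.pi fun f => (f : V →L[ℝ] ℝ)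
  have hker : LinearMap.ker ((Φ : V →ₗ[ℝ] (t → ℝ)).domRestrict F) = ⊥ := by
    rw [LinearMap.ker_eq_bot']
    rintro ⟨x, hx⟩ h
    have hxt : -x ∈ commonKer t := fun f hf => by
      have := congrFun h ⟨f, hf⟩
      simpa [Φ] using this
    have := hnorm x hx _ hxt
    simp only [add_neg_cancel, norm_zero, mul_zero, norm_le_zero_iff] at this
    exact Subtype.ext this
  obtain ⟨G, hG⟩ := LinearMap.exists_leftInverse_of_injective _ hker
  refine ⟨F.subtypeL.comp ((LinearMap.toContinuousLinearMap G).comp Φ),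
    ⟨fun x => (G (Φ x)).2, fun x hx => ?_⟩, fun y hy => ?_⟩
  · exact congrArg Subtype.val (LinearMap.congr_fun hG ⟨x, hx⟩)
  · have : Φ y = 0 := funext fun f => hy _ f.2
    simp [this]

/-- **Davis–Dean–Singer**: if all closed subspaces are complemented then the finite-dimensional
subspaces are uniformly complemented. -/
theorem uniformlyComplemented_of_forall_closed
    (h : ∀ M : Submodule ℝ V, IsClosed (M : Set V) →
      ∃ P : V →L[ℝ] V, LinearMap.IsProj M P) :
    UniformlyComplemented (⊤ : Submodule ℝ V) := by
  classical
  by_contra hnot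
  have hbad : ∀ (s : Finset (V →L[ℝ] ℝ)) (n : ℕ), ∃ E : Submodule ℝ V, FiniteDimensional ℝ E ∧
      E ≤ commonKer s ∧ ∀ P : V →L[ℝ] V, LinearMap.IsProj E P → (n : ℝ) < ‖P‖ := by
    intro s n
    by_contra! hcon
    exact hnot (UniformlyComplemented.of_commonKer s ⟨n, hcon⟩)
  choose E hEfd hEle hEP using hbad
  choose t hst hnorm S hS hSt using fun F : {F : Submodule ℝ V // FiniteDimensional ℝ F} =>
    haveI := F.2; exists_commonKer_norm_le (F : Submodule ℝ V)
  let G : ℕ → {F : Submodule ℝ V // FiniteDimensional ℝ F} × Finset (V →L[ℝ] ℝ) := fun n =>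
    Nat.rec (⟨⊥, inferInstance⟩, ∅)
      (fun n σ => (⟨σ.1.1 ⊔ E (t σ.1 σ.2) n,
        haveI := σ.1.2; haveI := hEfd (t σ.1 σ.2) n; inferInstance⟩, t σ.1 σ.2)) n
  let F : ℕ → Submodule ℝ V := fun n => (G n).1.1
  let T : ℕ → Finset (V →L[ℝ] ℝ) := fun n => t (G n).1 (G n).2
  let D : ℕ → Submodule ℝ V := fun n => E (T n) n
  let R : ℕ → V →L[ℝ] V := fun n => S (G n).1 (G n).2
  have hFsucc : ∀ n, F (n + 1) = F n ⊔ D n := fun n => rfl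
  have hFmono : Monotone F := monotone_nat_of_le_succ fun n => by
    rw [hFsucc]; exact le_sup_left
  have hTmono : Monotone T := monotone_nat_of_le_succ fun n => hst (G (n + 1)).1 (G (n + 1)).2
  have hFT : ∀ n m, n ≤ m → F m ≤ F n ⊔ commonKer (T n) := by
    intro n m hnm
    induction m, hnm using Nat.le_induction with
    | base => exact le_sup_left
    | succ m hnm ih =>
      rw [hFsucc]
      exact sup_le ih (((hEle (T m) m).trans (commonKer_anti (hTmono hnm))).trans le_sup_right)
  have hR : ∀ n, ∀ a ∈ F n, ∀ y ∈ commonKer (T n), R n (a + y) = a := by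
    intro n a ha y hy
    rw [map_add, (hS (G n).1 (G n).2).map_id a ha, hSt (G n).1 (G n).2 y hy, add_zero]
  let U : Submodule ℝ V := ⨆ n, F n
  have hU : ∀ n, ∀ x ∈ U, ∃ m, n ≤ m ∧ x ∈ F m := by
    intro n x hx
    obtain ⟨m, hm⟩ := (Submodule.mem_iSup_of_directed F hFmono.directed_le).1 hx
    exact ⟨max n m, le_max_left _ _, hFmono (le_max_right _ _) hm⟩
  have hRU : ∀ n, ∀ x ∈ closure (U : Set V), ‖R n x‖ ≤ 2 * ‖x‖ := by
    intro n
    refine closure_minimal (fun x hx => ?_)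
      (isClosed_le (R n).continuous.norm (continuous_const.mul continuous_norm))
    obtain ⟨m, hnm, hxm⟩ := hU n x hx
    obtain ⟨a, ha, y, hy, rfl⟩ := Submodule.mem_sup.1 (hFT n m hnm hxm)
    change ‖R n (a + y)‖ ≤ 2 * ‖a + y‖
    rw [hR n a ha y hy]
    exact hnorm (G n).1 (G n).2 a ha y hy
  have hRD : ∀ n, ∀ x ∈ closure (U : Set V), R (n + 1) x - R n x ∈ D n := by
    intro n
    have : FiniteDimensional ℝ (D n) := hEfd _ _
    refine closure_minimal (fun x hx => ?_)
      ((D n).closed_of_finiteDimensional.preimage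
        ((R (n + 1)).continuous.sub (R n).continuous))
    obtain ⟨m, hnm, hxm⟩ := hU (n + 1) x hx
    obtain ⟨a, ha, y, hy, rfl⟩ := Submodule.mem_sup.1 (hFT (n + 1) m hnm hxm)
    have hy' : y ∈ commonKer (T n) := commonKer_anti (hTmono n.le_succ) hy
    obtain ⟨b, hb, e, he, rfl⟩ := Submodule.mem_sup.1 (show a ∈ F n ⊔ D n from ha)
    have hey : e + y ∈ commonKer (T n) := Submodule.add_mem _ (hEle (T n) n he) hy'
    have h1 := hR (n + 1) (b + e) ha y hy
    have h2 := hR n b hb (e + y) hey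
    rw [← add_assoc] at h2
    change R (n + 1) (b + e + y) - R n (b + e + y) ∈ D n
    rw [h1, h2, add_sub_cancel_left]
    exact he
  obtain ⟨P, hP⟩ := h U.topologicalClosure U.isClosed_topologicalClosure
  have hPU : ∀ x, P x ∈ closure (U : Set V) := fun x => hP.map_mem x
  obtain ⟨n, hn⟩ := exists_nat_ge (4 * ‖P‖)
  have hproj : LinearMap.IsProj (D n) ((R (n + 1) - R n).comp P) := by
    refine ⟨fun x => hRD n _ (hPU x), fun e he => ?_⟩
    have heF : e ∈ F (n + 1) := (le_sup_right : D n ≤ F n ⊔ D n) he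
    have heU : e ∈ U.topologicalClosure := U.le_topologicalClosure 
      (Submodule.mem_iSup_of_mem (p := F) (n + 1) heF)
    have h1 := hR (n + 1) e heF 0 (Submodule.zero_mem _)
    have h2 := hR n 0 (Submodule.zero_mem _) e (hEle (T n) n he)
    rw [add_zero] at h1
    rw [zero_add] at h2
    simp [hP.map_id e heU, h1, h2]
  have hlt := hEP (T n) n _ hproj
  refine absurd (hlt.trans_le ?_) (lt_irrefl _)
  refine (ContinuousLinearMap.opNorm_le_bound _ (by positivity) fun x => ?_).trans hn
  calc ‖R (n + 1) (P x) - R n (P x)‖ ≤ 2 * ‖P x‖ + 2 * ‖P x‖ :=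
        (norm_sub_le _ _).trans (add_le_add (hRU (n + 1) _ (hPU x)) (hRU n _ (hPU x)))
    _ = 4 * ‖P x‖ := by ring
    _ ≤ 4 * (‖P‖ * ‖x‖) := by gcongr; exact P.le_opNorm x
    _ = 4 * ‖P‖ * ‖x‖ := by ring

end UniformComplementation

section RademacherSums

open Finset
open scoped BigOperators

/-- A sign as a real number. -/
def signReal (u : ℤˣ) : ℝ := ((u : ℤ) : ℝ)

@[simp] lemma signReal_one : signReal 1 = 1 := by simp [signReal]

@[simp] lemma signReal_neg_one : signReal (-1) = -1 := by simp [signReal]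

lemma signReal_mul (u v : ℤˣ) : signReal (u * v) = signReal u * signReal v := by
  simp [signReal]

@[simp] lemma signReal_sq (u : ℤˣ) : signReal u ^ 2 = 1 := by
  rcases Int.units_eq_one_or u with rfl | rfl <;> simp

@[simp] lemma abs_signReal (u : ℤˣ) : |signReal u| = 1 := by
  rcases Int.units_eq_one_or u with rfl | rfl <;> simp

lemma exists_eq_signReal_mul_abs (c : ℝ) : ∃ u : ℤˣ, c = signReal u * |c| := by
  rcases le_total 0 c with h | h
  · exact ⟨1, by simp [abs_of_nonneg h]⟩
  · exact ⟨-1, by simp [abs_of_nonpos h]⟩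

lemma expect_mul_left {G : Type*} [Group G] [Fintype G] (g : G) (F : G → ℝ) :
    𝔼 x, F (g * x) = 𝔼 x, F x :=
  Fintype.expect_equiv (Equiv.mulLeft g) _ _ fun _ => rfl

lemma expect_mul_right {G : Type*} [Group G] [Fintype G] (g : G) (F : G → ℝ) :
    𝔼 x, F (x * g) = 𝔼 x, F x :=
  Fintype.expect_equiv (Equiv.mulRight g) _ _ fun _ => rfl

section Moments

variable {ι : Type*} [DecidableEq ι]

/-- The sign vector whose only negative entry is at `i`. -/
def flipAt (i : ι) : ι → ℤˣ := Pi.mulSingle i (-1)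

@[simp] lemma flipAt_same (i : ι) : flipAt i i = -1 := by simp [flipAt]

lemma flipAt_of_ne {i j : ι} (h : j ≠ i) : flipAt i j = 1 := by simp [flipAt, h]

@[simp] lemma flipAt_mul_self (i : ι) : flipAt i * flipAt i = 1 := by
  rw [flipAt, ← Pi.mulSingle_mul]; simp

lemma flipAt_mul_flipAt_mul (i : ι) (ε : ι → ℤˣ) : flipAt i * (flipAt i * ε) = ε := by
  rw [← mul_assoc, flipAt_mul_self, one_mul]

lemma sum_signReal_flipAt {s : Finset ι} {i : ι} (hi : i ∉ s) (θ : ι → ℝ) (ε : ι → ℤˣ) :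
    ∑ j ∈ s, θ j * signReal ((flipAt i * ε) j) = ∑ j ∈ s, θ j * signReal (ε j) := by
  refine sum_congr rfl fun j hj => ?_
  rw [Pi.mul_apply, flipAt_of_ne (ne_of_mem_of_not_mem hj hi), one_mul]

variable [Fintype ι]

/-- A function odd in the sign at `i` has mean zero. -/
lemma expect_signReal_mul_eq_zero (i : ι) (F : (ι → ℤˣ) → ℝ)
    (hF : ∀ ε, F (flipAt i * ε) = F ε) : 𝔼 ε, signReal (ε i) * F ε = 0 := by
  have h := expect_mul_left (flipAt i) fun ε : ι → ℤˣ => signReal (ε i) * F ε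
  simp only [Pi.mul_apply, flipAt_same, signReal_mul, signReal_neg_one, hF] at h
  simp only [neg_mul, one_mul, expect_neg_distrib] at h
  linarith

lemma expect_sum_signReal_sq (θ : ι → ℝ) (s : Finset ι) :
    𝔼 ε : ι → ℤˣ, (∑ i ∈ s, θ i * signReal (ε i)) ^ 2 = ∑ i ∈ s, θ i ^ 2 := by
  induction s using Finset.induction_on with
  | empty => simp
  | insert i s hi ih =>
    have h0 := expect_signReal_mul_eq_zero i
      (fun ε => ∑ j ∈ s, θ j * signReal (ε j)) (sum_signReal_flipAt hi θ)
    calc 𝔼 ε : ι → ℤˣ, (∑ j ∈ insert i s, θ j * signReal (ε j)) ^ 2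
        = 𝔼 ε : ι → ℤˣ, (θ i ^ 2 + (2 * θ i) * (signReal (ε i) * ∑ j ∈ s, θ j * signReal (ε j)) +
            (∑ j ∈ s, θ j * signReal (ε j)) ^ 2) := by
          refine expect_congr rfl fun ε _ => ?_
          rw [sum_insert hi]
          linear_combination θ i ^ 2 * signReal_sq (ε i)
      _ = ∑ j ∈ insert i s, θ j ^ 2 := by
          rw [expect_add_distrib, expect_add_distrib, ← mul_expect, h0, ih, sum_insert hi,
            Fintype.expect_const]
          ring

lemma expect_sum_signReal_pow_four_le (θ : ι → ℝ) (s : Finset ι) :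
    𝔼 ε : ι → ℤˣ, (∑ i ∈ s, θ i * signReal (ε i)) ^ 4 ≤ 3 * (∑ i ∈ s, θ i ^ 2) ^ 2 := by
  induction s using Finset.induction_on with
  | empty => simp
  | insert i s hi ih =>
    have h1 := expect_signReal_mul_eq_zero i
      (fun ε => ∑ j ∈ s, θ j * signReal (ε j)) (sum_signReal_flipAt hi θ)
    have h3 := expect_signReal_mul_eq_zero i
      (fun ε => (∑ j ∈ s, θ j * signReal (ε j)) ^ 3)
      (fun ε => by simp only [sum_signReal_flipAt hi θ])
    have h2 := expect_sum_signReal_sq θ s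
    calc 𝔼 ε : ι → ℤˣ, (∑ j ∈ insert i s, θ j * signReal (ε j)) ^ 4
        = 𝔼 ε : ι → ℤˣ, (θ i ^ 4 +
            (4 * θ i ^ 3) * (signReal (ε i) * ∑ j ∈ s, θ j * signReal (ε j)) +
            (6 * θ i ^ 2) * (∑ j ∈ s, θ j * signReal (ε j)) ^ 2 +
            (4 * θ i) * (signReal (ε i) * (∑ j ∈ s, θ j * signReal (ε j)) ^ 3) +
            (∑ j ∈ s, θ j * signReal (ε j)) ^ 4) := by
          refine expect_congr rfl fun ε _ => ?_
          rw [sum_insert hi]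
          generalize ∑ j ∈ s, θ j * signReal (ε j) = S
          linear_combination (θ i ^ 4 * (signReal (ε i) ^ 2 + 1) +
            4 * θ i ^ 3 * signReal (ε i) * S + 6 * θ i ^ 2 * S ^ 2) * signReal_sq (ε i)
      _ ≤ 3 * (∑ j ∈ insert i s, θ j ^ 2) ^ 2 := by
          rw [expect_add_distrib, expect_add_distrib, expect_add_distrib, expect_add_distrib,
            ← mul_expect, ← mul_expect, ← mul_expect, h1, h2, h3, sum_insert hi,
            Fintype.expect_const]
          nlinarith [sq_nonneg (θ i ^ 2)]

/-- A form of **Khintchine's inequality**. -/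
lemma le_expect_abs_sum_signReal (θ : ι → ℝ) (hθ : ∑ i, θ i ^ 2 = 1) :
    1 / 2 ≤ 𝔼 ε : ι → ℤˣ, |∑ i, θ i * signReal (ε i)| := by
  have h2 := expect_sum_signReal_sq θ univ
  have h4 := expect_sum_signReal_pow_four_le θ univ
  rw [hθ] at h2 h4
  have hpt : ∀ t : ℝ, 3 / 4 * t ^ 2 - 1 / 16 * t ^ 4 ≤ |t| := by
    intro t
    rw [← sq_abs t, show t ^ 4 = |t| ^ 4 by rw [pow_abs, abs_of_nonneg (by positivity)]]
    have : 0 ≤ |t| * ((|t| - 2) ^ 2 * (|t| + 4)) := by positivity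
    nlinarith
  calc (1 : ℝ) / 2 ≤ 3 / 4 * 1 - 1 / 16 * (3 * 1 ^ 2) := by norm_num
    _ ≤ 𝔼 ε : ι → ℤˣ, (3 / 4 * (∑ i, θ i * signReal (ε i)) ^ 2 -
          1 / 16 * (∑ i, θ i * signReal (ε i)) ^ 4) := by
        rw [expect_sub_distrib, ← mul_expect, ← mul_expect, h2]
        linarith
    _ ≤ _ := expect_le_expect fun ε _ => hpt _

lemma expect_abs_sum_signReal_le (θ : ι → ℝ) (hθ : ∑ i, θ i ^ 2 = 1) :
    𝔼 ε : ι → ℤˣ, |∑ i, θ i * signReal (ε i)| ≤ 1 := by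
  have h2 := expect_sum_signReal_sq θ univ
  rw [hθ] at h2
  calc 𝔼 ε : ι → ℤˣ, |∑ i, θ i * signReal (ε i)|
      ≤ 𝔼 ε : ι → ℤˣ, (1 / 2 + 1 / 2 * (∑ i, θ i * signReal (ε i)) ^ 2) :=
        expect_le_expect fun ε _ => by
          nlinarith [sq_nonneg (|∑ i, θ i * signReal (ε i)| - 1),
            sq_abs (∑ i, θ i * signReal (ε i))]
    _ = 1 := by
        rw [expect_add_distrib, Fintype.expect_const, ← mul_expect, h2]; norm_num

end Moments

section Poincare

variable {ι : Type*} [Fintype ι] [DecidableEq ι]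

lemma eq_of_forall_flipAt {F : (ι → ℤˣ) → ℝ} (hF : ∀ i ε, F (flipAt i * ε) = F ε)
    (ε : ι → ℤˣ) : F ε = F 1 := by
  let H : Submonoid (ι → ℤˣ) :=
    { carrier := {η | ∀ ε, F (η * ε) = F ε}
      mul_mem' := fun {a b} ha hb ε => by rw [mul_assoc, ha, hb]
      one_mem' := fun ε => by rw [one_mul] }
  have hmem : ε ∈ H := by
    rw [← Finset.univ_prod_mulSingle ε]
    refine Submonoid.prod_mem _ fun i _ => ?_
    rcases Int.units_eq_one_or (ε i) with h | h
    · rw [h, Pi.mulSingle_one]; exact H.one_mem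
    · rw [h]; exact hF i
  simpa using hmem 1

lemma exists_flip_invariant (F : (ι → ℤˣ) → ℝ) (s : Finset ι) :
    ∃ F' : (ι → ℤˣ) → ℝ, 𝔼 ε, F' ε = 𝔼 ε, F ε ∧
      (∀ i ∈ s, ∀ ε, F' (flipAt i * ε) = F' ε) ∧
      (∀ i, 𝔼 ε, (F' ε - F' (flipAt i * ε)) ^ 2 ≤ 𝔼 ε, (F ε - F (flipAt i * ε)) ^ 2) ∧
      𝔼 ε, F ε ^ 2 - 𝔼 ε, F' ε ^ 2 ≤ 1 / 4 * ∑ i ∈ s, 𝔼 ε, (F ε - F (flipAt i * ε)) ^ 2 := by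
  induction s using Finset.induction_on with
  | empty => exact ⟨F, rfl, by simp, fun i => le_rfl, by simp⟩
  | insert i s hi ih =>
    obtain ⟨F', hmean, hinv, hcontr, hvar⟩ := ih
    refine ⟨fun ε => 1 / 2 * (F' ε + F' (flipAt i * ε)), ?_, ?_, fun j => ?_, ?_⟩
    · rw [← mul_expect, expect_add_distrib, expect_mul_left (flipAt i) F', hmean]
      ring
    · intro j hj ε
      beta_reduce
      rcases Finset.mem_insert.1 hj with rfl | hj
      · rw [flipAt_mul_flipAt_mul]; ring
      · rw [hinv j hj, mul_left_comm, hinv j hj]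
    · refine le_trans ?_ (hcontr j)
      let D : (ι → ℤˣ) → ℝ := fun ε => (F' ε - F' (flipAt j * ε)) ^ 2
      calc _ ≤ 𝔼 ε, (1 / 2 * (D ε + D (flipAt i * ε))) := by
            refine expect_le_expect fun ε _ => ?_
            simp only [D]
            rw [mul_left_comm (flipAt i) (flipAt j) ε]
            nlinarith [sq_nonneg ((F' ε - F' (flipAt j * ε)) -
              (F' (flipAt i * ε) - F' (flipAt j * (flipAt i * ε))))]
        _ = 𝔼 ε, D ε := by
            rw [← mul_expect, expect_add_distrib, expect_mul_left (flipAt i) D]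
            ring
    · have hstep : 𝔼 ε, F' ε ^ 2 - 𝔼 ε, (1 / 2 * (F' ε + F' (flipAt i * ε))) ^ 2 =
          1 / 4 * 𝔼 ε, (F' ε - F' (flipAt i * ε)) ^ 2 := by
        have h := expect_mul_left (flipAt i) fun ε => F' ε ^ 2
        have hpt : 𝔼 ε, (1 / 2 * (F' ε + F' (flipAt i * ε))) ^ 2 =
            𝔼 ε, (1 / 2 * F' ε ^ 2 + 1 / 2 * F' (flipAt i * ε) ^ 2 -
              1 / 4 * (F' ε - F' (flipAt i * ε)) ^ 2) :=
          expect_congr rfl fun ε _ => by ring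
        rw [hpt, expect_sub_distrib, expect_add_distrib, ← mul_expect, ← mul_expect, h,
          ← mul_expect]
        ring
      rw [sum_insert hi]
      linarith [hcontr i]

/-- The **Poincaré inequality** on the discrete cube. -/
lemma expect_sq_sub_sq_expect_le (F : (ι → ℤˣ) → ℝ) :
    𝔼 ε, F ε ^ 2 - (𝔼 ε, F ε) ^ 2 ≤ 1 / 4 * ∑ i, 𝔼 ε, (F ε - F (flipAt i * ε)) ^ 2 := by
  obtain ⟨F', hmean, hinv, -, hvar⟩ := exists_flip_invariant F univ
  have hconst := eq_of_forall_flipAt fun i ε => hinv i (mem_univ i) ε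
  have h1 : 𝔼 ε, F' ε = F' 1 := by
    rw [expect_congr rfl fun ε _ => hconst ε, Fintype.expect_const]
  have h2 : 𝔼 ε, F' ε ^ 2 = F' 1 ^ 2 := by
    rw [expect_congr rfl fun ε _ => by rw [hconst ε], Fintype.expect_const]
  rw [← hmean, h1, ← h2]
  exact hvar

end Poincare

end RademacherSums

section VectorRademacherMeans

open Finset
open scoped BigOperators

variable {ι κ Y : Type*} [Fintype ι] [Fintype κ] [NormedAddCommGroup Y] [NormedSpace ℝ Y]

/-- The signed sum `∑ ± f k`. -/
noncomputable def signedSum (f : κ → Y) (ε : κ → ℤˣ) : Y := ∑ k, signReal (ε k) • f k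

/-- The Rademacher mean `𝔼 ‖∑ ± f k‖`. -/
noncomputable def rademacherMean [DecidableEq κ] (f : κ → Y) : ℝ := 𝔼 ε : κ → ℤˣ, ‖signedSum f ε‖

/-- The finite system `f` is dominated by an orthonormal one. -/
def WeaklyTwoSummable (f : κ → Y) : Prop :=
  ∀ a : κ → ℝ, ‖∑ k, a k • f k‖ ^ 2 ≤ ∑ k, a k ^ 2

/-- The system `(θ i • f k)` indexed by pairs. -/
def scaledCopies (θ : ι → ℝ) (f : κ → Y) : ι × κ → Y := fun p => θ p.1 • f p.2

/-- The coefficient of the `k`-th vector in a signed sum of `scaledCopies θ f`. -/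
def columnSum (θ : ι → ℝ) (ε : ι × κ → ℤˣ) (k : κ) : ℝ := ∑ i, θ i * signReal (ε (i, k))

lemma sum_smul_scaledCopies (θ : ι → ℝ) (f : κ → Y) (a : ι × κ → ℝ) :
    ∑ p, a p • scaledCopies θ f p = ∑ k, (∑ i, θ i * a (i, k)) • f k := by
  rw [Fintype.sum_prod_type_right]
  refine sum_congr rfl fun k _ => ?_
  rw [sum_smul]
  exact sum_congr rfl fun i _ => by rw [scaledCopies, smul_smul, mul_comm]

lemma signedSum_scaledCopies (θ : ι → ℝ) (f : κ → Y) (ε : ι × κ → ℤˣ) :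
    signedSum (scaledCopies θ f) ε = ∑ k, columnSum θ ε k • f k :=
  sum_smul_scaledCopies θ f fun p => signReal (ε p)

lemma WeaklyTwoSummable.scaledCopies {f : κ → Y} (hf : WeaklyTwoSummable f) {θ : ι → ℝ}
    (hθ : ∑ i, θ i ^ 2 = 1) : WeaklyTwoSummable (scaledCopies θ f) := by
  intro a
  rw [sum_smul_scaledCopies, Fintype.sum_prod_type_right]
  refine (hf _).trans (sum_le_sum fun k _ => ?_)
  simpa [hθ] using sum_mul_sq_le_sq_mul_sq univ θ fun i => a (i, k)

lemma WeaklyTwoSummable.sum_sq_le {f : κ → Y} (hf : WeaklyTwoSummable f) {φ : Y →L[ℝ] ℝ}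
    (hφ : ‖φ‖ ≤ 1) : ∑ k, φ (f k) ^ 2 ≤ 1 := by
  have h1 : ∑ k, φ (f k) ^ 2 ≤ ‖∑ k, φ (f k) • f k‖ := by
    calc ∑ k, φ (f k) ^ 2 = φ (∑ k, φ (f k) • f k) := by simp [map_sum, pow_two]
      _ ≤ ‖φ (∑ k, φ (f k) • f k)‖ := Real.le_norm_self _
      _ ≤ 1 * ‖∑ k, φ (f k) • f k‖ := φ.le_of_opNorm_le hφ _
      _ = _ := one_mul _
  have h0 : 0 ≤ ∑ k, φ (f k) ^ 2 := sum_nonneg fun k _ => sq_nonneg _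
  have h2 := hf fun k => φ (f k)
  nlinarith

variable [DecidableEq ι] [DecidableEq κ]

lemma signedSum_flipAt (f : κ → Y) (k : κ) (ε : κ → ℤˣ) :
    signedSum f (flipAt k * ε) = signedSum f ε - (2 * signReal (ε k)) • f k := by
  rw [signedSum, signedSum, ← add_sum_erase _ _ (mem_univ k),
    ← add_sum_erase univ (fun j => signReal (ε j) • f j) (mem_univ k)]
  have : ∑ j ∈ univ.erase k, signReal ((flipAt k * ε) j) • f j =
      ∑ j ∈ univ.erase k, signReal (ε j) • f j :=
    sum_congr rfl fun j hj => by rw [Pi.mul_apply, flipAt_of_ne (ne_of_mem_erase hj), one_mul]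
  rw [this, Pi.mul_apply, flipAt_same, signReal_mul, signReal_neg_one]
  module

lemma norm_le_rademacherMean (f : κ → Y) (k : κ) : ‖f k‖ ≤ rademacherMean f := by
  have h : 2 * ‖f k‖ ≤ 𝔼 ε : κ → ℤˣ, (‖signedSum f ε‖ + ‖signedSum f (flipAt k * ε)‖) := by
    refine le_expect univ_nonempty fun ε _ => ?_
    calc 2 * ‖f k‖ = ‖signedSum f ε - signedSum f (flipAt k * ε)‖ := by
          rw [signedSum_flipAt, sub_sub_cancel, norm_smul, Real.norm_eq_abs, abs_mul,
            abs_signReal]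
          simp
      _ ≤ _ := norm_sub_le _ _
  rw [expect_add_distrib, expect_mul_left (flipAt k) fun ε => ‖signedSum f ε‖] at h
  change ‖f k‖ ≤ 𝔼 ε, ‖signedSum f ε‖
  linarith

/-- The variance of `‖∑ ± f k‖` is bounded by the weak two-summing norm of `f`. -/
lemma WeaklyTwoSummable.variance_le {f : κ → Y} (hf : WeaklyTwoSummable f) :
    𝔼 ε : κ → ℤˣ, (‖signedSum f ε‖ - rademacherMean f) ^ 2 ≤ 2 := by
  set N : (κ → ℤˣ) → ℝ := fun ε => ‖signedSum f ε‖ with hN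
  have hsplit : ∀ k, 𝔼 ε, (N ε - N (flipAt k * ε)) ^ 2 =
      2 * 𝔼 ε, max (N ε - N (flipAt k * ε)) 0 ^ 2 := by
    intro k
    have h := expect_mul_left (flipAt k) fun ε => max (N ε - N (flipAt k * ε)) 0 ^ 2
    simp only [flipAt_mul_flipAt_mul] at h
    have hpt : 𝔼 ε, (N ε - N (flipAt k * ε)) ^ 2 = 𝔼 ε, (max (N ε - N (flipAt k * ε)) 0 ^ 2 +
        max (N (flipAt k * ε) - N ε) 0 ^ 2) := by
      refine expect_congr rfl fun ε _ => ?_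
      rcases le_total (N ε) (N (flipAt k * ε)) with hle | hle
      · rw [max_eq_right (sub_nonpos.2 hle), max_eq_left (sub_nonneg.2 hle)]; ring
      · rw [max_eq_left (sub_nonneg.2 hle), max_eq_right (sub_nonpos.2 hle)]; ring
    rw [hpt, expect_add_distrib, h]
    ring
  have hpt : ∀ ε, ∑ k, max (N ε - N (flipAt k * ε)) 0 ^ 2 ≤ 4 := by
    intro ε
    obtain ⟨φ, hφ, hφv⟩ := exists_dual_vector'' ℝ (signedSum f ε)
    have hk : ∀ k, max (N ε - N (flipAt k * ε)) 0 ^ 2 ≤ 4 * φ (f k) ^ 2 := by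
      intro k
      have h1 : N ε - N (flipAt k * ε) ≤ 2 * signReal (ε k) * φ (f k) := by
        have h2 : φ (signedSum f (flipAt k * ε)) ≤ N (flipAt k * ε) :=
          (Real.le_norm_self _).trans ((φ.le_of_opNorm_le hφ _).trans_eq (one_mul _))
        rw [signedSum_flipAt, map_sub, hφv, map_smul, smul_eq_mul] at h2
        simp only [RCLike.ofReal_real_eq_id, id] at h2
        simp only [hN] at h2 ⊢
        linarith
      have h3 : max (N ε - N (flipAt k * ε)) 0 ≤ |2 * signReal (ε k) * φ (f k)| :=
        max_le (h1.trans (le_abs_self _)) (abs_nonneg _)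
      calc max (N ε - N (flipAt k * ε)) 0 ^ 2 ≤ |2 * signReal (ε k) * φ (f k)| ^ 2 :=
            pow_le_pow_left₀ (le_max_right _ _) h3 2
        _ = 4 * φ (f k) ^ 2 := by
            rw [sq_abs]; linear_combination 4 * φ (f k) ^ 2 * signReal_sq (ε k)
    calc ∑ k, max (N ε - N (flipAt k * ε)) 0 ^ 2 ≤ ∑ k, 4 * φ (f k) ^ 2 :=
          sum_le_sum fun k _ => hk k
      _ = 4 * ∑ k, φ (f k) ^ 2 := by rw [mul_sum]
      _ ≤ 4 := by linarith [hf.sum_sq_le hφ]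
  have hP := expect_sq_sub_sq_expect_le N
  have hsum : ∑ k, 𝔼 ε, (N ε - N (flipAt k * ε)) ^ 2 ≤ 8 := by
    simp only [hsplit]
    rw [← mul_sum, ← expect_sum_comm]
    have := expect_le (s := univ) (f := fun ε => ∑ k, max (N ε - N (flipAt k * ε)) 0 ^ 2)
      univ_nonempty fun ε _ => hpt ε
    linarith
  have hvar : 𝔼 ε, (N ε - rademacherMean f) ^ 2 = 𝔼 ε, N ε ^ 2 - (𝔼 ε, N ε) ^ 2 := by
    have hM : rademacherMean f = 𝔼 ε, N ε := rfl
    have : 𝔼 ε, (N ε - rademacherMean f) ^ 2 =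
        𝔼 ε, (N ε ^ 2 - 2 * rademacherMean f * N ε + rademacherMean f ^ 2) :=
      expect_congr rfl fun ε _ => by ring
    rw [this, expect_add_distrib, expect_sub_distrib, ← mul_expect, ← hM, Fintype.expect_const]
    ring
  change 𝔼 ε, (N ε - rademacherMean f) ^ 2 ≤ 2
  linarith

lemma rademacherMean_reindex (e : ι ≃ κ) (f : κ → Y) :
    rademacherMean (f ∘ e) = rademacherMean f := by
  refine Fintype.expect_equiv (e.arrowCongr (Equiv.refl ℤˣ)) _ _ fun ε => ?_
  congr 1
  refine Fintype.sum_equiv e _ _ fun i => ?_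
  simp

/-- Multiplying the signs of each column by a common sign does not change the mean. -/
lemma rademacherMean_scaledCopies (θ : ι → ℝ) (f : κ → Y) :
    rademacherMean (scaledCopies θ f) =
      𝔼 ε : ι × κ → ℤˣ, rademacherMean fun k => columnSum θ ε k • f k := by
  have h : ∀ (η : κ → ℤˣ) (ε : ι × κ → ℤˣ),
      signedSum (fun k => columnSum θ ε k • f k) η =
        signedSum (scaledCopies θ f) ((fun p => η p.2) * ε) := by
    intro η ε
    rw [signedSum_scaledCopies]
    refine sum_congr rfl fun k _ => ?_
    rw [smul_smul, columnSum, columnSum, mul_sum]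
    congr 1
    refine sum_congr rfl fun i _ => ?_
    rw [Pi.mul_apply, signReal_mul]
    ring
  simp only [rademacherMean, h]
  rw [expect_comm]
  simp only [expect_mul_left _ fun ε => ‖signedSum (scaledCopies θ f) ε‖]
  rw [Fintype.expect_const]

lemma rademacherMean_abs_smul (c : κ → ℝ) (f : κ → Y) :
    rademacherMean (fun k => |c k| • f k) = rademacherMean fun k => c k • f k := by
  choose δ hδ using fun k => exists_eq_signReal_mul_abs (c k)
  have h : ∀ η, signedSum (fun k => c k • f k) η = signedSum (fun k => |c k| • f k) (δ * η) := by
    intro η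
    refine sum_congr rfl fun k _ => ?_
    rw [Pi.mul_apply, signReal_mul, smul_smul, smul_smul]
    congr 1
    linear_combination signReal (η k) * hδ k
  simp only [rademacherMean, h]
  exact (expect_mul_left δ fun η => ‖signedSum (fun k => |c k| • f k) η‖).symm

lemma expect_column (g : (ι → ℤˣ) → ℝ) (k : κ) :
    𝔼 ε : ι × κ → ℤˣ, g (fun i => ε (i, k)) = 𝔼 δ, g δ := by
  have h : ∀ δ : ι → ℤˣ, 𝔼 ε : ι × κ → ℤˣ, g (δ * fun i => ε (i, k)) =
      𝔼 ε : ι × κ → ℤˣ, g (fun i => ε (i, k)) := fun δ =>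
    expect_mul_left (fun p : ι × κ => δ p.1) fun ε => g (fun i => ε (i, k))
  calc 𝔼 ε : ι × κ → ℤˣ, g (fun i => ε (i, k))
      = 𝔼 δ : ι → ℤˣ, 𝔼 ε : ι × κ → ℤˣ, g (δ * fun i => ε (i, k)) := by
        simp only [h]; rw [Fintype.expect_const]
    _ = 𝔼 ε : ι × κ → ℤˣ, 𝔼 δ : ι → ℤˣ, g (δ * fun i => ε (i, k)) := expect_comm _ _ _
    _ = 𝔼 δ, g δ := by
        simp only [expect_mul_right]; rw [Fintype.expect_const]

lemma rademacherMean_scaledCopies_ge {θ : ι → ℝ} (hθ : ∑ i, θ i ^ 2 = 1) (f : κ → Y) :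
    1 / 2 * rademacherMean f ≤ rademacherMean (scaledCopies θ f) := by
  set c := 𝔼 δ : ι → ℤˣ, |∑ i, θ i * signReal (δ i)| with hc
  have hcol : ∀ k : κ, 𝔼 ε : ι × κ → ℤˣ, |columnSum θ ε k| = c := fun k =>
    expect_column (fun δ => |∑ i, θ i * signReal (δ i)|) k
  have hM : 0 ≤ rademacherMean f := expect_nonneg fun ε _ => norm_nonneg _
  have key : ∀ η : κ → ℤˣ, c * ‖signedSum f η‖ ≤
      𝔼 ε : ι × κ → ℤˣ, ‖signedSum (fun k => |columnSum θ ε k| • f k) η‖ := by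
    intro η
    obtain ⟨φ, hφ, hφv⟩ := exists_dual_vector'' ℝ (signedSum f η)
    simp only [RCLike.ofReal_real_eq_id, id] at hφv
    have h1 : c * ‖signedSum f η‖ =
        𝔼 ε : ι × κ → ℤˣ, φ (signedSum (fun k => |columnSum θ ε k| • f k) η) := by
      rw [← hφv]
      simp only [signedSum, map_sum, map_smul, smul_eq_mul]
      rw [expect_sum_comm, mul_sum]
      refine sum_congr rfl fun k _ => ?_
      rw [← mul_expect, ← expect_mul, hcol]
      ring
    rw [h1]
    exact expect_le_expect fun ε _ =>
      (Real.le_norm_self _).trans ((φ.le_of_opNorm_le hφ _).trans_eq (one_mul _))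
  calc 1 / 2 * rademacherMean f ≤ c * rademacherMean f :=
        mul_le_mul_of_nonneg_right (le_expect_abs_sum_signReal θ hθ) hM
    _ = 𝔼 η : κ → ℤˣ, c * ‖signedSum f η‖ := mul_expect _ _ _
    _ ≤ 𝔼 η : κ → ℤˣ, 𝔼 ε : ι × κ → ℤˣ,
          ‖signedSum (fun k => |columnSum θ ε k| • f k) η‖ := expect_le_expect fun η _ => key η
    _ = 𝔼 ε : ι × κ → ℤˣ, rademacherMean fun k => |columnSum θ ε k| • f k := expect_comm _ _ _
    _ = rademacherMean (scaledCopies θ f) := by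
        simp only [rademacherMean_abs_smul, rademacherMean_scaledCopies]

lemma rademacherMean_scaledCopies_le {θ : ι → ℝ} (hθ : ∑ i, θ i ^ 2 = 1) (f : κ → Y) :
    rademacherMean (scaledCopies θ f) ≤ ∑ k, ‖f k‖ := by
  calc rademacherMean (scaledCopies θ f)
      ≤ 𝔼 ε : ι × κ → ℤˣ, ∑ k, |columnSum θ ε k| * ‖f k‖ := by
        refine expect_le_expect fun ε _ => ?_
        rw [signedSum_scaledCopies]
        refine (norm_sum_le _ _).trans (sum_le_sum fun k _ => ?_)
        rw [norm_smul, Real.norm_eq_abs]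
    _ = ∑ k, (𝔼 δ : ι → ℤˣ, |∑ i, θ i * signReal (δ i)|) * ‖f k‖ := by
        rw [expect_sum_comm]
        refine sum_congr rfl fun k _ => ?_
        rw [← expect_mul]
        congr 1
        exact expect_column (fun δ => |∑ i, θ i * signReal (δ i)|) k
    _ ≤ ∑ k, ‖f k‖ := sum_le_sum fun k _ =>
        mul_le_of_le_one_left (norm_nonneg _) (expect_abs_sum_signReal_le θ hθ)

/-- Enough copies of a long system of vectors bounded below have large Rademacher means. -/
lemma exists_le_rademacherMean_scaledCopies (C : ℝ) : ∃ m k : ℕ, ∃ θ : Fin k → ℝ,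
    ∑ i, θ i ^ 2 = 1 ∧ ∀ f : Fin m → Y, (∀ j, 1 / 3 ≤ ‖f j‖) →
      C ≤ rademacherMean (scaledCopies θ f) := by
  obtain ⟨k, hk⟩ := exists_nat_ge (max 1 ((6 * C) ^ 2))
  have hk1 : (1 : ℝ) ≤ k := (le_max_left _ _).trans hk
  have hk0 : (0 : ℝ) < k := by linarith
  have hkC : 6 * C ≤ √k := Real.le_sqrt_of_sq_le ((le_max_right _ _).trans hk)
  set q : ℕ := Fintype.card (Fin k → ℤˣ) with hq
  have hq0 : 0 < q := Fintype.card_pos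
  have hlt : ((q - 1 : ℕ) : ℝ) / q < 1 := by
    rw [div_lt_one (by exact_mod_cast hq0)]
    exact_mod_cast Nat.sub_lt hq0 one_pos
  obtain ⟨m, hm⟩ := exists_pow_lt_of_lt_one (show (0 : ℝ) < 1 / 2 by norm_num) hlt
  refine ⟨m, k, fun _ => (√k)⁻¹, ?_, fun f hf => ?_⟩
  · simp only [inv_pow, Real.sq_sqrt hk0.le, sum_const, card_univ, Fintype.card_fin, nsmul_eq_mul]
    exact mul_inv_cancel₀ hk0.ne'
  classical
  set bad : Finset (Fin k × Fin m → ℤˣ) := univ.filter fun ε => ∀ j, (fun i => ε (i, j)) ≠ 1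
  have hbad : #bad ≤ (q - 1) ^ m := by
    calc #bad ≤ #(Fintype.piFinset fun _ : Fin m => (univ : Finset (Fin k → ℤˣ)).erase 1) := by
          refine card_le_card_of_injOn (fun ε j i => ε (i, j)) (fun ε hε => ?_) ?_
          · have hε' : ∀ j, (fun i => ε (i, j)) ≠ 1 := by simpa [bad] using hε
            simpa using hε'
          · intro ε _ ε' _ h
            exact funext fun ⟨i, j⟩ => congrFun (congrFun h j) i
      _ = (q - 1) ^ m := by
          rw [Fintype.card_piFinset_const, card_erase_of_mem (mem_univ _), card_univ]
  have hcard : Fintype.card (Fin k × Fin m → ℤˣ) = q ^ m := by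
    simp [hq, pow_mul]
  have hE : 𝔼 ε : Fin k × Fin m → ℤˣ, (if ε ∈ bad then (1 : ℝ) else 0) ≤ 1 / 2 := by
    rw [Fintype.expect_eq_sum_div_card, sum_ite_mem, univ_inter, sum_const, nsmul_eq_mul, mul_one,
      hcard]
    refine le_trans ?_ hm.le
    rw [div_pow]
    push_cast
    gcongr
    exact_mod_cast hbad
  have hpt : ∀ ε : Fin k × Fin m → ℤˣ, √k / 3 * (1 - if ε ∈ bad then (1 : ℝ) else 0) ≤
      rademacherMean fun j => columnSum (fun _ => (√k)⁻¹) ε j • f j := by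
    intro ε
    split_ifs with h
    · rw [sub_self, mul_zero]
      exact expect_nonneg fun _ _ => norm_nonneg _
    · obtain ⟨j, hj⟩ : ∃ j, (fun i => ε (i, j)) = 1 := by simpa [bad] using h
      refine le_trans ?_ (norm_le_rademacherMean _ j)
      have hcol : columnSum (fun _ => (√k)⁻¹) ε j = √k := by
        have hj' : ∀ i, ε (i, j) = 1 := congrFun hj
        simp only [columnSum, hj', signReal_one, mul_one, sum_const, card_univ, Fintype.card_fin,
          nsmul_eq_mul]
        rw [← div_eq_mul_inv, Real.div_sqrt]
      rw [hcol, norm_smul, Real.norm_eq_abs, abs_of_nonneg (Real.sqrt_nonneg _)]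
      have := mul_le_mul_of_nonneg_left (hf j) (Real.sqrt_nonneg (k : ℝ))
      linarith
  calc C ≤ √k / 3 * (1 - 1 / 2) := by linarith
    _ ≤ √k / 3 * (1 - 𝔼 ε : Fin k × Fin m → ℤˣ, (if ε ∈ bad then (1 : ℝ) else 0)) := by gcongr
    _ = 𝔼 ε : Fin k × Fin m → ℤˣ, √k / 3 * (1 - if ε ∈ bad then (1 : ℝ) else 0) := by
        rw [← mul_expect, expect_sub_distrib, Fintype.expect_const]
    _ ≤ rademacherMean (scaledCopies (fun _ => (√k)⁻¹) f) := by
        rw [rademacherMean_scaledCopies]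
        exact expect_le_expect fun ε _ => hpt ε

end VectorRademacherMeans

section Dvoretzky

open Finset
open scoped BigOperators

variable {E Y : Type*} [NormedAddCommGroup E] [NormedSpace ℝ E] [NormedAddCommGroup Y]
  [NormedSpace ℝ Y]

lemma scaledCopies_scaledCopies {ι κ τ : Type*} (v : τ → ℝ) (θ : ι → ℝ) (f : κ → Y) :
    scaledCopies v (scaledCopies θ f) =
      scaledCopies (fun p : τ × ι => v p.1 * θ p.2) f ∘ (Equiv.prodAssoc τ ι κ).symm := by
  funext p
  simp [scaledCopies, smul_smul]

lemma sum_sq_prod_eq_one {ι τ : Type*} [Fintype ι] [Fintype τ] {v : τ → ℝ} {θ : ι → ℝ}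
    (hv : ∑ j, v j ^ 2 = 1) (hθ : ∑ i, θ i ^ 2 = 1) :
    ∑ p : τ × ι, (v p.1 * θ p.2) ^ 2 = 1 := by
  simp only [mul_pow]
  rw [Fintype.sum_prod_type]
  simp only [← mul_sum, hθ, mul_one, hv]

/-- Among the systems of copies of `f` there is one whose mean cannot be doubled by taking
further copies. -/
lemma exists_almost_maximal_copies {κ ι₀ : Type} [Fintype κ] [DecidableEq κ] [Fintype ι₀]
    [DecidableEq ι₀] (f : κ → Y) {C : ℝ} (hC : 0 < C) {θ₀ : ι₀ → ℝ}
    (hθ₀ : ∑ i, θ₀ i ^ 2 = 1) (hle : C ≤ rademacherMean (scaledCopies θ₀ f)) :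
    ∃ (ι : Type) (_ : Fintype ι) (_ : DecidableEq ι) (θ : ι → ℝ), ∑ i, θ i ^ 2 = 1 ∧
      C / 2 ≤ rademacherMean (scaledCopies θ f) ∧
      ∀ (τ : Type) [Fintype τ] [DecidableEq τ] (v : τ → ℝ), ∑ j, v j ^ 2 = 1 →
        rademacherMean (scaledCopies v (scaledCopies θ f)) ≤
          2 * rademacherMean (scaledCopies θ f) := by
  set S : Set ℝ := {r | ∃ (ι : Type) (_ : Fintype ι) (_ : DecidableEq ι) (θ : ι → ℝ),
    ∑ i, θ i ^ 2 = 1 ∧ r = rademacherMean (scaledCopies θ f)} with hS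
  have hbdd : BddAbove S := by
    refine ⟨∑ k, ‖f k‖, ?_⟩
    rintro r ⟨ι, _, _, θ, hθ, rfl⟩
    exact rademacherMean_scaledCopies_le hθ f
  have hmem : rademacherMean (scaledCopies θ₀ f) ∈ S := ⟨ι₀, _, _, θ₀, hθ₀, rfl⟩
  have hCS : C ≤ sSup S := hle.trans (le_csSup hbdd hmem)
  obtain ⟨r, ⟨ι, i₁, i₂, θ, hθ, rfl⟩, hr⟩ :=
    exists_lt_of_lt_csSup ⟨_, hmem⟩ (half_lt_self (hC.trans_le hCS))
  refine ⟨ι, i₁, i₂, θ, hθ, by linarith, fun τ _ _ v hv => ?_⟩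
  rw [scaledCopies_scaledCopies, rademacherMean_reindex]
  have : rademacherMean (scaledCopies (fun p : τ × ι => v p.1 * θ p.2) f) ≤ sSup S :=
    le_csSup hbdd ⟨τ × ι, _, _, _, sum_sq_prod_eq_one hv hθ, rfl⟩
  linarith

/-- One choice of signs works simultaneously for finitely many systems of copies. -/
lemma exists_signs_near_mean {κ τ : Type*} [Fintype κ] [DecidableEq κ] [Fintype τ]
    [DecidableEq τ] {f : κ → Y} (hf : WeaklyTwoSummable f) (s : Finset (τ → ℝ))
    (hs : ∀ v ∈ s, ∑ j, v j ^ 2 = 1) {t : ℝ} (ht : 0 ≤ t) (hst : 2 * (#s : ℝ) ≤ t ^ 2) :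
    ∃ ε : τ × κ → ℤˣ, ∀ v ∈ s,
      |‖signedSum (scaledCopies v f) ε‖ - rademacherMean (scaledCopies v f)| ≤ t := by
  have hE : 𝔼 ε : τ × κ → ℤˣ,
      ∑ v ∈ s, (‖signedSum (scaledCopies v f) ε‖ - rademacherMean (scaledCopies v f)) ^ 2 ≤
        t ^ 2 := by
    rw [expect_sum_comm]
    refine (sum_le_card_nsmul _ _ 2 fun v hv => (hf.scaledCopies (hs v hv)).variance_le).trans ?_
    rw [nsmul_eq_mul]
    linarith
  obtain ⟨ε, -, hε⟩ := exists_le_of_expect_le (univ_nonempty)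
    (hE.trans_eq (Fintype.expect_const (ι := τ × κ → ℤˣ) (t ^ 2)).symm)
  refine ⟨ε, fun v hv => abs_le_of_sq_le_sq ?_ ht⟩
  exact (single_le_sum
    (f := fun v => (‖signedSum (scaledCopies v f) ε‖ - rademacherMean (scaledCopies v f)) ^ 2)
    (fun v _ => sq_nonneg _) hv).trans (hε.trans_eq (Fintype.expect_const _))

lemma norm_bounds_of_net (T : E →L[ℝ] Y) {s : Set E}
    (hs : ∀ x : E, ‖x‖ = 1 → ∃ v ∈ s, ‖x - v‖ ≤ 1 / 18) {M : ℝ} (hM : 0 ≤ M)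
    (h : ∀ v ∈ s, 3 / 8 * M ≤ ‖T v‖ ∧ ‖T v‖ ≤ 17 / 8 * M) (x : E) :
    M / 4 * ‖x‖ ≤ ‖T x‖ ∧ ‖T x‖ ≤ 9 / 4 * M * ‖x‖ := by
  have hT : ‖T‖ ≤ 17 / 8 * M + ‖T‖ / 18 := by
    refine T.opNorm_le_of_unit_norm (by positivity) fun x hx => ?_
    obtain ⟨v, hv, hxv⟩ := hs x hx
    calc ‖T x‖ = ‖T v + T (x - v)‖ := by rw [map_sub]; congr 1; abel
      _ ≤ ‖T v‖ + ‖T‖ * ‖x - v‖ := (norm_add_le _ _).trans (by gcongr; exact T.le_opNorm _)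
      _ ≤ 17 / 8 * M + ‖T‖ * (1 / 18) := by gcongr; exact (h v hv).2
      _ = _ := by ring
  have hT' : ‖T‖ ≤ 9 / 4 * M := by linarith
  refine ⟨?_, T.le_of_opNorm_le hT' x⟩
  rcases eq_or_ne x 0 with rfl | hx
  · simp
  have hx0 : 0 < ‖x‖ := norm_pos_iff.2 hx
  have hu : M / 4 ≤ ‖T (‖x‖⁻¹ • x)‖ := by
    obtain ⟨v, hv, hxv⟩ := hs (‖x‖⁻¹ • x) (by
      rw [norm_smul, norm_inv, norm_norm, inv_mul_cancel₀ hx0.ne'])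
    have h1 : ‖T v‖ ≤ ‖T (‖x‖⁻¹ • x)‖ + ‖T‖ * ‖‖x‖⁻¹ • x - v‖ := by
      calc ‖T v‖ = ‖T (‖x‖⁻¹ • x) - T (‖x‖⁻¹ • x - v)‖ := by rw [map_sub]; congr 1; abel
        _ ≤ _ := (norm_sub_le _ _).trans (by gcongr; exact T.le_opNorm _)
    have h2 : ‖T‖ * ‖‖x‖⁻¹ • x - v‖ ≤ 9 / 4 * M * (1 / 18) := by gcongr
    linarith [(h v hv).1]
  rw [map_smul, norm_smul, norm_inv, norm_norm, inv_mul_eq_div, le_div_iff₀ hx0] at hu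
  exact hu

lemma exists_finset_net_sphere (E : Type*) [NormedAddCommGroup E] [NormedSpace ℝ E]
    [FiniteDimensional ℝ E] {δ : ℝ} (hδ : 0 < δ) :
    ∃ s : Finset E, (∀ v ∈ s, ‖v‖ = 1) ∧ ∀ x : E, ‖x‖ = 1 → ∃ v ∈ s, ‖x - v‖ ≤ δ := by
  have : ProperSpace E := FiniteDimensional.proper ℝ E
  obtain ⟨t, hts, htf, hcov⟩ := (isCompact_sphere (0 : E) 1).finite_cover_balls hδ
  refine ⟨htf.toFinset, fun v hv => by simpa using hts (htf.mem_toFinset.1 hv), fun x hx => ?_⟩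
  obtain ⟨v, hv, hxv⟩ := Set.mem_iUnion₂.1 (hcov (mem_sphere_zero_iff_norm.2 hx))
  exact ⟨v, htf.mem_toFinset.2 hv, by rw [← dist_eq_norm]; exact (Metric.mem_ball.1 hxv).le⟩

/-- A form of **Dvoretzky's theorem**. -/
lemma exists_euclidean_embedding_s6
    (h : ∀ m : ℕ, ∃ f : Fin m → Y, WeaklyTwoSummable f ∧ ∀ i, 1 / 3 ≤ ‖f i‖)
    (τ : Type) [Fintype τ] :
    ∃ T : EuclideanSpace ℝ τ →ₗ[ℝ] Y, ∀ x, ‖x‖ ≤ ‖T x‖ ∧ ‖T x‖ ≤ 9 * ‖x‖ := by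
  classical
  obtain ⟨s, hs1, hs⟩ := exists_finset_net_sphere (EuclideanSpace ℝ τ)
    (show (0 : ℝ) < 1 / 18 by norm_num)
  set C : ℝ := 32 * (#s + 1) with hC
  have hC1 : 0 < C := by positivity
  obtain ⟨m, k, θ₀, hθ₀, hle⟩ := exists_le_rademacherMean_scaledCopies (Y := Y) C
  obtain ⟨f₀, hf₀, hf₀'⟩ := h m
  obtain ⟨ι, _, _, θ, hθ, hM, hmax⟩ :=
    exists_almost_maximal_copies f₀ hC1 hθ₀ (hle f₀ hf₀')
  set f := scaledCopies θ f₀ with hf_def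
  have hf : WeaklyTwoSummable f := hf₀.scaledCopies hθ
  set M := rademacherMean f with hM_def
  have hM0 : 0 < M := by linarith
  have hunit : ∀ v ∈ s, ∑ j, v j ^ 2 = 1 := fun v hv => by
    rw [← EuclideanSpace.real_norm_sq_eq, hs1 v hv, one_pow]
  obtain ⟨ε, hε⟩ := exists_signs_near_mean hf (s.image fun v : EuclideanSpace ℝ τ => (v : τ → ℝ))
    (by simpa using hunit) (t := M / 8) (by positivity) (by
      have h1 : (#(s.image fun v : EuclideanSpace ℝ τ => (v : τ → ℝ)) : ℝ) ≤ #s := by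
        exact_mod_cast card_image_le
      have h2 : 2 * ((#s : ℝ) + 1) ≤ M / 8 := by linarith
      have h0 : (0 : ℝ) ≤ #s := by positivity
      nlinarith)
  let T₀ : EuclideanSpace ℝ τ →ₗ[ℝ] Y :=
    { toFun := fun x => signedSum (scaledCopies (x : τ → ℝ) f) ε
      map_add' := fun x y => by
        simp only [signedSum, scaledCopies, PiLp.add_apply, add_smul, smul_add, sum_add_distrib]
      map_smul' := fun c x => by
        simp only [signedSum, scaledCopies, PiLp.smul_apply, smul_sum, RingHom.id_apply,
          smul_smul, smul_eq_mul]
        exact sum_congr rfl fun p _ => by congr 1; ring }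
  have hnet : ∀ v ∈ (s : Set (EuclideanSpace ℝ τ)),
      3 / 8 * M ≤ ‖LinearMap.toContinuousLinearMap T₀ v‖ ∧
        ‖LinearMap.toContinuousLinearMap T₀ v‖ ≤ 17 / 8 * M := by
    intro v hv
    have h1 := abs_le.1 (hε _ (mem_image_of_mem _ hv))
    have h2 := rademacherMean_scaledCopies_ge (hunit v hv) f
    have h3 := hmax τ _ (hunit v hv)
    change 3 / 8 * M ≤ ‖signedSum (scaledCopies (v : τ → ℝ) f) ε‖ ∧
      ‖signedSum (scaledCopies (v : τ → ℝ) f) ε‖ ≤ 17 / 8 * M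
    constructor <;> linarith [h1.1, h1.2]
  refine ⟨(4 / M) • T₀, fun x => ?_⟩
  obtain ⟨h1, h2⟩ := norm_bounds_of_net _ hs hM0.le hnet x
  rw [LinearMap.coe_toContinuousLinearMap'] at h1 h2
  rw [LinearMap.smul_apply, norm_smul, Real.norm_of_nonneg (by positivity)]
  constructor
  · calc ‖x‖ = 4 / M * (M / 4 * ‖x‖) := by field_simp
      _ ≤ _ := by gcongr
  · calc 4 / M * ‖T₀ x‖ ≤ 4 / M * (9 / 4 * M * ‖x‖) := by gcongr
      _ = 9 * ‖x‖ := by field_simp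

end Dvoretzky

section DvoretzkyRogers

open Finset Filter Topology

variable {V W Y : Type*} [NormedAddCommGroup Y] [NormedSpace ℝ Y]

lemma LinearMap.exists_one_lt_det [AddCommGroup V] [Module ℝ V] [FiniteDimensional ℝ V]
    (B : V →ₗ[ℝ] V) (hB : 0 < LinearMap.trace ℝ V B) :
    ∃ t : ℝ, 0 < t ∧ t ≤ 1 ∧ 1 < LinearMap.det (1 + t • B) := by
  let b := Module.finBasis ℝ V
  set A := LinearMap.toMatrix b b B with hA
  set q := (Matrix.det (1 + (Polynomial.X : Polynomial ℝ) • A.map Polynomial.C)).divX.divX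
  have hdet : ∀ t : ℝ, LinearMap.det (1 + t • B) = 1 + t * (A.trace + q.eval t * t) := by
    intro t
    rw [← LinearMap.det_toMatrix b, map_add, map_smul, LinearMap.toMatrix_one,
      Matrix.det_one_add_smul]
    ring
  have htr : 0 < A.trace := by rwa [hA, ← LinearMap.trace_eq_matrix_trace]
  have hlim : Tendsto (fun t : ℝ => A.trace + q.eval t * t) (𝓝[>] 0) (𝓝 A.trace) := by
    have : Continuous fun t : ℝ => A.trace + q.eval t * t := by fun_prop
    simpa using (this.tendsto 0).mono_left nhdsWithin_le_nhds
  obtain ⟨t, h1, ht0, ht1⟩ := ((hlim.eventually_const_lt htr).and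
    (Ioc_mem_nhdsGT (show (0 : ℝ) < 1 by norm_num))).exists
  exact ⟨t, ht0, ht1, by rw [hdet]; nlinarith⟩

variable [NormedAddCommGroup V] [InnerProductSpace ℝ V] [FiniteDimensional ℝ V]

/-- An operator of maximal determinant among those for which `L ∘ u` is a contraction. -/
lemma exists_det_maximal (L : V →L[ℝ] Y) (hL : Function.Injective L) :
    ∃ u : V →L[ℝ] V, (∀ x, ‖L (u x)‖ ≤ ‖x‖) ∧ 0 < u.det ∧
      ∀ w : V →L[ℝ] V, (∀ x, ‖L (w x)‖ ≤ ‖x‖) → w.det ≤ u.det := by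
  obtain ⟨c, hc0, hc⟩ := (L : V →ₗ[ℝ] Y).exists_antilipschitzWith (LinearMap.ker_eq_bot.2 hL)
  set K : Set (V →L[ℝ] V) := {u | ∀ x, ‖L (u x)‖ ≤ ‖x‖} with hK
  have hclosed : IsClosed K := by
    rw [hK, Set.ofPred_forall]
    exact isClosed_iInter fun x => isClosed_le (by fun_prop) continuous_const
  have hbdd : Bornology.IsBounded K := by
    refine (Metric.isBounded_closedBall (x := (0 : V →L[ℝ] V)) (r := c)).subset fun u hu => ?_
    rw [mem_closedBall_zero_iff]
    refine u.opNorm_le_bound c.2 fun x => ?_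
    have h1 := hc.le_mul_dist (u x) 0
    rw [dist_zero_right, map_zero, dist_zero_right] at h1
    exact h1.trans (mul_le_mul_of_nonneg_left (hu x) c.2)
  have : ProperSpace (V →L[ℝ] V) := FiniteDimensional.proper ℝ _
  have hcomp : IsCompact K := Metric.isCompact_of_isClosed_isBounded hclosed hbdd
  set r : ℝ := (‖L‖ + 1)⁻¹ with hr
  have hr0 : 0 < r := by positivity
  have hmem : r • ContinuousLinearMap.id ℝ V ∈ K := by
    intro x
    have h1 : ‖L x‖ ≤ (‖L‖ + 1) * ‖x‖ := (L.le_opNorm x).trans (by gcongr; linarith)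
    rw [smul_apply, ContinuousLinearMap.id_apply, map_smul, norm_smul,
      Real.norm_of_nonneg hr0.le, hr, inv_mul_le_iff₀ (by positivity)]
    exact h1
  obtain ⟨u, hu, hmax⟩ := hcomp.exists_isMaxOn ⟨_, hmem⟩
    ContinuousLinearMap.continuous_det.continuousOn
  refine ⟨u, hu, lt_of_lt_of_le ?_ (hmax hmem), fun w hw => hmax hw⟩
  have : (r • ContinuousLinearMap.id ℝ V).det = r ^ Module.finrank ℝ V := by
    rw [ContinuousLinearMap.det]
    simp
  change 0 < (r • ContinuousLinearMap.id ℝ V).det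
  rw [this]
  positivity

lemma exists_norm_ge_of_det_maximal {L : V →L[ℝ] Y} {u : V →L[ℝ] V}
    (hu : ∀ x, ‖L (u x)‖ ≤ ‖x‖) (hdet : 0 < u.det)
    (hmax : ∀ w : V →L[ℝ] V, (∀ x, ‖L (w x)‖ ≤ ‖x‖) → w.det ≤ u.det)
    (W : Submodule ℝ V) (hW : Module.finrank ℝ V < 3 * Module.finrank ℝ W) :
    ∃ w ∈ W, ‖w‖ = 1 ∧ 1 / 3 ≤ ‖L (u w)‖ := by
  by_contra! hcon
  have hsmall : ∀ w ∈ W, ‖L (u w)‖ ≤ 1 / 3 * ‖w‖ := by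
    intro w hw
    rcases eq_or_ne w 0 with rfl | hw0
    · simp
    have hn : 0 < ‖w‖ := norm_pos_iff.2 hw0
    have h1 := hcon (‖w‖⁻¹ • w) (W.smul_mem _ hw) (by
      rw [norm_smul, norm_inv, norm_norm, inv_mul_cancel₀ hn.ne'])
    rw [map_smul, map_smul, norm_smul, norm_inv, norm_norm, inv_mul_lt_iff₀ hn] at h1
    linarith
  set P := W.starProjection with hP
  have hPproj : LinearMap.IsProj W (P : V →ₗ[ℝ] V) :=
    ⟨fun x => W.starProjection_apply_mem x, fun x hx => W.starProjection_eq_self_iff.2 hx⟩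
  set B : V →L[ℝ] V := (3 : ℝ) • P - 1 with hB
  have htr : 0 < LinearMap.trace ℝ V (B : V →ₗ[ℝ] V) := by
    have h1 : (B : V →ₗ[ℝ] V) = (3 : ℝ) • (P : V →ₗ[ℝ] V) - 1 := rfl
    rw [h1, map_sub, map_smul, hPproj.trace, LinearMap.trace_one, smul_eq_mul, sub_pos]
    exact_mod_cast hW
  obtain ⟨t, ht0, ht1, ht⟩ := (B : V →ₗ[ℝ] V).exists_one_lt_det htr
  have hmem : ∀ x, ‖L ((u ∘L (1 + t • B)) x)‖ ≤ ‖x‖ := by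
    intro x
    have hx : L ((u ∘L (1 + t • B)) x) = (1 - t) • L (u x) + (3 * t) • L (u (P x)) := by
      have : (1 + t • B) x = (1 - t) • x + (3 * t) • P x := by
        simp only [hB, add_apply, smul_apply,
          sub_apply, one_apply_eq_self]
        module
      rw [ContinuousLinearMap.comp_apply, this]
      simp only [map_add, map_smul]
    have hPx : ‖P x‖ ≤ ‖x‖ := W.norm_starProjection_apply_le x
    calc ‖L ((u ∘L (1 + t • B)) x)‖ ≤ (1 - t) * ‖L (u x)‖ + (3 * t) * ‖L (u (P x))‖ := by
          rw [hx]
          refine (norm_add_le _ _).trans_eq ?_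
          rw [norm_smul, norm_smul, Real.norm_of_nonneg (by linarith),
            Real.norm_of_nonneg (by linarith)]
      _ ≤ (1 - t) * ‖x‖ + (3 * t) * (1 / 3 * ‖x‖) := by
          have h1 := hu x
          have h2 := (hsmall _ (hPproj.map_mem x)).trans
            (mul_le_mul_of_nonneg_left hPx (by norm_num))
          have h3 : 0 ≤ 1 - t := by linarith
          gcongr
          exact h2
      _ = ‖x‖ := by ring
  have h1 := hmax _ hmem
  have h2 : (u ∘L (1 + t • B)).det =
      u.det * LinearMap.det (1 + t • (B : V →ₗ[ℝ] V)) := by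
    rw [ContinuousLinearMap.det, ContinuousLinearMap.toLinearMap_comp, LinearMap.det_comp]
    rfl
  rw [h2] at h1
  nlinarith

lemma exists_orthonormal_norm_ge {L : V →L[ℝ] Y} {u : V →L[ℝ] V} {m : ℕ}
    (hV : Module.finrank ℝ V = 2 * m) (hu : ∀ x, ‖L (u x)‖ ≤ ‖x‖) (hdet : 0 < u.det)
    (hmax : ∀ w : V →L[ℝ] V, (∀ x, ‖L (w x)‖ ≤ ‖x‖) → w.det ≤ u.det) (j : ℕ) (hj : j ≤ m) :
    ∃ e : Fin j → V, Orthonormal ℝ e ∧ ∀ i, 1 / 3 ≤ ‖L (u (e i))‖ := by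
  induction j with
  | zero => exact ⟨Fin.elim0, by simp [Orthonormal, Pairwise], fun i => i.elim0⟩
  | succ j ih =>
    obtain ⟨e, he, he'⟩ := ih (by omega)
    have hfin : Module.finrank ℝ V <
        3 * Module.finrank ℝ (Submodule.span ℝ (Set.range e))ᗮ := by
      have h1 := (Submodule.span ℝ (Set.range e)).finrank_add_finrank_orthogonal
      rw [finrank_span_eq_card he.linearIndependent, Fintype.card_fin] at h1
      omega
    obtain ⟨w, hw, hw1, hw'⟩ := exists_norm_ge_of_det_maximal hu hdet hmax _ hfin
    have horth : ∀ i, inner ℝ (e i) w = 0 := fun i =>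
      (Submodule.mem_orthogonal _ _).1 hw _ (Submodule.subset_span ⟨i, rfl⟩)
    refine ⟨Fin.cons w e, ⟨?_, ?_⟩, ?_⟩
    · exact Fin.cases hw1 he.1
    · intro a b
      refine Fin.cases ?_ (fun a => ?_) a <;> refine Fin.cases ?_ (fun b => ?_) b
      · simp
      · intro _
        simpa [real_inner_comm] using horth b
      · intro _
        simpa using horth a
      · intro hab
        simpa using he.2 (fun h => hab (by rw [h]))
    · exact Fin.cases hw' he'

lemma exists_injective_of_infinite_dimensional [AddCommGroup W] [Module ℝ W]
    [FiniteDimensional ℝ W] (hY : ¬ FiniteDimensional ℝ Y) :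
    ∃ L : W →ₗ[ℝ] Y, Function.Injective L := by
  have hrank : ((Module.finrank ℝ W : ℕ) : Cardinal) ≤ Module.rank ℝ Y :=
    (Cardinal.natCast_lt_aleph0).le.trans (not_lt.1 fun h => hY (Module.rank_lt_aleph0_iff.1 h))
  obtain ⟨y, hy⟩ := exists_linearIndependent_of_le_rank hrank
  exact ⟨(Module.finBasis ℝ W).constr ℝ y, Module.Basis.injective_constr_of_linearIndependent _ hy⟩

/-- A form of the **Dvoretzky–Rogers lemma**. -/
lemma exists_weaklyTwoSummable (hY : ¬ FiniteDimensional ℝ Y) (m : ℕ) :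
    ∃ f : Fin m → Y, WeaklyTwoSummable f ∧ ∀ i, 1 / 3 ≤ ‖f i‖ := by
  obtain ⟨L₀, hL₀⟩ := exists_injective_of_infinite_dimensional
    (W := EuclideanSpace ℝ (Fin (2 * m))) hY
  obtain ⟨u, hu, hdet, hmax⟩ := exists_det_maximal (LinearMap.toContinuousLinearMap L₀) hL₀
  obtain ⟨e, he, he'⟩ :=
    exists_orthonormal_norm_ge finrank_euclideanSpace_fin hu hdet hmax m le_rfl
  refine ⟨fun i => LinearMap.toContinuousLinearMap L₀ (u (e i)), fun a => ?_, he'⟩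
  have h2 : ‖∑ k, a k • e k‖ ^ 2 = ∑ k, a k ^ 2 := by
    rw [← real_inner_self_eq_norm_sq, he.inner_sum]
    simp [pow_two]
  simp only [← map_smul, ← map_sum]
  rw [← h2]
  exact pow_le_pow_left₀ (norm_nonneg _) (hu _) 2

end DvoretzkyRogers

section EuclideanDistance

variable {V : Type*} [NormedAddCommGroup V] [NormedSpace ℝ V]

/-- The normed space `V` has a linear map into a finite-dimensional Euclidean space which
distorts norms by at most a factor `d`. -/
def EuclideanDistanceLE (V : Type*) [NormedAddCommGroup V] [NormedSpace ℝ V] (d : ℝ) : Prop :=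
  ∃ (ι : Type) (_ : Fintype ι) (J : V →ₗ[ℝ] EuclideanSpace ℝ ι),
    ∀ x, ‖J x‖ ≤ ‖x‖ ∧ ‖x‖ ≤ d * ‖J x‖

lemma EuclideanDistanceLE.mono {d d' : ℝ} (h : EuclideanDistanceLE V d) (hd : d ≤ d') :
    EuclideanDistanceLE V d' := by
  obtain ⟨ι, _, J, hJ⟩ := h
  exact ⟨ι, _, J, fun x => ⟨(hJ x).1, (hJ x).2.trans (by gcongr)⟩⟩

lemma exists_euclideanDistanceLE (V : Type*) [NormedAddCommGroup V] [NormedSpace ℝ V]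
    [FiniteDimensional ℝ V] : ∃ d, 0 ≤ d ∧ EuclideanDistanceLE V d := by
  let e := toEuclidean (E := V)
  set r : ℝ := ‖(e : V →L[ℝ] EuclideanSpace ℝ (Fin (Module.finrank ℝ V)))‖ + 1 with hr
  have hr0 : 0 < r := by positivity
  refine ⟨‖(e.symm : EuclideanSpace ℝ (Fin (Module.finrank ℝ V)) →L[ℝ] V)‖ * r,
    by positivity, _, inferInstance,
    r⁻¹ • (e : V →ₗ[ℝ] EuclideanSpace ℝ (Fin (Module.finrank ℝ V))), fun x => ?_⟩
  have hJ : ‖(r⁻¹ • (e : V →ₗ[ℝ] EuclideanSpace ℝ (Fin (Module.finrank ℝ V)))) x‖ =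
      r⁻¹ * ‖e x‖ := by
    rw [LinearMap.smul_apply, norm_smul, Real.norm_of_nonneg (by positivity)]
    rfl
  rw [hJ]
  constructor
  · rw [inv_mul_le_iff₀ hr0]
    exact (e.toContinuousLinearMap.le_opNorm x).trans (by gcongr; linarith)
  · calc ‖x‖ = ‖e.symm (e x)‖ := by rw [e.symm_apply_apply]
      _ ≤ ‖(e.symm : EuclideanSpace ℝ (Fin (Module.finrank ℝ V)) →L[ℝ] V)‖ * ‖e x‖ :=
        e.symm.toContinuousLinearMap.le_opNorm (e x)
      _ = _ := by field_simp

/-- The `ℓ²`-combination of two maps into Euclidean spaces. -/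
lemma exists_euclidean_sum {E : Type*} [AddCommGroup E] [Module ℝ E] {ι κ : Type} [Fintype ι]
    [Fintype κ] (J : E →ₗ[ℝ] EuclideanSpace ℝ ι) (K : E →ₗ[ℝ] EuclideanSpace ℝ κ) :
    ∃ S : E →ₗ[ℝ] EuclideanSpace ℝ (ι ⊕ κ), ∀ x, ‖S x‖ ^ 2 = ‖J x‖ ^ 2 + ‖K x‖ ^ 2 := by
  refine ⟨{ toFun := fun x => WithLp.toLp 2 (Sum.elim (J x) (K x))
            map_add' := fun x y => ?_
            map_smul' := fun c x => ?_ }, fun x => ?_⟩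
  · ext (i | i) <;> simp
  · ext (i | i) <;> simp
  · simp [EuclideanSpace.real_norm_sq_eq]

lemma not_finiteDimensional_ker {E : Submodule ℝ V} [FiniteDimensional ℝ E]
    (hV : ¬ FiniteDimensional ℝ V) {P : V →ₗ[ℝ] V} (hP : LinearMap.IsProj E P) :
    ¬ FiniteDimensional ℝ (LinearMap.ker P) := by
  intro h
  refine hV (Module.finite_def.2 ?_)
  have htop : E ⊔ LinearMap.ker P = ⊤ := by
    refine eq_top_iff.2 fun x _ => Submodule.mem_sup.2 ⟨P x, hP.map_mem x, x - P x, ?_, by abel⟩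
    rw [LinearMap.mem_ker, map_sub, hP.map_id _ (hP.map_mem x), sub_self]
  rw [← htop]
  exact Submodule.FG.sup (Module.Finite.iff_fg.1 inferInstance) (Module.Finite.iff_fg.1 h)

/-- Projecting onto the graph of a nearly isometric copy of `J` inside the kernel of a projection
improves the Euclidean distance of `E`. -/
lemma EuclideanDistanceLE.improve {c : ℝ} (hc : 1 ≤ c) (hV : ¬ FiniteDimensional ℝ V)
    (hU : ∀ E : Submodule ℝ V, FiniteDimensional ℝ E →
      ∃ P : V →L[ℝ] V, LinearMap.IsProj E P ∧ ‖P‖ ≤ c)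
    (E : Submodule ℝ V) [FiniteDimensional ℝ E] {d : ℝ} (hd : 0 ≤ d)
    (hE : EuclideanDistanceLE E d) :
    EuclideanDistanceLE E (d / 2 + 54 * c ^ 3 * (1 + c)) := by
  obtain ⟨ι, _, J, hJ⟩ := hE
  obtain ⟨P, hP, hPc⟩ := hU E inferInstance
  have hP' : LinearMap.IsProj E (P : V →ₗ[ℝ] V) := ⟨hP.map_mem, hP.map_id⟩
  obtain ⟨T₀, hT₀⟩ := exists_euclidean_embedding_s6
    (exists_weaklyTwoSummable (not_finiteDimensional_ker hV hP')) ι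
  set t : ℝ := 3 * c * (1 + c) with ht
  have ht0 : 0 < t := by positivity
  let T : E →ₗ[ℝ] V := t • ((LinearMap.ker (P : V →ₗ[ℝ] V)).subtype ∘ₗ T₀ ∘ₗ J)
  have hPT : ∀ x, P (T x) = 0 := fun x => by
    have : P (T₀ (J x) : V) = 0 := (T₀ (J x)).2
    simp [T, this]
  have hTnorm : ∀ x, ‖T x‖ = t * ‖T₀ (J x)‖ := fun x => by
    simp [T, norm_smul, abs_of_pos ht0]
  obtain ⟨R, hR, hRc⟩ := hU (LinearMap.range (E.subtype + T)) inferInstance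
  let A : E →ₗ[ℝ] E := (hP'.codRestrict ∘ₗ (R : V →ₗ[ℝ] V)) ∘ₗ E.subtype
  have hA : ∀ x, (A x : V) = P (R x) := fun x => rfl
  have hPE : ∀ x : E, P x = x := fun x => hP.map_id x x.2
  have hRx : ∀ x : E, R x = A x + T (A x) := by
    intro x
    obtain ⟨y, hy⟩ := hR.map_mem (x : V)
    have hy' : R x = y + T y := hy.symm
    have : A x = y := Subtype.ext (by rw [hA, hy', map_add, hPT, hPE, add_zero])
    rw [this, hy']
  have hdecomp : ∀ x : E, (x : V) = A x + P (R (T x)) := by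
    intro x
    have h1 : R (x + T x) = x + T x := hR.map_id _ ⟨x, rfl⟩
    calc (x : V) = P (x + T x) := by rw [map_add, hPT, hPE, add_zero]
      _ = P (R (x + T x)) := by rw [h1]
      _ = _ := by rw [map_add, map_add, hA]
  have hbd : ∀ v, ‖P v‖ ≤ c * ‖v‖ ∧ ‖R v‖ ≤ c * ‖v‖ := fun v =>
    ⟨P.le_of_opNorm_le hPc v, R.le_of_opNorm_le hRc v⟩
  have hJA : ∀ x, 3 * ‖J (A x)‖ ≤ ‖x‖ := by
    intro x
    have h1 : T (A x) = R x - P (R x) := by rw [← hA, hRx]; abel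
    have h2 : t * ‖J (A x)‖ ≤ c * (1 + c) * ‖x‖ := by
      calc t * ‖J (A x)‖ ≤ ‖T (A x)‖ := by rw [hTnorm]; gcongr; exact (hT₀ _).1
        _ ≤ ‖R x‖ + c * ‖R x‖ := by
            rw [h1]; exact (norm_sub_le _ _).trans (by gcongr; exact (hbd _).1)
        _ = (1 + c) * ‖R x‖ := by ring
        _ ≤ (1 + c) * (c * ‖(x : V)‖) := by gcongr; exact (hbd _).2
        _ = c * (1 + c) * ‖x‖ := by rw [Submodule.coe_norm]; ring
    have h3 : 0 < c * (1 + c) := by positivity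
    refine le_of_mul_le_mul_left ?_ h3
    calc c * (1 + c) * (3 * ‖J (A x)‖) = t * ‖J (A x)‖ := by rw [ht]; ring
      _ ≤ _ := h2
  have hx : ∀ x, ‖x‖ ≤ d * ‖J (A x)‖ + 27 * c ^ 3 * (1 + c) * ‖J x‖ := by
    intro x
    calc ‖x‖ = ‖(A x : V) + P (R (T x))‖ := by rw [← hdecomp, Submodule.coe_norm]
      _ ≤ ‖A x‖ + c * (c * ‖T x‖) := by
          refine (norm_add_le _ _).trans ?_
          gcongr
          · exact le_rfl
          · exact (hbd _).1.trans (by gcongr; exact (hbd _).2)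
      _ ≤ d * ‖J (A x)‖ + c * (c * (t * (9 * ‖J x‖))) := by
          rw [hTnorm]
          gcongr
          · exact (hJ _).2
          · exact (hT₀ _).2
      _ = _ := by rw [ht]; ring
  obtain ⟨S, hS⟩ := exists_euclidean_sum J ((3 : ℝ) • (J ∘ₗ A))
  have hs2 : √2 ^ 2 = 2 := Real.sq_sqrt (by norm_num)
  have hs0 : 0 < √2 := by positivity
  refine ⟨ι ⊕ ι, inferInstance, (√2)⁻¹ • S, fun x => ?_⟩
  set n := ‖((√2)⁻¹ • S) x‖ with hn
  have hn0 : 0 ≤ n := norm_nonneg _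
  have hnsq : 2 * n ^ 2 = ‖J x‖ ^ 2 + (3 * ‖J (A x)‖) ^ 2 := by
    have h1 := hS x
    rw [LinearMap.smul_apply, norm_smul, Real.norm_of_nonneg (by norm_num : (0 : ℝ) ≤ 3)] at h1
    rw [LinearMap.comp_apply] at h1
    rw [← h1, hn, LinearMap.smul_apply, norm_smul, norm_inv, Real.norm_of_nonneg hs0.le, mul_pow,
      inv_pow, hs2]
    ring
  have h1 : ‖J x‖ ≤ 3 / 2 * n := by
    refine abs_le_of_sq_le_sq' ?_ (by positivity) |>.2
    nlinarith [sq_nonneg (3 * ‖J (A x)‖)]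
  have h2 : 3 * ‖J (A x)‖ ≤ 3 / 2 * n := by
    refine abs_le_of_sq_le_sq' ?_ (by positivity) |>.2
    nlinarith [sq_nonneg ‖J x‖]
  constructor
  · refine abs_le_of_sq_le_sq' ?_ (norm_nonneg _) |>.2
    have h3 := pow_le_pow_left₀ (norm_nonneg _) (hJ x).1 2
    have h4 := pow_le_pow_left₀ (by positivity) (hJA x) 2
    linarith
  · calc ‖x‖ ≤ d * ‖J (A x)‖ + 27 * c ^ 3 * (1 + c) * ‖J x‖ := hx x
      _ ≤ d * (1 / 2 * n) + 27 * c ^ 3 * (1 + c) * (2 * n) := by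
          gcongr
          · linarith
          · linarith
      _ = _ := by ring

lemma exists_uniform_euclideanDistanceLE (hV : ¬ FiniteDimensional ℝ V)
    (hU : UniformlyComplemented (⊤ : Submodule ℝ V)) :
    ∃ d, 0 < d ∧ ∀ E : Submodule ℝ V, FiniteDimensional ℝ E → EuclideanDistanceLE E d := by
  obtain ⟨c₀, hc₀⟩ := hU
  set c := max c₀ 1
  have hc : 1 ≤ c := le_max_right _ _
  have hU : ∀ E : Submodule ℝ V, FiniteDimensional ℝ E →
      ∃ P : V →L[ℝ] V, LinearMap.IsProj E P ∧ ‖P‖ ≤ c := fun E hE => by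
    obtain ⟨P, hP, hPc⟩ := hc₀ E hE le_top
    exact ⟨P, hP, hPc.trans (le_max_left _ _)⟩
  set B : ℝ := 54 * c ^ 3 * (1 + c) with hB
  have hB0 : 0 < B := by positivity
  refine ⟨1 + 2 * B, by positivity, fun E hE => ?_⟩
  obtain ⟨d, hd, hdE⟩ := exists_euclideanDistanceLE E
  have hiter : ∀ n : ℕ, EuclideanDistanceLE E (d * (1 / 2) ^ n + 2 * B) := by
    intro n
    induction n with
    | zero => exact hdE.mono (by linarith [pow_zero (1 / 2 : ℝ)])
    | succ n ih =>
      refine (ih.improve hc hV hU E (by positivity)).mono (le_of_eq ?_)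
      rw [pow_succ, hB]
      ring
  obtain ⟨n, hn⟩ := exists_pow_lt_of_lt_one (show (0 : ℝ) < 1 / (d + 1) by positivity)
    (show (1 / 2 : ℝ) < 1 by norm_num)
  refine (hiter n).mono ?_
  have : d * (1 / 2) ^ n ≤ 1 := by
    calc d * (1 / 2) ^ n ≤ (d + 1) * (1 / (d + 1)) := by gcongr; linarith
      _ = 1 := by field_simp
  linarith

end EuclideanDistance

section LocalToGlobal

open Filter Topology

variable {V : Type*} [NormedAddCommGroup V] [NormedSpace ℝ V]

/-- Uniformly Euclidean finite-dimensional subspaces force an equivalent inner product. -/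
lemma isomorphicToHilbert_of_euclideanDistanceLE {d : ℝ} (hd : 0 < d)
    (h : ∀ E : Submodule ℝ V, FiniteDimensional ℝ E → EuclideanDistanceLE E d) :
    IsomorphicToHilbert V := by
  classical
  choose ι _ J hJ using fun s : Finset V => h (Submodule.span ℝ (s : Set V)) inferInstance
  let B : Finset V → V → V → ℝ := fun s x y =>
    if hxy : x ∈ Submodule.span ℝ (s : Set V) ∧ y ∈ Submodule.span ℝ (s : Set V) then
      inner ℝ (J s ⟨x, hxy.1⟩) (J s ⟨y, hxy.2⟩) else 0
  have hB : ∀ {s : Finset V} {x y : V} (hx : x ∈ Submodule.span ℝ (s : Set V))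
      (hy : y ∈ Submodule.span ℝ (s : Set V)), B s x y = inner ℝ (J s ⟨x, hx⟩) (J s ⟨y, hy⟩) :=
    fun hx hy => dif_pos ⟨hx, hy⟩
  have hBbd : ∀ s x y, B s x y ∈ Set.Icc (-(‖x‖ * ‖y‖)) (‖x‖ * ‖y‖) := by
    intro s x y
    rw [Set.mem_Icc, ← abs_le]
    by_cases hxy : x ∈ Submodule.span ℝ (s : Set V) ∧ y ∈ Submodule.span ℝ (s : Set V)
    · rw [hB hxy.1 hxy.2]
      refine (abs_real_inner_le_norm _ _).trans ?_
      exact mul_le_mul (hJ s _).1 (hJ s _).1 (norm_nonneg _) (norm_nonneg _)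
    · rw [show B s x y = 0 from dif_neg hxy, abs_zero]
      positivity
  let U : Ultrafilter (Finset V) := Ultrafilter.of atTop
  have hU : (U : Filter (Finset V)) ≤ atTop := Ultrafilter.of_le _
  have hmem : ∀ x : V, ∀ᶠ s : Finset V in U, x ∈ Submodule.span ℝ (s : Set V) := fun x =>
    hU ((eventually_ge_atTop {x}).mono fun s hs => Submodule.subset_span (hs (by simp)))
  have hlim : ∀ x y, ∃ r, Tendsto (fun s => B s x y) U (𝓝 r) := by
    intro x y
    obtain ⟨r, -, hr⟩ := isCompact_Icc.ultrafilter_le_nhds (U.map fun s => B s x y)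
      (le_principal_iff.2 (Ultrafilter.mem_map.2 (univ_mem' fun s => hBbd s x y)))
    exact ⟨r, hr⟩
  choose f hf using hlim
  have hlow : ∀ x, (d ^ 2)⁻¹ * ‖x‖ ^ 2 ≤ f x x := by
    intro x
    refine ge_of_tendsto (hf x x) ((hmem x).mono fun s hx => ?_)
    rw [hB hx hx, real_inner_self_eq_norm_sq, inv_mul_le_iff₀ (by positivity), ← mul_pow]
    exact pow_le_pow_left₀ (norm_nonneg _) (hJ s ⟨x, hx⟩).2 2
  refine ⟨f, ⟨fun x y => ?_, fun a x y => ?_, fun x y z => ?_, fun x hx => ?_⟩,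
    (d ^ 2)⁻¹, 1, by positivity, one_pos, fun x => ⟨hlow x, ?_⟩⟩
  · refine tendsto_nhds_unique_of_eventuallyEq (hf x y) (hf y x) ?_
    filter_upwards [hmem x, hmem y] with s hx hy
    rw [hB hx hy, hB hy hx, real_inner_comm]
  · refine tendsto_nhds_unique_of_eventuallyEq (hf (a • x) y) ((hf x y).const_mul a) ?_
    filter_upwards [hmem x, hmem y] with s hx hy
    rw [hB (Submodule.smul_mem _ a hx) hy, hB hx hy, ← real_inner_smul_left, ← map_smul]
    rfl
  · refine tendsto_nhds_unique_of_eventuallyEq (hf (x + y) z) ((hf x z).add (hf y z)) ?_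
    filter_upwards [hmem x, hmem y, hmem z] with s hx hy hz
    rw [hB (Submodule.add_mem _ hx hy) hz, hB hx hz, hB hy hz, ← inner_add_left, ← map_add]
    rfl
  · have := norm_pos_iff.2 hx
    exact lt_of_lt_of_le (by positivity) (hlow x)
  · refine le_of_tendsto (hf x x) (Eventually.of_forall fun s => (hBbd s x x).2.trans_eq ?_)
    ring

lemma exists_isProj_of_quotient_right_inverse {M : Submodule ℝ V} [IsClosed (M : Set V)]
    {ψ : (V ⧸ M) →L[ℝ] V} (hψ : ∀ u : V ⧸ M, Submodule.Quotient.mk (ψ u) = u) :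
    ∃ P : V →L[ℝ] V, LinearMap.IsProj M P := by
  refine ⟨ContinuousLinearMap.id ℝ V - ψ ∘L M.mkQL, fun x => ?_, fun x hx => ?_⟩
  · rw [← Submodule.Quotient.mk_eq_zero]
    change Submodule.Quotient.mk (x - ψ (Submodule.Quotient.mk x)) = _
    rw [Submodule.Quotient.mk_sub, hψ, sub_self]
  · change x - ψ (Submodule.Quotient.mk x) = x
    rw [(Submodule.Quotient.mk_eq_zero M).2 hx, map_zero, sub_zero]

end LocalToGlobal

/-- Theorem 3.A.10: if for every closed subspace `M` of the real Banach space `X` the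
quotient map `X → X/M` admits a continuous linear right inverse, then `X` is isomorphic
to a Hilbert space. -/
theorem linear_right_inverse_of_quotient_map_implies_hilbert [CompleteSpace X]
    (h : ∀ (M : Submodule ℝ X) [IsClosed (M : Set X)],
      ∃ ψ : (X ⧸ M) →L[ℝ] X, ∀ u : X ⧸ M, Submodule.Quotient.mk (ψ u) = u) :
    IsomorphicToHilbert X := by
  have hU : UniformlyComplemented (⊤ : Submodule ℝ X) :=
    uniformlyComplemented_of_forall_closed fun M hM =>
      have := hM
      exists_isProj_of_quotient_right_inverse (h M).choose_spec
  by_cases hX : FiniteDimensional ℝ X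
  · obtain ⟨d, hd, ι, _, J, hJ⟩ := exists_euclideanDistanceLE X
    refine isomorphicToHilbert_of_euclideanDistanceLE (d := d + 1) (by positivity) fun E _ => ?_
    exact EuclideanDistanceLE.mono ⟨ι, _, J ∘ₗ E.subtype, fun x => hJ x⟩ (by linarith)
  · obtain ⟨d, hd, hE⟩ := exists_uniform_euclideanDistanceLE hX hU
    exact isomorphicToHilbert_of_euclideanDistanceLE hd hE
end
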